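/- arXiv:math/0411525 — 8 statements merged into one kernel-verified Lean document; each statement's English description precedes it below -/
import Mathlib

section
/- Let λ > 0 and let f : ℕ → [0,1]. Then for every j ∈ ℕ, |U_o f(j)| ≤ min(1, 1.4·λ^{-1/2}). -/
/-- The Poisson expectation `E_o f = Σ_{k=0}^∞ e^{-λ} λ^k f(k)/k!`. -/
noncomputable def steinEo (lam : ℝ) (f : ℕ → ℝ) : ℝ :=
  ∑' k : ℕ, Real.exp (-lam) * lam ^ k * f k / (Nat.factorial k)

/-- The Stein "inverse" operator: `U_o f(0) = 0` and for `j ≥ 1`,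
`U_o f(j) = ((j-1)!/λ^j) Σ_{k=0}^{j-1} (λ^k/k!)(f(k) - E_o f)`. -/
noncomputable def steinUo (lam : ℝ) (f : ℕ → ℝ) : ℕ → ℝ
  | 0 => 0
  | (j + 1) =>
      ((Nat.factorial j : ℝ) / lam ^ (j + 1)) *
        ∑ k ∈ Finset.range (j + 1), (lam ^ k / (Nat.factorial k : ℝ)) * (f k - steinEo lam f)

theorem aux_pmf_bound (lam : ℝ) (hlam : 0 < lam) (k : ℕ) :
    lam * (Real.exp (-lam) * lam ^ k / (Nat.factorial k)) ^ 2 ≤ 0.49 := by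
  rcases Nat.eq_zero_or_pos k with rfl | hk
  · have h1 := Real.add_one_le_exp lam
    have h2 : Real.exp (-lam) * Real.exp lam = 1 := by rw [← Real.exp_add]; simp
    have h3 : 0 < Real.exp (-lam) := Real.exp_pos _
    have h4 : Real.exp (-lam) * (lam + 1) ≤ 1 := by nlinarith
    have h5 : (Real.exp (-lam) * (lam + 1)) ^ 2 ≤ 1 := by
      have : 0 ≤ Real.exp (-lam) * (lam + 1) := by positivity
      nlinarith
    have h6 : 0 ≤ (Real.exp (-lam) * (lam - 1)) ^ 2 := sq_nonneg _
    simp only [pow_zero, Nat.factorial_zero, Nat.cast_one, mul_one, div_one]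
    nlinarith
  · have hk' : (1 : ℝ) ≤ k := by exact_mod_cast hk
    have hst := Stirling.le_log_factorial_stirling (n := k) hk.ne'
    have hfp : (0 : ℝ) < (Nat.factorial k : ℝ) := by exact_mod_cast Nat.factorial_pos k
    have hpos : 0 < lam * (Real.exp (-lam) * lam ^ k / (Nat.factorial k)) ^ 2 := by positivity
    have hlog : Real.log (lam * (Real.exp (-lam) * lam ^ k / (Nat.factorial k)) ^ 2)
        = Real.log lam + 2 * (-lam + k * Real.log lam - Real.log (Nat.factorial k)) := by
      rw [Real.log_mul (by positivity) (by positivity), Real.log_pow,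
        Real.log_div (by positivity) (by positivity), Real.log_mul (by positivity) (by positivity),
        Real.log_exp, Real.log_pow]
      push_cast; ring
    have e1 : Real.log lam ≤ Real.log (k + 1/2) + (lam / (k + 1/2) - 1) := by
      have := Real.log_le_sub_one_of_pos (show 0 < lam / ((k : ℝ) + 1/2) by positivity)
      rw [Real.log_div (by positivity) (by positivity)] at this
      linarith
    have e2 : Real.log (k + 1/2) ≤ Real.log k + 1 / (2 * k) := by
      have := Real.log_le_sub_one_of_pos (show 0 < ((k : ℝ) + 1/2) / k by positivity)
      rw [Real.log_div (by positivity) (by positivity)] at this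
      have h : ((k : ℝ) + 1/2) / k - 1 = 1 / (2 * k) := by field_simp; ring
      linarith
    have e3 : (2 * (k : ℝ) + 1) * Real.log lam
        ≤ (2 * k + 1) * (Real.log k + 1 / (2 * k) + (lam / (k + 1/2) - 1)) :=
      mul_le_mul_of_nonneg_left (by linarith) (by positivity)
    have e4 : (2 * (k : ℝ) + 1) * (Real.log k + 1 / (2 * k) + (lam / (k + 1/2) - 1))
        = (2 * k + 1) * Real.log k + 1 + 1 / (2 * k) + 2 * lam - 2 * k - 1 := by
      field_simp; ring
    have e5 : 1 / (2 * (k : ℝ)) ≤ 1 := by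
      rw [div_le_one (by positivity)]; linarith
    have e6 : Real.log (lam * (Real.exp (-lam) * lam ^ k / (Nat.factorial k)) ^ 2)
        ≤ 1 - Real.log (2 * Real.pi) := by
      rw [hlog]; linarith
    have e7 := (Real.log_le_iff_le_exp hpos).1 e6
    refine e7.trans ?_
    rw [Real.exp_sub, Real.exp_log (by positivity), div_le_iff₀ (by positivity)]
    have := Real.exp_one_lt_d9
    have := Real.pi_gt_d2
    norm_num at *
    linarith

theorem aux_sum_sq (x : ℕ → ℝ) (M : ℝ) (hx : ∀ i, 0 ≤ x i) (hM : ∀ i, x i ≤ M) (n : ℕ) :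
    (∑ i ∈ Finset.range n, x i) ^ 2 ≤ 2 * M * ∑ i ∈ Finset.range n, ((i : ℝ) + 1/2) * x i := by
  induction n with
  | zero => simp
  | succ n ih =>
    rw [Finset.sum_range_succ, Finset.sum_range_succ]
    have h : ∑ i ∈ Finset.range n, x i ≤ n * M := by
      have := Finset.sum_le_sum (s := Finset.range n) (fun i _ => hM i)
      simpa using this
    have := mul_le_mul_of_nonneg_right h (hx n)
    have := mul_le_mul_of_nonneg_right (hM n) (hx n)
    nlinarith

theorem aux_sum_half (x : ℕ → ℝ) (hx : ∀ i, 0 ≤ x i) (n : ℕ) :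
    ∑ i ∈ Finset.range n, x i ≤ 2 * ∑ i ∈ Finset.range n, ((i : ℝ) + 1/2) * x i := by
  rw [Finset.mul_sum]
  refine Finset.sum_le_sum fun i _ => ?_
  have : 0 ≤ (i : ℝ) * x i := mul_nonneg (by positivity) (hx i)
  linarith

theorem aux_core (lam : ℝ) (hlam : 0 < lam) (p : ℕ → ℝ) (hp : ∀ k, 0 ≤ p k)
    (hrec : ∀ k : ℕ, ((k : ℝ) + 1) * p (k + 1) = lam * p k) (hsum : HasSum p 1) (M : ℝ)
    (hM : ∀ k, p k ≤ M) (j : ℕ) (F : ℝ) (hF : F = ∑ k ∈ Finset.range (j + 1), p k) :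
    F * (1 - F) ≤ lam * p j ∧ F * (1 - F) ≤ 2 * M * (lam * p j) := by
  have hM0 : 0 ≤ M := (hp 0).trans (hM 0)
  have hF0 : 0 ≤ F := by rw [hF]; exact Finset.sum_nonneg fun i _ => hp i
  have hF1 : F ≤ 1 := by rw [hF]; exact sum_le_hasSum _ (fun i _ => hp i) hsum
  -- lower part
  have low : ∀ j : ℕ, ∑ k ∈ Finset.range (j + 1), (lam - k) * p k = lam * p j := by
    intro j
    induction j with
    | zero => simp
    | succ n ih =>
      rw [Finset.sum_range_succ, ih]
      have := hrec n
      push_cast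
      linarith
  have lowF : ∑ i ∈ Finset.range (j + 1), p (j - i) = F := by
    rw [hF, ← Finset.sum_range_reflect p]; simp
  have lowS : ∑ i ∈ Finset.range (j + 1), ((i : ℝ) + 1/2) * p (j - i)
      = lam * p j - (lam - j - 1/2) * F := by
    rw [← low j, hF, Finset.mul_sum, ← Finset.sum_sub_distrib,
      ← Finset.sum_range_reflect (fun k : ℕ => (lam - k) * p k - (lam - j - 1/2) * p k)]
    refine Finset.sum_congr rfl fun i hi => ?_
    have hi' : i ≤ j := by simp at hi; omega
    have h : j + 1 - 1 - i = j - i := by omega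
    rw [h, Nat.cast_sub hi']
    ring
  have L1 := aux_sum_sq (fun i => p (j - i)) M (fun i => hp _) (fun i => hM _) (j + 1)
  have L2 := aux_sum_half (fun i => p (j - i)) (fun i => hp _) (j + 1)
  simp only [lowF, lowS] at L1 L2
  -- upper part
  have upS : ∀ n : ℕ, ∑ i ∈ Finset.range n, ((i : ℝ) + 1/2) * p (j + 1 + i)
      = lam * p j - lam * p (j + n)
        + (lam - j - 1/2) * ∑ i ∈ Finset.range n, p (j + 1 + i) := by
    intro n
    induction n with
    | zero => simp
    | succ n ih =>
      rw [Finset.sum_range_succ, Finset.sum_range_succ, ih]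
      have := hrec (j + n)
      have h : j + 1 + n = j + n + 1 := by omega
      have h' : j + (n + 1) = j + n + 1 := by omega
      rw [h, h']
      push_cast at this
      linarith
  have tl : Filter.Tendsto (fun n => ∑ i ∈ Finset.range n, p (j + 1 + i)) Filter.atTop
      (nhds (1 - F)) := by
    have := (hasSum_nat_add_iff' (j + 1)).2 hsum
    rw [← hF] at this
    simpa [add_comm] using this.tendsto_sum_nat
  have U1 : (1 - F) ^ 2 ≤ 2 * M * (lam * p j + (lam - j - 1/2) * (1 - F)) := by
    refine le_of_tendsto_of_tendsto' (tl.pow 2)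
      (((tl.const_mul (lam - j - 1/2)).const_add (lam * p j)).const_mul (2 * M)) fun n => ?_
    have := aux_sum_sq (fun i => p (j + 1 + i)) M (fun i => hp _) (fun i => hM _) n
    rw [upS] at this
    refine this.trans ?_
    have := mul_nonneg hlam.le (hp (j + n))
    exact mul_le_mul_of_nonneg_left (by linarith) (by positivity)
  have U2 : (1 - F) ≤ 2 * (lam * p j + (lam - j - 1/2) * (1 - F)) := by
    refine le_of_tendsto_of_tendsto' tl
      (((tl.const_mul (lam - j - 1/2)).const_add (lam * p j)).const_mul 2) fun n => ?_
    have := aux_sum_half (fun i => p (j + 1 + i)) (fun i => hp _) n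
    rw [upS] at this
    have := mul_nonneg hlam.le (hp (j + n))
    linarith
  have hG : 0 ≤ 1 - F := by linarith
  constructor
  · have a := mul_le_mul_of_nonneg_left L2 hG
    have b := mul_le_mul_of_nonneg_left U2 hF0
    linarith
  · have a := mul_le_mul_of_nonneg_left L1 hG
    have b := mul_le_mul_of_nonneg_left U1 hF0
    linarith

theorem aux_abs (p : ℕ → ℝ) (hp : ∀ k, 0 ≤ p k) (hsum : HasSum p 1) (f : ℕ → ℝ)
    (hf : ∀ k, 0 ≤ f k ∧ f k ≤ 1) (j : ℕ) (F : ℝ) (hF : F = ∑ k ∈ Finset.range (j + 1), p k) :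
    |∑ k ∈ Finset.range (j + 1), p k * (f k - ∑' k, p k * f k)| ≤ F * (1 - F) := by
  have hF0 : 0 ≤ F := by rw [hF]; exact Finset.sum_nonneg fun i _ => hp i
  have hF1 : F ≤ 1 := by rw [hF]; exact sum_le_hasSum _ (fun i _ => hp i) hsum
  have hs : Summable fun k => p k * f k :=
    Summable.of_nonneg_of_le (fun k => mul_nonneg (hp k) (hf k).1)
      (fun k => mul_le_of_le_one_right (hp k) (hf k).2) hsum.summable
  have h1 := hs.sum_add_tsum_nat_add (j + 1)
  have h2 := (hasSum_nat_add_iff' (j + 1)).2 hsum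
  rw [← hF] at h2
  have hs' := (summable_nat_add_iff (j + 1)).2 hs
  have T0 : 0 ≤ ∑' i, p (i + (j + 1)) * f (i + (j + 1)) :=
    tsum_nonneg fun k => mul_nonneg (hp _) (hf _).1
  have T1 : ∑' i, p (i + (j + 1)) * f (i + (j + 1)) ≤ 1 - F := by
    rw [← h2.tsum_eq]
    exact hs'.tsum_le_tsum (fun k => mul_le_of_le_one_right (hp _) (hf _).2) h2.summable
  have H0 : 0 ≤ ∑ k ∈ Finset.range (j + 1), p k * f k :=
    Finset.sum_nonneg fun k _ => mul_nonneg (hp _) (hf _).1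
  have H1 : ∑ k ∈ Finset.range (j + 1), p k * f k ≤ F := by
    rw [hF]
    exact Finset.sum_le_sum fun k _ => mul_le_of_le_one_right (hp _) (hf _).2
  rw [← h1]
  simp only [mul_sub, Finset.sum_sub_distrib, ← Finset.sum_mul]
  rw [← hF]
  set H := ∑ k ∈ Finset.range (j + 1), p k * f k
  set T := ∑' i, p (i + (j + 1)) * f (i + (j + 1))
  have hG : 0 ≤ 1 - F := by linarith
  rw [abs_le]
  constructor
  · nlinarith [mul_nonneg hG H0, mul_le_mul_of_nonneg_left T1 hF0]
  · nlinarith [mul_le_mul_of_nonneg_left H1 hG, mul_nonneg hF0 T0]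

/-- For `λ > 0` and `f : ℕ → [0,1]`, `|U_o f(j)| ≤ min(1, 1.4 λ^{-1/2})` for all `j`. -/
theorem abs_steinUo_le (lam : ℝ) (hlam : 0 < lam) (f : ℕ → ℝ)
    (hf : ∀ k, 0 ≤ f k ∧ f k ≤ 1) (j : ℕ) :
    |steinUo lam f j| ≤ min 1 (1.4 / Real.sqrt lam) := by
  have hs := Real.sqrt_pos.2 hlam
  have hs2 := Real.mul_self_sqrt hlam.le
  cases j with
  | zero =>
    simp only [steinUo, abs_zero]
    exact le_min zero_le_one (by positivity)
  | succ j =>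
    set p : ℕ → ℝ := fun k => Real.exp (-lam) * lam ^ k / (Nat.factorial k) with hpdef
    have hfac : ∀ k : ℕ, (0 : ℝ) < (Nat.factorial k : ℝ) := fun k => by
      exact_mod_cast Nat.factorial_pos k
    have hpp : ∀ k, 0 < p k := fun k => by
      have := hfac k
      simp only [hpdef]; positivity
    have hrec : ∀ k : ℕ, ((k : ℝ) + 1) * p (k + 1) = lam * p k := by
      intro k
      have := hfac k
      simp only [hpdef, Nat.factorial_succ]
      push_cast
      field_simp
      ring
    have hsum : HasSum p 1 := by
      have := (NormedSpace.expSeries_div_hasSum_exp lam).mul_left (Real.exp (-lam))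
      rw [← Real.exp_eq_exp_ℝ, ← Real.exp_add, neg_add_cancel, Real.exp_zero] at this
      simpa only [hpdef, mul_div_assoc] using this
    have hM : ∀ k, p k ≤ 0.7 / Real.sqrt lam := by
      intro k
      rw [le_div_iff₀ hs]
      have h := aux_pmf_bound lam hlam k
      refine abs_le_of_sq_le_sq' ?_ (by norm_num) |>.2
      change lam * p k ^ 2 ≤ _ at h
      rw [mul_pow, Real.sq_sqrt hlam.le]
      norm_num at h ⊢
      linarith
    have hE : steinEo lam f = ∑' k, p k * f k := by
      simp only [steinEo, hpdef]
      exact tsum_congr fun k => by ring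
    have hU : steinUo lam f (j + 1)
        = (∑ k ∈ Finset.range (j + 1), p k * (f k - ∑' k, p k * f k)) / (lam * p j) := by
      simp only [steinUo, hE]
      rw [eq_div_iff (mul_pos hlam (hpp j)).ne', mul_right_comm, Finset.mul_sum]
      refine Finset.sum_congr rfl fun k _ => ?_
      have h1 := hfac j
      have h2 := hfac k
      rw [← mul_assoc]
      congr 1
      simp only [hpdef]
      field_simp
      ring
    obtain ⟨c1, c2⟩ := aux_core lam hlam p (fun k => (hpp k).le) hrec hsum _ hM j _ rfl
    have ha := aux_abs p (fun k => (hpp k).le) hsum f hf j _ rfl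
    have hlp := mul_pos hlam (hpp j)
    rw [hU, abs_div, abs_of_pos hlp]
    refine le_min ?_ ?_
    · rw [div_le_one hlp]; exact ha.trans c1
    · rw [div_le_iff₀ hlp]
      refine (ha.trans c2).trans (le_of_eq ?_)
      ring
end

section
/- Let λ > 0 and let f : ℕ → [0,1]. Then for every j ∈ ℕ, |U_o f(j+1) - U_o f(j)| ≤ (1 - e^{-λ})/λ. -/
theorem stein_core (l e w f S F T G J E U1 U0 : ℝ) (hl : 0 < l) (he : 0 < e) (hw : 0 < w)
    (hJ : 0 < J) (hf0 : 0 ≤ f) (hf1 : f ≤ 1) (hS0 : 0 ≤ S) (hT0 : 0 ≤ T)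
    (hF0 : 0 ≤ F) (hF1 : F ≤ S) (hG0 : 0 ≤ G) (hG1 : G ≤ T) (hE : e * E = F + w * f + G)
    (hST : e = S + w + T) (hT : J * T ≤ l * (w + T)) (hS : l * S ≤ J * (S + w - 1))
    (hU1 : U1 = 1 / (l * w) * (F + w * f - (S + w) * E))
    (hU0 : U0 = 1 / (J * w) * (F - S * E)) :
    |U1 - U0| ≤ (1 - 1 / e) / l := by
  have hE' : E = (F + w * f + G) / e := by field_simp; linarith
  have key : U1 - U0 = (F * (J * T - l * (w + T)) + w * f * (J * T + l * S)
      + G * (l * S - J * (S + w))) / (l * w * J * e) := by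
    rw [hU1, hU0, hE', hST]
    have : S + w + T ≠ 0 := by rw [← hST]; exact he.ne'
    field_simp
    ring
  have hP : 0 < l * w * J * e := by positivity
  have hB : J * T + l * S ≤ J * (e - 1) := by rw [hST]; nlinarith
  have hB' : w * (J * T + l * S) ≤ w * (J * (e - 1)) := by gcongr
  have hR : (1 - 1 / e) / l = (w * (J * (e - 1))) / (l * w * J * e) := by
    field_simp
  have hA : 0 ≤ l * (w + T) - J * T := by linarith
  have hC : 0 ≤ J * (S + w) - l * S := by nlinarith
  have hBn : 0 ≤ w * (J * T + l * S) := by positivity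
  have a1 := mul_nonneg hF0 hA
  have a2 := mul_nonneg (sub_nonneg.2 hF1) hA
  have c1 := mul_nonneg hG0 hC
  have c2 := mul_nonneg (sub_nonneg.2 hG1) hC
  have b1 := mul_nonneg hf0 hBn
  have b2 := mul_nonneg (sub_nonneg.2 hf1) hBn
  rw [key, hR, abs_div, abs_of_pos hP]
  gcongr
  rw [abs_le]
  constructor <;> nlinarith

/-- For `λ > 0` and `f : ℕ → [0,1]`, `|U_o f(j+1) - U_o f(j)| ≤ (1 - e^{-λ})/λ` for all `j`. -/
theorem abs_steinUo_succ_sub_le (lam : ℝ) (hlam : 0 < lam) (f : ℕ → ℝ)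
    (hf : ∀ k, 0 ≤ f k ∧ f k ≤ 1) (j : ℕ) :
    |steinUo lam f (j + 1) - steinUo lam f j| ≤ (1 - Real.exp (-lam)) / lam := by
  set w : ℕ → ℝ := fun k => lam ^ k / (Nat.factorial k : ℝ) with hwdef
  have hwpos : ∀ k, 0 < w k := fun k => by simp only [hwdef]; positivity
  have hws : ∀ k : ℕ, ((k : ℝ) + 1) * w (k + 1) = lam * w k := fun k => by
    simp only [hwdef, Nat.factorial_succ]; push_cast; field_simp; ring
  have hsum : HasSum w (Real.exp lam) := by
    rw [Real.exp_eq_exp_ℝ]; exact NormedSpace.expSeries_div_hasSum_exp lam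
  have hwf : Summable (fun k => w k * f k) :=
    Summable.of_nonneg_of_le (fun k => mul_nonneg (hwpos k).le (hf k).1)
      (fun k => mul_le_of_le_one_right (hwpos k).le (hf k).2) hsum.summable
  have hE : Real.exp lam * steinEo lam f = ∑' k, w k * f k := by
    unfold steinEo
    rw [← tsum_mul_left]
    congr 1; ext k
    simp only [hwdef, Real.exp_neg]
    field_simp
  have hU : ∀ n, steinUo lam f (n + 1) = 1 / (lam * w n) *
      (∑ k ∈ Finset.range (n + 1), w k * f k
        - (∑ k ∈ Finset.range (n + 1), w k) * steinEo lam f) := fun n => by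
    simp only [steinUo]
    rw [Finset.sum_mul, ← Finset.sum_sub_distrib]
    congr 1
    · simp only [hwdef]; field_simp; ring
    · exact Finset.sum_congr rfl fun k _ => by simp only [hwdef]; ring
  have hexp : Real.exp (-lam) = 1 / Real.exp lam := by rw [Real.exp_neg, one_div]
  have tS : ∀ n, Summable (fun k => w (k + n)) := fun n => (summable_nat_add_iff n).2 hsum.summable
  have tG : ∀ n, Summable (fun k => w (k + n) * f (k + n)) := fun n =>
    (summable_nat_add_iff (f := fun k => w k * f k) n).2 hwf
  have hST : ∀ n, Real.exp lam = ∑ k ∈ Finset.range n, w k + ∑' k, w (k + n) := fun n => by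
    rw [hsum.summable.sum_add_tsum_nat_add n, hsum.tsum_eq]
  have hT0 : ∀ n, 0 ≤ ∑' k, w (k + n) := fun n => tsum_nonneg fun k => (hwpos _).le
  have hG0 : ∀ n, 0 ≤ ∑' k, w (k + n) * f (k + n) := fun n =>
    tsum_nonneg fun k => mul_nonneg (hwpos _).le (hf _).1
  have hG1 : ∀ n, ∑' k, w (k + n) * f (k + n) ≤ ∑' k, w (k + n) := fun n =>
    (tG n).tsum_le_tsum (fun k => mul_le_of_le_one_right (hwpos _).le (hf _).2) (tS n)
  have hEG : ∀ n, Real.exp lam * steinEo lam f =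
      ∑ k ∈ Finset.range n, w k * f k + ∑' k, w (k + n) * f (k + n) := fun n => by
    rw [hE, hwf.sum_add_tsum_nat_add n]
  have hw0 : w 0 = 1 := by simp [hwdef]
  rw [hexp]
  have hep := Real.exp_pos lam
  cases j with
  | zero =>
    have e1 := hEG 1
    have e2 := hST 1
    have g0 := hG0 1
    have g1 := hG1 1
    have u1 := hU 0
    simp only [zero_add, Finset.sum_range_one, hw0, one_mul, mul_one] at e1 e2 u1
    have u0 : steinUo lam f 0 = 0 := rfl
    rw [zero_add, u0, u1, sub_zero, abs_mul, abs_of_pos (by positivity), one_div_mul_eq_div]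
    gcongr
    have h0 := hf 0
    have hT := hT0 1
    generalize (∑' k, w (k + 1)) = T at *
    generalize (∑' k, w (k + 1) * f (k + 1)) = G at *
    generalize steinEo lam f = E at *
    have h1 : E = (f 0 + G) / Real.exp lam := by field_simp; linarith
    have h2 : f 0 - E = (f 0 * T - G) / Real.exp lam := by
      rw [h1]; field_simp; rw [e2]; ring
    have h3 : 1 - 1 / Real.exp lam = T / Real.exp lam := by
      field_simp; linarith
    rw [h2, h3, abs_div, abs_of_pos hep]
    gcongr
    rw [abs_le]
    constructor <;> nlinarith [mul_nonneg h0.1 hT, mul_nonneg (sub_nonneg.2 h0.2) hT]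
  | succ n =>
    have hJ : (0 : ℝ) < (n : ℝ) + 1 := by positivity
    have hTT : ∑' k, w (k + (n + 1)) = w (n + 1) + ∑' k, w (k + (n + 1 + 1)) := by
      have a := hST (n + 1)
      have b := hST (n + 1 + 1)
      rw [Finset.sum_range_succ] at b
      linarith
    refine stein_core lam (Real.exp lam) (w (n + 1)) (f (n + 1))
      (∑ k ∈ Finset.range (n + 1), w k) (∑ k ∈ Finset.range (n + 1), w k * f k)
      (∑' k, w (k + (n + 1 + 1))) (∑' k, w (k + (n + 1 + 1)) * f (k + (n + 1 + 1)))
      ((n : ℝ) + 1) (steinEo lam f) _ _ hlam hep (hwpos _) hJ (hf _).1 (hf _).2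
      (Finset.sum_nonneg fun k _ => (hwpos k).le) (hT0 _)
      (Finset.sum_nonneg fun k _ => mul_nonneg (hwpos k).le (hf k).1)
      (Finset.sum_le_sum fun k _ => mul_le_of_le_one_right (hwpos k).le (hf k).2)
      (hG0 _) (hG1 _) ?_ ?_ ?_ ?_ ?_ ?_
    · rw [hEG (n + 1 + 1), Finset.sum_range_succ _ (n + 1)]
    · rw [hST (n + 1 + 1), Finset.sum_range_succ _ (n + 1)]
    · rw [← hTT, ← tsum_mul_left, ← tsum_mul_left]
      refine ((tS _).mul_left _).tsum_le_tsum (fun k => ?_) ((tS _).mul_left _)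
      rw [← hws (k + (n + 1))]
      have : k + (n + 1 + 1) = k + (n + 1) + 1 := by ring
      rw [this]
      refine mul_le_mul_of_nonneg_right ?_ (hwpos _).le
      push_cast
      have : (0 : ℝ) ≤ k := by positivity
      linarith
    · rw [← Finset.sum_range_succ, Finset.sum_range_succ' _ (n + 1), hw0, add_sub_cancel_right,
        Finset.mul_sum, Finset.mul_sum]
      refine Finset.sum_le_sum fun k hk => ?_
      rw [← hws k]
      refine mul_le_mul_of_nonneg_right ?_ (hwpos _).le
      have : (k : ℝ) ≤ n := by exact_mod_cast Nat.lt_succ_iff.1 (Finset.mem_range.1 hk)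
      linarith
    · rw [hU (n + 1), Finset.sum_range_succ _ (n + 1), Finset.sum_range_succ _ (n + 1)]
    · rw [hU n, hws n]
end

section
/- Let λ > 0 and define f : ℕ → ℝ by f(j) = δ_0(j) - e^{-λ}, where δ_0(0) = 1 and δ_0(j) = 0 for j ≥ 1. Then for every j ∈ ℕ, |U_o f(j)| ≤ (1 - e^{-λ})/λ. -/
theorem aux_hasSum (lam : ℝ) : HasSum (fun k : ℕ => lam ^ k / (Nat.factorial k : ℝ)) (Real.exp lam) := by
  rw [Real.exp_eq_exp_ℝ]
  exact NormedSpace.expSeries_div_hasSum_exp lam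

theorem aux_Eo (lam : ℝ) (f : ℕ → ℝ)
    (hf : ∀ j, f j = (if j = 0 then (1 : ℝ) else 0) - Real.exp (-lam)) : steinEo lam f = 0 := by
  have h1 := (aux_hasSum lam).mul_left (Real.exp (-lam) * Real.exp (-lam))
  have h2 := (hasSum_ite_eq (0 : ℕ) (Real.exp (-lam))).sub h1
  have he : Real.exp (-lam) * Real.exp lam = 1 := by rw [← Real.exp_add]; simp
  have h3 : Real.exp (-lam) - Real.exp (-lam) * Real.exp (-lam) * Real.exp lam = 0 := by
    rw [mul_assoc, he]; ring
  rw [h3] at h2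
  unfold steinEo
  rw [← h2.tsum_eq]
  congr 1
  funext k
  rw [hf]
  by_cases hk : k = 0
  · subst hk; simp; ring
  · simp [hk]; ring

theorem aux_tail (lam : ℝ) (hlam : 0 < lam) (j : ℕ) :
    0 ≤ Real.exp lam - ∑ k ∈ Finset.range (j + 1), lam ^ k / (Nat.factorial k : ℝ) ∧
    (Nat.factorial j : ℝ) / lam ^ j *
      (Real.exp lam - ∑ k ∈ Finset.range (j + 1), lam ^ k / (Nat.factorial k : ℝ))
      ≤ Real.exp lam - 1 := by
  have h1 := (hasSum_nat_add_iff' (j + 1)).mpr (aux_hasSum lam)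
  have h0 := (hasSum_nat_add_iff' 1).mpr (aux_hasSum lam)
  simp only [Finset.sum_range_one, pow_zero, Nat.factorial_zero, Nat.cast_one, div_one] at h0
  refine ⟨h1.nonneg fun m => by positivity, ?_⟩
  refine hasSum_le (fun m => ?_) (h1.mul_left _) h0
  have hd : (Nat.factorial j : ℝ) * (Nat.factorial (m + 1) : ℝ)
      ≤ (Nat.factorial (m + (j + 1)) : ℝ) := by
    have := Nat.le_of_dvd (Nat.factorial_pos _) (Nat.factorial_mul_factorial_dvd_factorial_add j (m + 1))
    rw [show m + (j + 1) = j + (m + 1) by ring]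
    exact_mod_cast this
  have e : (Nat.factorial j : ℝ) / lam ^ j * (lam ^ (m + (j + 1)) / (Nat.factorial (m + (j + 1)) : ℝ))
      = lam ^ (m + 1) * ((Nat.factorial j : ℝ) / (Nat.factorial (m + (j + 1)) : ℝ)) := by
    rw [show m + (j + 1) = (m + 1) + j by ring, pow_add lam (m + 1) j]
    field_simp
  rw [e, div_eq_mul_inv (lam ^ (m + 1))]
  gcongr
  rw [div_le_iff₀ (by positivity), inv_mul_eq_div, le_div_iff₀ (by positivity)]
  exact hd

/-- For `λ > 0` and `f(j) = δ_0(j) - e^{-λ}`, `|U_o f(j)| ≤ (1 - e^{-λ})/λ` for all `j`. -/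
theorem abs_steinUo_delta_le (lam : ℝ) (hlam : 0 < lam)
    (f : ℕ → ℝ) (hf : ∀ j, f j = (if j = 0 then (1 : ℝ) else 0) - Real.exp (-lam)) (j : ℕ) :
    |steinUo lam f j| ≤ (1 - Real.exp (-lam)) / lam := by
  have he : Real.exp (-lam) * Real.exp lam = 1 := by rw [← Real.exp_add]; simp
  cases j with
  | zero =>
    have : Real.exp (-lam) ≤ 1 := Real.exp_le_one_iff.mpr (by linarith)
    simp only [steinUo, abs_zero]
    exact div_nonneg (by linarith) hlam.le
  | succ j =>
    obtain ⟨h0, h1⟩ := aux_tail lam hlam j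
    have hs : ∑ k ∈ Finset.range (j + 1), (lam ^ k / (Nat.factorial k : ℝ)) * (f k - steinEo lam f)
        = Real.exp (-lam) *
          (Real.exp lam - ∑ k ∈ Finset.range (j + 1), lam ^ k / (Nat.factorial k : ℝ)) := by
      rw [aux_Eo lam f hf, mul_sub, he]
      simp only [hf, sub_zero, mul_sub, Finset.sum_sub_distrib, ← Finset.sum_mul]
      simp
      ring
    simp only [steinUo]
    rw [hs, abs_of_nonneg (by positivity)]
    generalize Real.exp lam - ∑ k ∈ Finset.range (j + 1), lam ^ k / (Nat.factorial k : ℝ) = T at *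
    rw [le_div_iff₀ hlam]
    calc _ = Real.exp (-lam) * ((Nat.factorial j : ℝ) / lam ^ j * T) := by
          rw [pow_succ]; field_simp
      _ ≤ Real.exp (-lam) * (Real.exp lam - 1) := by gcongr
      _ = _ := by rw [mul_sub, he, mul_one]
end

section
/- Let σ be a uniformly random permutation of {1, …, n} and let W = #{i : σ(i) = i} be its number of fixed points. Then ‖L(W) - Poi_1‖_TV ≤ 2/n. -/
open MeasureTheory

/-- The Poisson distribution on `ℕ` with mean `lam`, assigning mass
`e^{-λ} λ^k / k!` to each `k : ℕ`. -/
noncomputable def poissonMeasure (lam : ℝ) : Measure ℕ :=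
  Measure.sum fun k : ℕ =>
    (ENNReal.ofReal (Real.exp (-lam) * lam ^ k / (Nat.factorial k))) • Measure.dirac k

instance (n : ℕ) : MeasurableSpace (Equiv.Perm (Fin n)) := ⊤

/-- The uniform distribution on the permutations of `{1, …, n}`. -/
noncomputable def uniformPerm (n : ℕ) : Measure (Equiv.Perm (Fin n)) :=
  (Fintype.card (Equiv.Perm (Fin n)) : ENNReal)⁻¹ • Measure.count

/-- The number of fixed points of a permutation. -/
def numFixedPoints {n : ℕ} (σ : Equiv.Perm (Fin n)) : ℕ :=
  (Finset.univ.filter fun i => σ i = i).card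

theorem mpa_poisson_eq : poissonMeasure 1 = ProbabilityTheory.poissonMeasure 1 := by
  unfold poissonMeasure ProbabilityTheory.poissonMeasure
  simp

theorem mpa_uniform_prob (n : ℕ) : IsProbabilityMeasure (uniformPerm n) := by
  constructor
  unfold uniformPerm
  rw [Measure.smul_apply, Measure.count_apply MeasurableSet.univ, smul_eq_mul]
  rw [Set.encard_univ, ENat.card_eq_coe_fintype_card]
  simp only [ENat.toENNReal_coe]
  apply ENNReal.inv_mul_cancel
  · exact_mod_cast Fintype.card_ne_zero
  · exact ENNReal.natCast_ne_top _

theorem mpa_der_succ (m : ℕ) :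
    (numDerangements (m+1) : ℝ) / (m+1).factorial =
      (numDerangements m : ℝ) / m.factorial + (-1)^(m+1) * (1 / (m+1).factorial) := by
  have h : (numDerangements (m + 1) : ℝ) = (m + 1) * (numDerangements m : ℝ) - (-1) ^ m := by
    exact_mod_cast numDerangements_succ m
  have h2 : (m.factorial : ℝ) ≠ 0 := by positivity
  have h3 : (m + 1 : ℝ) ≠ 0 := by positivity
  rw [h, Nat.factorial_succ]
  push_cast
  field_simp
  ring

theorem mpa_der_sum (m : ℕ) :
    ∑ i ∈ Finset.range (m+1), (-1 : ℝ)^i * (1 / (i.factorial : ℝ)) =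
      (numDerangements m : ℝ) / m.factorial := by
  induction m with
  | zero => simp
  | succ m ih => rw [Finset.sum_range_succ, ih, mpa_der_succ]

theorem mpa_der_bound (m : ℕ) :
    |(numDerangements m : ℝ) / m.factorial - Real.exp (-1)| ≤ 1 / (m+1).factorial := by
  have ht : Filter.Tendsto
      (fun n => ∑ i ∈ Finset.range n, (-1 : ℝ)^i * (1 / (i.factorial : ℝ)))
      Filter.atTop (nhds (Real.exp (-1))) := by
    rw [← Filter.tendsto_add_atTop_iff_nat 1]
    simp_rw [mpa_der_sum]
    exact numDerangements_tendsto_inv_e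
  have ha : Antitone (fun i : ℕ => 1 / (i.factorial : ℝ)) := by
    intro a b hab
    have := Nat.factorial_le hab
    have h1 : (0 : ℝ) < a.factorial := by positivity
    exact one_div_le_one_div_of_le h1 (by exact_mod_cast this)
  rw [← mpa_der_sum, abs_le]
  rcases Nat.even_or_odd' m with ⟨k, rfl | rfl⟩
  · have h1 := ha.tendsto_le_alternating_series ht k
    have h2 := ha.alternating_series_le_tendsto ht (k+1)
    rw [show 2 * (k+1) = 2*k+1+1 by ring, Finset.sum_range_succ] at h2
    have h0 : (0 : ℝ) ≤ 1 / ((2*k+1).factorial : ℝ) := by positivity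
    have : (-1 : ℝ)^(2*k+1) = -1 := by simp [pow_succ]
    rw [this] at h2
    constructor <;> linarith
  · have h1 := ha.alternating_series_le_tendsto ht (k+1)
    have h2 := ha.tendsto_le_alternating_series ht (k+1)
    rw [Finset.sum_range_succ] at h2
    have h0 : (0 : ℝ) ≤ 1 / ((2*(k+1)).factorial : ℝ) := by positivity
    have : (-1 : ℝ)^(2*(k+1)) = 1 := by simp
    rw [this] at h2
    rw [show 2 * k + 1 + 1 = 2 * (k+1) by ring]
    constructor <;> linarith

theorem mpa_card_fix {n : ℕ} (S : Finset (Fin n)) :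
    (Finset.univ.filter fun σ : Equiv.Perm (Fin n) =>
      (Finset.univ.filter fun i => σ i = i) = S).card = numDerangements (n - S.card) := by
  have e := derangements.subtypeEquiv (fun a : Fin n => a ∉ S)
  have h1 := Fintype.card_congr e
  rw [card_derangements_eq_numDerangements] at h1
  have h2 : Fintype.card {a : Fin n // a ∉ S} = n - S.card := by
    rw [Fintype.card_subtype_compl]; simp
  rw [h2] at h1
  rw [h1, Fintype.card_subtype]
  congr 1
  ext σ
  simp only [Finset.mem_filter, Finset.mem_univ, true_and, Finset.ext_iff, not_not,
    Function.mem_fixedPoints, Function.IsFixedPt]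
  exact forall_congr' fun a => iff_comm

theorem mpa_card (n k : ℕ) :
    (Finset.univ.filter fun σ : Equiv.Perm (Fin n) => numFixedPoints σ = k).card
      = n.choose k * numDerangements (n - k) := by
  have h := Finset.card_eq_sum_card_fiberwise
    (s := Finset.univ.filter fun σ : Equiv.Perm (Fin n) => numFixedPoints σ = k)
    (t := Finset.powersetCard k (Finset.univ : Finset (Fin n)))
    (f := fun σ : Equiv.Perm (Fin n) => (Finset.univ.filter fun i => σ i = i))
    (by
      intro σ hσ
      simp only [Finset.coe_filter, Finset.mem_univ, true_and, Set.mem_setOf_eq] at hσ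
      simp only [Finset.mem_coe, Finset.mem_powersetCard, Finset.subset_univ, true_and]
      exact hσ)
  rw [h, Finset.sum_congr rfl (g := fun _ => numDerangements (n - k))]
  · simp
  · intro S hS
    have hk := (Finset.mem_powersetCard.1 hS).2
    rw [← hk, ← mpa_card_fix S, hk]
    congr 1
    ext σ
    simp only [Finset.mem_filter, Finset.mem_univ, true_and]
    constructor
    · exact fun h => h.2
    · intro h
      refine ⟨?_, h⟩
      unfold numFixedPoints
      rw [h, hk]

theorem mpa_law_apply (n : ℕ) (k : ℕ) :
    ((uniformPerm n).map (fun σ => numFixedPoints σ)).real {k}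
      = (n.choose k * numDerangements (n - k) : ℕ) / (n.factorial : ℝ) := by
  rw [measureReal_def, Measure.map_apply measurable_from_top (MeasurableSet.singleton k),
    ← mpa_card]
  unfold uniformPerm
  rw [Measure.smul_apply, Measure.count_apply MeasurableSpace.measurableSet_top, smul_eq_mul]
  have : ((fun σ : Equiv.Perm (Fin n) => numFixedPoints σ) ⁻¹' {k}) =
    ((Finset.univ.filter fun σ : Equiv.Perm (Fin n) => numFixedPoints σ = k :
      Finset (Equiv.Perm (Fin n))) : Set (Equiv.Perm (Fin n))) := by
    ext σ; simp
  rw [this, Set.encard_coe_eq_coe_finsetCard]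
  simp [Fintype.card_perm, div_eq_inv_mul]

theorem mpa_pt (n k : ℕ) (hk : k ≤ n) :
    ((uniformPerm n).map (fun σ => numFixedPoints σ)).real {k} ≤
      (ProbabilityTheory.poissonMeasure 1).real {k} + ((n+1).choose k : ℝ) / (n+1).factorial := by
  rw [mpa_law_apply, ProbabilityTheory.poissonMeasure_real_singleton]
  obtain ⟨m, rfl⟩ := Nat.exists_eq_add_of_le hk
  have hb := (abs_le.1 (mpa_der_bound m)).2
  have e1 : ((k+m).choose k : ℝ) = (k+m).factorial / (k.factorial * m.factorial) := by
    rw [Nat.cast_choose ℝ hk]; simp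
  have e2 : ((k+m+1).choose k : ℝ) = (k+m+1).factorial / (k.factorial * (m+1).factorial) := by
    rw [Nat.cast_choose ℝ (by omega), show k + m + 1 - k = m + 1 by omega]
  rw [show k + m - k = m by omega]
  push_cast
  rw [e1, e2]
  have p1 : ((k+m).factorial : ℝ) ≠ 0 := by positivity
  have p2 : ((k+m+1).factorial : ℝ) ≠ 0 := by positivity
  have p3 : (0 : ℝ) < 1 / (k.factorial : ℝ) := by positivity
  have p4 : (m.factorial : ℝ) ≠ 0 := by positivity
  have p5 : ((m+1).factorial : ℝ) ≠ 0 := by positivity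
  have p6 : (k.factorial : ℝ) ≠ 0 := by positivity
  have := mul_le_mul_of_nonneg_left hb p3.le
  have g1 : ((k+m).factorial : ℝ) / (k.factorial * m.factorial) * numDerangements m / (k+m).factorial
     = 1 / (k.factorial : ℝ) * (numDerangements m / m.factorial) := by field_simp
  have g2 : ((k+m+1).factorial : ℝ) / (k.factorial * (m+1).factorial) / (k+m+1).factorial
     = 1 / (k.factorial : ℝ) * (1 / (m+1).factorial) := by field_simp
  rw [g1, g2]
  rw [mul_sub] at this
  have g3 : Real.exp (-1) * 1 ^ k / (k.factorial : ℝ) = 1 / (k.factorial : ℝ) * Real.exp (-1) := by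
    rw [one_pow]; ring
  rw [g3]
  linarith

theorem mpa_num (n : ℕ) (hn : 1 ≤ n) (h2 : n ≠ 2) :
    (2 : ℝ)^(n+1) / (n+1).factorial ≤ 2 / n := by
  have key : ∀ m : ℕ, 3 ≤ m → m * 2^m ≤ (m+1).factorial := by
    intro m hm
    induction m, hm using Nat.le_induction with
    | base => decide
    | succ m hm ih =>
      rw [Nat.factorial_succ]
      have : (m+1) * 2^(m+1) ≤ (m+2) * (m * 2^m) := by
        have : (m+1) * 2 ≤ (m+2) * m := by nlinarith
        calc (m+1) * 2^(m+1) = ((m+1) * 2) * 2^m := by ring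
          _ ≤ ((m+2) * m) * 2^m := Nat.mul_le_mul_right _ this
          _ = _ := by ring
      exact this.trans (Nat.mul_le_mul_left _ ih)
  have hk : n * 2^n ≤ (n+1).factorial := by
    by_cases h : n = 1
    · subst h; decide
    · exact key n (by omega)
  have hk' : (n : ℝ) * 2^n ≤ ((n+1).factorial : ℝ) := by exact_mod_cast hk
  have hn' : (0 : ℝ) < n := by exact_mod_cast hn
  rw [div_le_div_iff₀ (by positivity) hn', pow_succ]
  linarith

theorem mpa_one_sided (n : ℕ) (hn : 1 ≤ n) (A : Set ℕ) :
    ((uniformPerm n).map (fun σ => numFixedPoints σ)).real A ≤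
      (ProbabilityTheory.poissonMeasure 1).real A + 2 / n := by
  classical
  haveI := mpa_uniform_prob n
  haveI : IsProbabilityMeasure ((uniformPerm n).map (fun σ => numFixedPoints σ)) :=
    Measure.isProbabilityMeasure_map measurable_from_top.aemeasurable
  by_cases h2 : n = 2
  · subst h2
    have : ((uniformPerm 2).map (fun σ => numFixedPoints σ)).real A ≤ 1 := measureReal_le_one
    have : 0 ≤ (ProbabilityTheory.poissonMeasure 1).real A := measureReal_nonneg
    norm_num
    linarith
  set F : Finset ℕ := (Finset.range (n+1)).filter (· ∈ A) with hF
  have hFA : (F : Set ℕ) ⊆ A := by intro x hx; simp [hF] at hx; exact hx.2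
  have hQ : ((uniformPerm n).map (fun σ => numFixedPoints σ)).real A =
      ((uniformPerm n).map (fun σ => numFixedPoints σ)).real F := by
    rw [measureReal_def, measureReal_def, Measure.map_apply measurable_from_top (by trivial),
      Measure.map_apply measurable_from_top (by trivial)]
    congr 2
    ext σ
    have : numFixedPoints σ ≤ n := by
      unfold numFixedPoints
      exact (Finset.card_le_univ _).trans (by simp)
    simp [hF]
    omega
  have hP : (ProbabilityTheory.poissonMeasure 1).real F ≤
    (ProbabilityTheory.poissonMeasure 1).real A := measureReal_mono hFA
  have hS : ∑ k ∈ F, ((n+1).choose k : ℝ) / (n+1).factorial ≤ 2^(n+1) / (n+1).factorial := by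
    rw [← Finset.sum_div]
    gcongr
    have h := Nat.sum_range_choose (n+1)
    have h' : ∑ k ∈ Finset.range (n+1+1), ((n+1).choose k : ℝ) = 2^(n+1) := by exact_mod_cast h
    rw [← h']
    apply Finset.sum_le_sum_of_subset_of_nonneg
    · intro x hx
      simp [hF] at hx ⊢
      omega
    · intros; positivity
  rw [hQ, ← sum_measureReal_singleton]
  rw [← sum_measureReal_singleton] at hP
  have hpt : ∑ k ∈ F, ((uniformPerm n).map (fun σ => numFixedPoints σ)).real {k} ≤
      ∑ k ∈ F, ((ProbabilityTheory.poissonMeasure 1).real {k}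
        + ((n+1).choose k : ℝ) / (n+1).factorial) := by
    apply Finset.sum_le_sum
    intro k hk
    apply mpa_pt
    simp [hF] at hk
    omega
  rw [Finset.sum_add_distrib] at hpt
  have := mpa_num n hn h2
  linarith

/-- If `W` is the number of fixed points of a uniformly random permutation of `{1, …, n}`,
then `‖L(W) - Poi_1‖_TV ≤ 2/n`. -/
theorem matching_poisson_approx (n : ℕ) (hn : 1 ≤ n) :
    ∀ A : Set ℕ,
      |(((uniformPerm n).map (fun σ => numFixedPoints σ)) A).toReal -
        (poissonMeasure 1 A).toReal| ≤ 2 / n := by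
  intro A
  rw [mpa_poisson_eq]
  change |((uniformPerm n).map (fun σ => numFixedPoints σ)).real A -
    (ProbabilityTheory.poissonMeasure 1).real A| ≤ 2 / n
  haveI := mpa_uniform_prob n
  haveI : IsProbabilityMeasure ((uniformPerm n).map (fun σ => numFixedPoints σ)) :=
    Measure.isProbabilityMeasure_map measurable_from_top.aemeasurable
  have h1 := mpa_one_sided n hn A
  have h2 := mpa_one_sided n hn Aᶜ
  rw [probReal_compl_eq_one_sub (by trivial), probReal_compl_eq_one_sub (by trivial)] at h2
  rw [abs_le]
  constructor <;> linarith
end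

section
/- Let l_1, …, l_k be positive integers with n = Σ_{i=1}^k l_i ≥ 2, and let c : {1, …, n} → {1, …, k} be a map with |c^{-1}(i)| = l_i for each i. Let σ be a uniformly random permutation of {1, …, n} and let W = #{j : c(σ(j)) = c(j)} be the number of fixed points of the induced random permutation of the multiset in which symbol i appears l_i times. Set λ = (1/n) Σ_{i=1}^k l_i² and μ = Σ_{i=1}^k l_i³. Then ‖L(W) - Poi_λ‖_TV ≤ 1.4 · [λ^{3/2}/(n-1) + 3μ/(2 n² λ^{1/2})]. -/
open MeasureTheory

namespace GMP

noncomputable def p (lam : ℝ) (k : ℕ) : ℝ := Real.exp (-lam) * lam ^ k / (Nat.factorial k)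

lemma p_pos {lam : ℝ} (h : 0 < lam) (k : ℕ) : 0 < p lam k := by
  unfold p; positivity

lemma p_succ (lam : ℝ) (k : ℕ) : ((k : ℝ) + 1) * p lam (k + 1) = lam * p lam k := by
  unfold p
  rw [Nat.factorial_succ]
  have : (Nat.factorial k : ℝ) ≠ 0 := by positivity
  have : (k : ℝ) + 1 ≠ 0 := by positivity
  push_cast
  field_simp
  try ring

lemma p_hasSum (lam : ℝ) : HasSum (p lam) 1 := by
  have h := (NormedSpace.expSeries_div_hasSum_exp lam).mul_left (Real.exp (-lam))
  rw [← Real.exp_eq_exp_ℝ, ← Real.exp_add] at h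
  simp only [neg_add_cancel, Real.exp_zero] at h
  have e : p lam = fun k => Real.exp (-lam) * (lam ^ k / (Nat.factorial k : ℝ)) := by
    funext k
    unfold p
    ring
  rw [e]
  exact h

open Classical in
noncomputable def ind (A : Set ℕ) (k : ℕ) : ℝ := if k ∈ A then 1 else 0

lemma ind_nonneg (A : Set ℕ) (k : ℕ) : 0 ≤ ind A k := by
  unfold ind; split_ifs <;> norm_num

lemma ind_le (A : Set ℕ) (k : ℕ) : ind A k ≤ 1 := by
  unfold ind; split_ifs <;> norm_num

/-- Poisson integral of u. -/
noncomputable def PA (lam : ℝ) (u : ℕ → ℝ) : ℝ := ∑' k, p lam k * u k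

noncomputable def S (lam : ℝ) (u : ℕ → ℝ) (k : ℕ) : ℝ :=
  ∑ i ∈ Finset.range k, p lam i * (u i - PA lam u)

/-- Stein solution -/
noncomputable def f (lam : ℝ) (u : ℕ → ℝ) (k : ℕ) : ℝ :=
  S lam u k / (lam * p lam (k - 1))

lemma stein {lam : ℝ} (h : 0 < lam) (u : ℕ → ℝ) (k : ℕ) :
    lam * f lam u (k + 1) - k * f lam u k = u k - PA lam u := by
  have hp := p_pos h k
  have h1 : lam * f lam u (k + 1) = S lam u (k + 1) / p lam k := by
    unfold f; simp only [Nat.add_sub_cancel]; field_simp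
  have h2 : k * f lam u k = S lam u k / p lam k := by
    cases k with
    | zero => simp [S]
    | succ k =>
      unfold f
      simp only [Nat.add_sub_cancel]
      have hp' := p_pos h k
      rw [← p_succ]
      push_cast
      have : (k : ℝ) + 1 ≠ 0 := by positivity
      field_simp
  rw [h1, h2, ← sub_div, S, Finset.sum_range_succ, S]
  field_simp
  ring

lemma head_ineq {lam : ℝ} (h : 0 < lam) (k : ℕ) :
    lam * ∑ i ∈ Finset.range k, p lam i ≤ k * ∑ i ∈ Finset.range (k + 1), p lam i := by
  rw [Finset.mul_sum, Finset.sum_range_succ', mul_add, Finset.mul_sum]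
  have : ∑ i ∈ Finset.range k, lam * p lam i ≤ ∑ i ∈ Finset.range k, (k : ℝ) * p lam (i + 1) := by
    apply Finset.sum_le_sum
    intro i hi
    rw [← p_succ]
    have := Finset.mem_range.1 hi
    have h2 : ((i : ℝ) + 1) ≤ k := by exact_mod_cast this
    exact mul_le_mul_of_nonneg_right h2 (p_pos h _).le
  have h3 : 0 ≤ (k : ℝ) * p lam 0 := mul_nonneg (by positivity) (p_pos h _).le
  linarith

lemma tail_ineq {lam : ℝ} (h : 0 < lam) (k : ℕ) :
    (k : ℝ) * (1 - ∑ i ∈ Finset.range (k + 1), p lam i) ≤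
      lam * (1 - ∑ i ∈ Finset.range k, p lam i) := by
  have hs := (p_hasSum lam).summable
  have e (m : ℕ) : (1 - ∑ i ∈ Finset.range m, p lam i) = ∑' i, p lam (i + m) := by
    have := hs.sum_add_tsum_nat_add m
    rw [(p_hasSum lam).tsum_eq] at this
    linarith
  rw [e, e, ← tsum_mul_left, ← tsum_mul_left]
  apply Summable.tsum_le_tsum
  · intro i
    rw [← p_succ]
    push_cast
    rw [show i + (k + 1) = i + k + 1 by ring]
    apply mul_le_mul_of_nonneg_right _ (p_pos h _).le
    have : (0 : ℝ) ≤ i := by positivity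
    linarith
  · exact ((summable_nat_add_iff (k + 1)).2 hs).mul_left _
  · exact ((summable_nat_add_iff k).2 hs).mul_left _

lemma summ {lam : ℝ} (h : 0 < lam) (u : ℕ → ℝ) (h0 : ∀ k, 0 ≤ u k) (h1 : ∀ k, u k ≤ 1) :
    Summable (fun k => p lam k * u k) := by
  refine Summable.of_nonneg_of_le (fun k => mul_nonneg (p_pos h k).le (h0 k)) (fun k => ?_)
    (p_hasSum lam).summable
  have := p_pos h k
  nlinarith [h1 k]

lemma delta_le {lam : ℝ} (h : 0 < lam) (u : ℕ → ℝ) (h0 : ∀ k, 0 ≤ u k) (h1 : ∀ k, u k ≤ 1)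
    (k : ℕ) (hk : 1 ≤ k) : f lam u (k + 1) - f lam u k ≤ 1 / lam := by
  have hs := summ h u h0 h1
  set a := ∑ i ∈ Finset.range k, p lam i * u i with ha
  set b := p lam k * u k with hb
  set d := ∑' i, p lam (i + (k + 1)) * u (i + (k + 1)) with hd
  set F := ∑ i ∈ Finset.range k, p lam i with hF
  have hP : PA lam u = a + b + d := by
    have := hs.sum_add_tsum_nat_add (k + 1)
    rw [Finset.sum_range_succ] at this
    unfold PA
    rw [← this]
  have hS (m) : S lam u m = ∑ i ∈ Finset.range m, p lam i * u i
      - PA lam u * ∑ i ∈ Finset.range m, p lam i := by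
    unfold S
    rw [Finset.mul_sum, ← Finset.sum_sub_distrib]
    exact Finset.sum_congr rfl fun i _ => by ring
  have hp := p_pos h k
  have hk0 : (0 : ℝ) < k := by exact_mod_cast hk
  have e1 : f lam u (k + 1) = (a + b - (a + b + d) * (F + p lam k)) / (lam * p lam k) := by
    unfold f
    rw [hS, Finset.sum_range_succ, Finset.sum_range_succ, hP]
    simp [ha, hb, hF]
  have e2 : f lam u k = (a - (a + b + d) * F) / (k * p lam k) := by
    unfold f
    obtain ⟨j, rfl⟩ : ∃ j, k = j + 1 := ⟨k - 1, by omega⟩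
    rw [hS, hP]
    simp only [Nat.add_sub_cancel]
    rw [← p_succ]
    push_cast
    rfl
  have ha0 : 0 ≤ a := Finset.sum_nonneg fun i _ => mul_nonneg (p_pos h i).le (h0 i)
  have hb0 : 0 ≤ b := mul_nonneg hp.le (h0 k)
  have hb1 : b ≤ p lam k := by nlinarith [h1 k]
  have hd0 : 0 ≤ d := tsum_nonneg fun i => mul_nonneg (p_pos h _).le (h0 _)
  have H1 := head_ineq h k
  have H2 := tail_ineq h k
  rw [Finset.sum_range_succ, ← hF] at H1 H2
  set q := p lam k
  set K := (k : ℝ)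
  have hG : K * (1 - F - q) ≤ lam * (1 - F) := by linarith
  have key : K * (a + b - (a + b + d) * (F + q)) - lam * (a - (a + b + d) * F) ≤ K * q := by
    have t1 : a * (K * (1 - F - q)) ≤ a * (lam * (1 - F)) := mul_le_mul_of_nonneg_left hG ha0
    have t2 : d * (lam * F) ≤ d * (K * (F + q)) := mul_le_mul_of_nonneg_left H1 hd0
    have t3 : b * (lam * F) ≤ b * (K * (F + q)) := mul_le_mul_of_nonneg_left H1 hb0
    have t4 : K * b ≤ K * q := mul_le_mul_of_nonneg_left hb1 hk0.le
    linarith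
  rw [e1, e2]
  have : (a + b - (a + b + d) * (F + q)) / (lam * q) - (a - (a + b + d) * F) / (K * q)
    = (K * (a + b - (a + b + d) * (F + q)) - lam * (a - (a + b + d) * F)) / (lam * (K * q)) := by
    field_simp
  rw [this, div_le_div_iff₀ (by positivity) h]
  nlinarith

lemma f_compl {lam : ℝ} (h : 0 < lam) (u : ℕ → ℝ) (h0 : ∀ k, 0 ≤ u k) (h1 : ∀ k, u k ≤ 1)
    (k : ℕ) : f lam (fun i => 1 - u i) k = - f lam u k := by
  have : PA lam (fun i => 1 - u i) = 1 - PA lam u := by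
    unfold PA
    have := ((p_hasSum lam).sub (summ h u h0 h1).hasSum).tsum_eq
    rw [← this]
    exact tsum_congr fun i => by ring
  unfold f S
  rw [this, ← neg_div, ← Finset.sum_neg_distrib]
  congr 1
  exact Finset.sum_congr rfl fun i _ => by ring

lemma delta_abs {lam : ℝ} (h : 0 < lam) (u : ℕ → ℝ) (h0 : ∀ k, 0 ≤ u k) (h1 : ∀ k, u k ≤ 1)
    (k : ℕ) (hk : 1 ≤ k) : |f lam u (k + 1) - f lam u k| ≤ 1 / lam := by
  rw [abs_le]
  refine ⟨?_, delta_le h u h0 h1 k hk⟩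
  have := delta_le h (fun i => 1 - u i) (fun k => by linarith [h1 k]) (fun k => by linarith [h0 k]) k hk
  rw [f_compl h u h0 h1, f_compl h u h0 h1] at this
  linarith

/-! permutations -/
section perm
variable {n k : ℕ}

lemma swap_sum (j m : Fin n) (g : Equiv.Perm (Fin n) → ℝ) :
    ∑ σ : Equiv.Perm (Fin n), g (Equiv.swap (σ j) m * σ)
      = n * ∑ σ : Equiv.Perm (Fin n), if σ j = m then g σ else 0 := by
  have h1 : ∀ σ : Equiv.Perm (Fin n), g (Equiv.swap (σ j) m * σ)
      = ∑ r : Fin n, if σ j = r then g (Equiv.swap r m * σ) else 0 := by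
    intro σ; simp
  simp_rw [h1]
  rw [Finset.sum_comm]
  have h2 : ∀ r : Fin n, ∑ σ : Equiv.Perm (Fin n), (if σ j = r then g (Equiv.swap r m * σ) else 0)
      = ∑ σ : Equiv.Perm (Fin n), if σ j = m then g σ else 0 := by
    intro r
    refine Fintype.sum_equiv (Equiv.mulLeft (Equiv.swap r m)) _ _ fun σ => ?_
    have : ((Equiv.mulLeft (Equiv.swap r m)) σ) j = m ↔ σ j = r := by
      simp only [Equiv.coe_mulLeft, Equiv.Perm.coe_mul, Function.comp]
      rw [Equiv.swap_apply_eq_iff, Equiv.swap_apply_right]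
    simp only [this]
    rfl
  simp [h2]

lemma count1 (j m : Fin n) :
    (n : ℝ) * ∑ σ : Equiv.Perm (Fin n), (if σ j = m then (1 : ℝ) else 0) = (n.factorial : ℝ) := by
  rw [← swap_sum j m (fun _ => 1)]
  simp [Fintype.card_perm]

lemma count2 (j r s m : Fin n) (hj : j ≠ r) (hs : s ≠ m) :
    ((n : ℝ) - 1) * ∑ σ : Equiv.Perm (Fin n), (if σ j = s ∧ σ r = m then (1 : ℝ) else 0)
      = ∑ σ : Equiv.Perm (Fin n), (if σ r = m then (1 : ℝ) else 0) := by
  have h1 : ∀ σ : Equiv.Perm (Fin n), (if σ r = m then (1 : ℝ) else 0)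
      = ∑ t ∈ Finset.univ.erase m, if σ j = t ∧ σ r = m then (1 : ℝ) else 0 := by
    intro σ
    by_cases h : σ r = m
    · have : σ j ≠ m := fun h' => hj (σ.injective (h'.trans h.symm))
      simp [h, this]
    · simp [h]
  simp_rw [h1]
  rw [Finset.sum_comm]
  have h2 : ∀ t ∈ Finset.univ.erase m,
      ∑ σ : Equiv.Perm (Fin n), (if σ j = t ∧ σ r = m then (1 : ℝ) else 0)
      = ∑ σ : Equiv.Perm (Fin n), (if σ j = s ∧ σ r = m then (1 : ℝ) else 0) := by
    intro t ht
    have ht : t ≠ m := (Finset.mem_erase.1 ht).1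
    refine Fintype.sum_equiv (Equiv.mulLeft (Equiv.swap t s)) _ _ fun σ => ?_
    have e1 : ((Equiv.mulLeft (Equiv.swap t s)) σ) j = s ↔ σ j = t := by
      simp only [Equiv.coe_mulLeft, Equiv.Perm.coe_mul, Function.comp]
      rw [Equiv.swap_apply_eq_iff, Equiv.swap_apply_right]
    have e2 : ((Equiv.mulLeft (Equiv.swap t s)) σ) r = m ↔ σ r = m := by
      simp only [Equiv.coe_mulLeft, Equiv.Perm.coe_mul, Function.comp]
      rw [Equiv.swap_apply_eq_iff, Equiv.swap_apply_of_ne_of_ne ht.symm hs.symm]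
    simp only [e1, e2]
  rw [Finset.sum_congr rfl h2, Finset.sum_const, Finset.card_erase_of_mem (Finset.mem_univ _)]
  have : 1 ≤ n := by have := j.2; omega
  simp [Nat.cast_sub this]

def W (c : Fin n → Fin k) (σ : Equiv.Perm (Fin n)) : ℕ :=
  (Finset.univ.filter fun j => c (σ j) = c j).card

lemma W_eq (c : Fin n → Fin k) (σ : Equiv.Perm (Fin n)) :
    (W c σ : ℤ) = ∑ i, if c (σ i) = c i then (1 : ℤ) else 0 := by
  simp [W]

def Bad (c : Fin n → Fin k) (j m : Fin n) (σ : Equiv.Perm (Fin n)) : Prop :=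
  c (σ j) = c j ∨ c (σ.symm m) = c j ∨ (c (σ j) = c (σ.symm m) ∧ c (σ.symm m) ≠ c j)

lemma W_swap (c : Fin n → Fin k) (j m : Fin n) (hm : c m = c j) (σ : Equiv.Perm (Fin n)) :
    1 ≤ W c (Equiv.swap (σ j) m * σ) ∧
    (W c (Equiv.swap (σ j) m * σ) = W c σ + 1 ∨
      (Bad c j m σ ∧ (W c (Equiv.swap (σ j) m * σ) = W c σ
        ∨ W c (Equiv.swap (σ j) m * σ) = W c σ + 2))) := by
  set τ := Equiv.swap (σ j) m * σ with hτ
  have hτj : τ j = m := by simp [hτ]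
  refine ⟨?_, ?_⟩
  · unfold W
    rw [Nat.one_le_iff_ne_zero, ← Nat.pos_iff_ne_zero, Finset.card_pos]
    exact ⟨j, by simp [hτj, hm]⟩
  by_cases hp : σ.symm m = j
  · have h1 : σ j = m := by rw [← hp]; simp
    have : τ = σ := by rw [hτ, h1, Equiv.swap_self]; rfl
    right
    refine ⟨Or.inl (by rw [h1, hm]), Or.inl (by rw [this])⟩
  set q := σ.symm m with hq
  have hσq : σ q = m := by simp [hq]
  have hτq : τ q = σ j := by simp [hτ, hσq]
  have hoth : ∀ i, i ≠ j → i ≠ q → τ i = σ i := by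
    intro i h1 h2
    simp only [hτ, Equiv.Perm.coe_mul, Function.comp]
    apply Equiv.swap_apply_of_ne_of_ne
    · exact fun h => h1 (σ.injective h)
    · exact fun h => h2 (σ.injective (h.trans hσq.symm))
  have hdiff : (W c τ : ℤ) - W c σ =
      ((if c (τ j) = c j then (1 : ℤ) else 0) - (if c (σ j) = c j then (1 : ℤ) else 0)) +
      ((if c (τ q) = c q then (1 : ℤ) else 0) - (if c (σ q) = c q then (1 : ℤ) else 0)) := by
    rw [W_eq, W_eq, ← Finset.sum_sub_distrib]
    rw [← Finset.sum_pair (Ne.symm hp)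
      (f := fun i => (if c (τ i) = c i then (1 : ℤ) else 0) - (if c (σ i) = c i then (1 : ℤ) else 0))]
    symm
    apply Finset.sum_subset (Finset.subset_univ _)
    intro i _ hi
    simp only [Finset.mem_insert, Finset.mem_singleton, not_or] at hi
    rw [hoth i hi.1 hi.2]; simp
  rw [hτj, hτq, hσq, hm] at hdiff
  unfold Bad
  rw [← hq]
  by_cases h1 : c (σ j) = c j
  · by_cases h2 : c j = c q
    · simp only [h1, h2, if_true] at hdiff ⊢
      right
      refine ⟨by simp, ?_⟩
      left; omega
    · have h3 : c (σ j) ≠ c q := by rw [h1]; exact h2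
      simp only [h1, h2, if_true, if_false] at hdiff ⊢
      right
      refine ⟨by simp, ?_⟩
      left; omega
  · by_cases h2 : c j = c q
    · have h3 : c (σ j) ≠ c q := by rw [← h2]; exact h1
      simp only [h2, h3, if_true, if_false] at hdiff ⊢
      right
      refine ⟨by simp, ?_⟩
      left; omega
    · by_cases h3 : c (σ j) = c q
      · right
        refine ⟨Or.inr (Or.inr ⟨h3, Ne.symm h2⟩), ?_⟩
        simp only [h2, h3, if_true, if_false] at hdiff
        have h2' : ¬ c q = c j := Ne.symm h2
        simp only [h2', if_false] at hdiff
        omega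
      · left
        simp only [h1, h2, h3, if_true, if_false] at hdiff
        omega


open Classical in
lemma bad_le (c : Fin n → Fin k) (j m : Fin n) (hm : c m = c j) (σ : Equiv.Perm (Fin n)) :
    (if Bad c j m σ then (1 : ℝ) else 0) ≤
      (∑ s, if c s = c j then (if σ j = s then (1 : ℝ) else 0) else 0) +
      (∑ r, if c r = c j then (if σ r = m then (1 : ℝ) else 0) else 0) +
      ∑ r, ∑ s, if c s = c r ∧ c r ≠ c j then (if σ j = s ∧ σ r = m then (1 : ℝ) else 0) else 0 := by
  have n1 : ∀ s, 0 ≤ (if c s = c j then (if σ j = s then (1 : ℝ) else 0) else 0) := by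
    intro s; split_ifs <;> norm_num
  have n2 : ∀ r, 0 ≤ (if c r = c j then (if σ r = m then (1 : ℝ) else 0) else 0) := by
    intro s; split_ifs <;> norm_num
  have n3 : ∀ r s, 0 ≤ (if c s = c r ∧ c r ≠ c j then (if σ j = s ∧ σ r = m then (1 : ℝ) else 0) else 0) := by
    intro r s; split_ifs <;> norm_num
  have N1 := Finset.sum_nonneg (s := Finset.univ) fun s _ => n1 s
  have N2 := Finset.sum_nonneg (s := Finset.univ) fun s _ => n2 s
  have N3' := fun r => Finset.sum_nonneg (s := Finset.univ) fun s _ => n3 r s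
  have N3 := Finset.sum_nonneg (s := Finset.univ) fun r _ => N3' r
  split_ifs with hB
  · rcases hB with hB | hB | ⟨hB, hB'⟩
    · have := Finset.single_le_sum (fun s _ => n1 s) (Finset.mem_univ (σ j))
      rw [if_pos hB, if_pos rfl] at this
      linarith
    · have := Finset.single_le_sum (fun s _ => n2 s) (Finset.mem_univ (σ.symm m))
      rw [if_pos hB, if_pos (by simp)] at this
      linarith
    · have h1 := Finset.single_le_sum (fun s _ => N3' s) (Finset.mem_univ (σ.symm m))
      have h2 := Finset.single_le_sum (fun s _ => n3 (σ.symm m) s) (Finset.mem_univ (σ j))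
      rw [if_pos ⟨hB, hB'⟩, if_pos (by simp)] at h2
      linarith
  · linarith

open Classical in
lemma bad_count (hn : 2 ≤ n) (c : Fin n → Fin k) (j m : Fin n) (hm : c m = c j) (lam L : ℝ)
    (hL : ∑ s, (if c s = c j then (1 : ℝ) else 0) = L)
    (hlam : n * lam = ∑ r, ∑ s, (if c s = c r then (1 : ℝ) else 0)) :
    ∑ σ : Equiv.Perm (Fin n), (if Bad c j m σ then (1 : ℝ) else 0) ≤
      n.factorial * (2 * L / n + lam / (n - 1)) := by
  have hn0 : (0 : ℝ) < n := by positivity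
  have hn1 : (0 : ℝ) < n - 1 := by
    have : (2 : ℝ) ≤ n := by exact_mod_cast hn
    linarith
  have hc1 : ∀ r s : Fin n, ∑ σ : Equiv.Perm (Fin n), (if σ r = s then (1 : ℝ) else 0)
      = n.factorial / n := by
    intro r s
    rw [eq_div_iff hn0.ne', mul_comm]
    exact count1 r s
  refine (Finset.sum_le_sum fun σ _ => bad_le c j m hm σ).trans ?_
  rw [Finset.sum_add_distrib, Finset.sum_add_distrib, Finset.sum_comm,
    Finset.sum_comm (f := fun (σ : Equiv.Perm (Fin n)) r =>
      if c r = c j then (if σ r = m then (1 : ℝ) else 0) else 0)]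
  have e1 : ∑ s, ∑ σ : Equiv.Perm (Fin n), (if c s = c j then (if σ j = s then (1 : ℝ) else 0) else 0)
      = n.factorial / n * L := by
    rw [← hL, Finset.mul_sum]
    refine Finset.sum_congr rfl fun s _ => ?_
    by_cases h : c s = c j
    · simp only [h, if_true, mul_one]; exact hc1 _ _
    · simp [h]
  have e2 : ∑ s, ∑ σ : Equiv.Perm (Fin n), (if c s = c j then (if σ s = m then (1 : ℝ) else 0) else 0)
      = n.factorial / n * L := by
    rw [← hL, Finset.mul_sum]
    refine Finset.sum_congr rfl fun s _ => ?_
    by_cases h : c s = c j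
    · simp only [h, if_true, mul_one]; exact hc1 _ _
    · simp [h]
  have e3 : ∑ σ : Equiv.Perm (Fin n), ∑ r, ∑ s,
      (if c s = c r ∧ c r ≠ c j then (if σ j = s ∧ σ r = m then (1 : ℝ) else 0) else 0)
      ≤ n.factorial / n / (n - 1) * (n * lam) := by
    rw [Finset.sum_comm, hlam, Finset.mul_sum]
    refine Finset.sum_le_sum fun r _ => ?_
    rw [Finset.sum_comm, Finset.mul_sum]
    refine Finset.sum_le_sum fun s _ => ?_
    by_cases h : c s = c r ∧ c r ≠ c j
    · have hj : j ≠ r := fun e => h.2 (by rw [e])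
      have hs : s ≠ m := fun e => h.2 (by rw [← h.1, e, hm])
      have h2 := count2 j r s m hj hs
      rw [hc1] at h2
      have h3 : ∑ σ : Equiv.Perm (Fin n), (if σ j = s ∧ σ r = m then (1 : ℝ) else 0)
        = n.factorial / n / (n - 1) := by
        rw [eq_div_iff hn1.ne', mul_comm]; exact h2
      rw [if_pos h.1, mul_one, ← h3]
      refine Finset.sum_le_sum fun σ _ => ?_
      rw [if_pos h]
    · simp only [h, if_false, Finset.sum_const_zero]
      split_ifs <;> positivity
  rw [e1, e2]
  have : (n.factorial : ℝ) * (2 * L / n + lam / (n - 1)) = n.factorial / n * L + n.factorial / n * L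
    + n.factorial / n / (n - 1) * (n * lam) := by
    field_simp; ring
  rw [this]
  linarith

open Classical in
lemma stein_diff {lam : ℝ} (h : 0 < lam) (u : ℕ → ℝ) (h0 : ∀ k, 0 ≤ u k) (h1 : ∀ k, u k ≤ 1)
    (c : Fin n → Fin k) (j m : Fin n) (hm : c m = c j) (σ : Equiv.Perm (Fin n)) :
    |f lam u (W c σ + 1) - f lam u (W c (Equiv.swap (σ j) m * σ))| ≤
      1 / lam * (if Bad c j m σ then (1 : ℝ) else 0) := by
  obtain ⟨hw, hh | ⟨hb, hh | hh⟩⟩ := W_swap c j m hm σ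
  · rw [hh]
    simp only [sub_self, abs_zero]
    split_ifs <;> simp <;> positivity
  · rw [hh] at hw ⊢
    rw [if_pos hb, mul_one]
    exact delta_abs h u h0 h1 _ hw
  · rw [hh, if_pos hb, mul_one, abs_sub_comm]
    exact delta_abs h u h0 h1 _ (by omega)

lemma main_bound (hn : 2 ≤ n) {lam : ℝ} (h : 0 < lam) (u : ℕ → ℝ) (h0 : ∀ k, 0 ≤ u k)
    (h1 : ∀ k, u k ≤ 1) (c : Fin n → Fin k) (L : Fin n → ℝ) (mu : ℝ)
    (hL : ∀ j, ∑ s, (if c s = c j then (1 : ℝ) else 0) = L j)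
    (hlam : n * lam = ∑ j, L j) (hmu : mu = ∑ j, L j ^ 2) :
    |(∑ σ : Equiv.Perm (Fin n), u (W c σ)) / n.factorial - PA lam u| ≤
      lam / (n - 1) + 2 * mu / (n ^ 2 * lam) := by
  classical
  have hn0 : (0 : ℝ) < n := by positivity
  have hn1 : (0 : ℝ) < n - 1 := by
    have : (2 : ℝ) ≤ n := by exact_mod_cast hn
    linarith
  have hN : (0 : ℝ) < n.factorial := by positivity
  have E1 : n * ∑ σ : Equiv.Perm (Fin n), (W c σ : ℝ) * f lam u (W c σ)
      = ∑ j, ∑ m, if c m = c j then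
        ∑ σ : Equiv.Perm (Fin n), f lam u (W c (Equiv.swap (σ j) m * σ)) else 0 := by
    have : ∀ σ : Equiv.Perm (Fin n), (W c σ : ℝ) * f lam u (W c σ)
        = ∑ j, ∑ m, if c m = c j then (if σ j = m then f lam u (W c σ) else 0) else 0 := by
      intro σ
      have hW : (W c σ : ℝ) = ∑ j, if c (σ j) = c j then (1 : ℝ) else 0 := by
        simp [W]
      nth_rewrite 1 [hW]
      rw [Finset.sum_mul]
      refine Finset.sum_congr rfl fun j _ => ?_
      rw [Finset.sum_eq_single (σ j)]
      · simp
      · intro b _ hb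
        simp [hb.symm]
      · simp
    simp_rw [this]
    rw [Finset.sum_comm, Finset.mul_sum]
    refine Finset.sum_congr rfl fun j _ => ?_
    rw [Finset.sum_comm, Finset.mul_sum]
    refine Finset.sum_congr rfl fun m _ => ?_
    by_cases hm : c m = c j
    · simp only [hm, if_true]
      exact (swap_sum j m (fun σ => f lam u (W c σ))).symm
    · simp [hm]
  have E2 : n * ∑ σ : Equiv.Perm (Fin n), lam * f lam u (W c σ + 1)
      = ∑ j, ∑ m, if c m = c j then
        ∑ σ : Equiv.Perm (Fin n), f lam u (W c σ + 1) else 0 := by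
    rw [← Finset.mul_sum, ← mul_assoc, hlam, Finset.sum_mul]
    refine Finset.sum_congr rfl fun j _ => ?_
    rw [← hL, Finset.sum_mul]
    refine Finset.sum_congr rfl fun m _ => ?_
    split_ifs <;> simp
  have E3 : n * (∑ σ : Equiv.Perm (Fin n), u (W c σ) - n.factorial * PA lam u)
      = ∑ j, ∑ m, if c m = c j then
        ∑ σ : Equiv.Perm (Fin n),
          (f lam u (W c σ + 1) - f lam u (W c (Equiv.swap (σ j) m * σ))) else 0 := by
    have e : ∑ σ : Equiv.Perm (Fin n), u (W c σ) - n.factorial * PA lam u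
        = ∑ σ : Equiv.Perm (Fin n), (lam * f lam u (W c σ + 1) - W c σ * f lam u (W c σ)) := by
      simp_rw [stein h u]
      rw [Finset.sum_sub_distrib]
      simp [Fintype.card_perm]
    rw [e, Finset.sum_sub_distrib, mul_sub, E1, E2, ← Finset.sum_sub_distrib]
    refine Finset.sum_congr rfl fun j _ => ?_
    rw [← Finset.sum_sub_distrib]
    refine Finset.sum_congr rfl fun m _ => ?_
    split_ifs
    · rw [Finset.sum_sub_distrib]
    · simp
  have E4 : |n * (∑ σ : Equiv.Perm (Fin n), u (W c σ) - n.factorial * PA lam u)|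
      ≤ ∑ j, L j * (1 / lam * (n.factorial * (2 * L j / n + lam / (n - 1)))) := by
    rw [E3]
    refine (Finset.abs_sum_le_sum_abs _ _).trans (Finset.sum_le_sum fun j _ => ?_)
    refine (Finset.abs_sum_le_sum_abs _ _).trans ?_
    rw [← hL j, Finset.sum_mul, hL j]
    refine Finset.sum_le_sum fun m _ => ?_
    split_ifs with hm
    · rw [one_mul]
      refine (Finset.abs_sum_le_sum_abs _ _).trans ?_
      refine (Finset.sum_le_sum fun σ _ => stein_diff h u h0 h1 c j m hm σ).trans ?_
      rw [← Finset.mul_sum]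
      refine mul_le_mul_of_nonneg_left ?_ (by positivity)
      refine bad_count hn c j m hm lam (L j) (hL j) ?_
      rw [hlam]
      exact Finset.sum_congr rfl fun j _ => (hL j).symm
    · simp
  have E5 : ∑ j, L j * (1 / lam * (n.factorial * (2 * L j / n + lam / (n - 1))))
      = n.factorial * n * (lam / (n - 1) + 2 * mu / (n ^ 2 * lam)) := by
    have : ∀ j, L j * (1 / lam * (n.factorial * (2 * L j / n + lam / (n - 1))))
      = (n.factorial * 2 / (lam * n)) * L j ^ 2 + (n.factorial / (n - 1)) * L j := by
      intro j; field_simp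
    simp_rw [this]
    rw [Finset.sum_add_distrib, ← Finset.mul_sum, ← Finset.mul_sum, ← hlam, ← hmu]
    field_simp; ring
  have E6 : (∑ σ : Equiv.Perm (Fin n), u (W c σ)) / n.factorial - PA lam u
      = (n * (∑ σ : Equiv.Perm (Fin n), u (W c σ) - n.factorial * PA lam u)) / (n.factorial * n) := by
    field_simp
  rw [E6, abs_div, abs_of_pos (show (0 : ℝ) < n.factorial * n by positivity),
    div_le_iff₀ (by positivity)]
  rw [E5] at E4
  linarith

end perm
end GMP

lemma GMP.poisson_real {lam : ℝ} (h : 0 < lam) (A : Set ℕ) :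
    (poissonMeasure lam A).toReal = GMP.PA lam (GMP.ind A) := by
  classical
  unfold poissonMeasure GMP.PA
  rw [Measure.sum_apply _ (MeasurableSet.of_discrete)]
  rw [ENNReal.tsum_toReal_eq]
  · refine tsum_congr fun k => ?_
    have := GMP.p_pos h k
    unfold GMP.p at this ⊢
    simp only [Measure.smul_apply, smul_eq_mul, ENNReal.toReal_mul, ENNReal.toReal_ofReal this.le]
    congr 1
    rw [Measure.dirac_apply' _ (MeasurableSet.of_discrete)]
    unfold GMP.ind
    by_cases hk : k ∈ A <;> simp [hk]
  · intro k
    simp only [Measure.smul_apply, smul_eq_mul]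
    exact ENNReal.mul_ne_top ENNReal.ofReal_ne_top (measure_ne_top _ _)

lemma GMP.unif_real {n : ℕ} (g : Equiv.Perm (Fin n) → ℕ) (A : Set ℕ) :
    (((uniformPerm n).map g) A).toReal = (∑ σ, GMP.ind A (g σ)) / n.factorial := by
  classical
  rw [Measure.map_apply (measurable_from_top) (MeasurableSet.of_discrete)]
  unfold uniformPerm
  rw [Measure.smul_apply, smul_eq_mul, ENNReal.toReal_mul,
    Measure.count_apply (MeasurableSpace.measurableSet_top)]
  rw [Set.encard_eq_coe_toFinset_card]
  simp [Fintype.card_perm, GMP.ind]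
  rw [div_eq_inv_mul]

/-- Generalized matching: a uniformly random permutation of a multiset on symbols
`1, …, k`, symbol `i` appearing `l_i` times (realized via a labelling map `c`).  If `W`
is the number of fixed points of the induced permutation of the multiset,
`λ = (1/n) Σ l_i²` and `μ = Σ l_i³`, then
`‖L(W) - Poi_λ‖_TV ≤ 1.4 [λ^{3/2}/(n-1) + 3μ/(2n²λ^{1/2})]`. -/
theorem generalized_matching_poisson_approx
    (k : ℕ) (l : Fin k → ℕ) (hl : ∀ i, 1 ≤ l i)
    (n : ℕ) (hn : n = ∑ i, l i) (hn2 : 2 ≤ n)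
    (c : Fin n → Fin k) (hc : ∀ i, (Finset.univ.filter fun j => c j = i).card = l i)
    (lam : ℝ) (hlam : lam = (1 / n) * ∑ i, (l i : ℝ) ^ 2)
    (mu : ℝ) (hmu : mu = ∑ i, (l i : ℝ) ^ 3) :
    ∀ A : Set ℕ,
      |(((uniformPerm n).map
          (fun σ => (Finset.univ.filter fun j => c (σ j) = c j).card)) A).toReal -
        (poissonMeasure lam A).toReal| ≤
      1.4 * (lam ^ ((3 : ℝ) / 2) / (n - 1) + 3 * mu / (2 * n ^ 2 * Real.sqrt lam)) := by
  intro A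
  have hn0 : (0 : ℝ) < n := by positivity
  have hn1 : (0 : ℝ) < n - 1 := by
    have : (2 : ℝ) ≤ n := by exact_mod_cast hn2
    linarith
  have hlam' : n * lam = ∑ i, (l i : ℝ) ^ 2 := by
    rw [hlam]; field_simp
  have hlam1 : 1 ≤ lam := by
    have : (n : ℝ) ≤ ∑ i, (l i : ℝ) ^ 2 := by
      rw [hn]; push_cast
      refine Finset.sum_le_sum fun i _ => ?_
      have : (1 : ℝ) ≤ l i := by exact_mod_cast hl i
      nlinarith
    rw [← hlam'] at this
    by_contra hlt
    push Not at hlt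
    nlinarith
  have h : 0 < lam := by linarith
  have hfib : ∀ g : Fin k → ℝ, ∑ j, g (c j) = ∑ i, l i * g i := by
    intro g
    rw [← Finset.sum_fiberwise (s := Finset.univ) (g := c)]
    refine Finset.sum_congr rfl fun i _ => ?_
    rw [Finset.sum_congr rfl (g := fun _ => g i), Finset.sum_const, hc, nsmul_eq_mul]
    intro x hx
    rw [(Finset.mem_filter.1 hx).2]
  have hmu0 : 0 ≤ mu := by rw [hmu]; positivity
  have M := GMP.main_bound hn2 h (GMP.ind A) (GMP.ind_nonneg A) (GMP.ind_le A) c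
    (fun j => (l (c j) : ℝ)) mu
    (by
      intro j
      rw [← hc (c j)]
      simp)
    (by
      rw [hlam', hfib (fun i => (l i : ℝ))]
      exact Finset.sum_congr rfl fun i _ => by ring)
    (by
      rw [hmu, hfib (fun i => (l i : ℝ) ^ 2)]
      exact Finset.sum_congr rfl fun i _ => by ring)
  rw [GMP.poisson_real h, GMP.unif_real]
  refine le_trans M ?_
  have hs1 : 1 ≤ Real.sqrt lam := Real.one_le_sqrt.2 hlam1
  have hsq : Real.sqrt lam * Real.sqrt lam = lam := Real.mul_self_sqrt h.le
  have hr : lam ^ ((3 : ℝ) / 2) = lam * Real.sqrt lam := by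
    rw [Real.sqrt_eq_rpow, ← Real.rpow_one_add' h.le (by norm_num)]
    norm_num
  rw [hr]
  have t1 : lam / (n - 1) ≤ 1.4 * (lam * Real.sqrt lam / (n - 1)) := by
    rw [← mul_div_assoc]
    apply div_le_div_of_nonneg_right _ hn1.le
    nlinarith
  have t2 : 2 * mu / (n ^ 2 * lam) ≤ 1.4 * (3 * mu / (2 * n ^ 2 * Real.sqrt lam)) := by
    have hb : (0 : ℝ) ≤ mu / (n ^ 2 * Real.sqrt lam) := by positivity
    have e1 : 1.4 * (3 * mu / (2 * n ^ 2 * Real.sqrt lam)) = 2.1 * (mu / (n ^ 2 * Real.sqrt lam)) := by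
      field_simp; ring
    have e2 : 2 * mu / (n ^ 2 * lam) ≤ 2 * (mu / (n ^ 2 * Real.sqrt lam)) := by
      rw [mul_div_assoc]
      have : Real.sqrt lam ≤ lam := by nlinarith
      gcongr
    rw [e1]; linarith
  linarith
end

section
/- Drop k ≥ 1 balls independently and uniformly into n ≥ 1 boxes; that is, let b_1, …, b_k be i.i.d. uniform on {1, …, n}. Let W be the number of boxes containing at least two balls and set θ = k/√n. Then ‖L(W) - Poi_{θ²/2}‖_TV ≤ min(1, √2 · θ^{-1}) · [(19θ³ + 6θ)/(12√n) + θ²/(2n)]. -/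
open MeasureTheory

instance (n : ℕ) : MeasurableSpace (Fin n) := ⊤

/-- The uniform distribution on allocations of `k` balls to `n` boxes, i.e. the law of
`k` i.i.d. balls each uniform on the `n` boxes. -/
noncomputable def uniformAlloc (k n : ℕ) : Measure (Fin k → Fin n) :=
  (Fintype.card (Fin k → Fin n) : ENNReal)⁻¹ • Measure.count


noncomputable def pp (l : ℝ) (i : ℕ) : ℝ := Real.exp (-l) * l ^ i / (Nat.factorial i)
noncomputable def FF (l : ℝ) (j : ℕ) : ℝ := ∑ i ∈ Finset.range (j+1), pp l i

lemma pp_pos {l : ℝ} (hl : 0 < l) (i : ℕ) : 0 < pp l i := by unfold pp; positivity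

lemma pp_succ (l : ℝ) (i : ℕ) : ((i:ℝ)+1) * pp l (i+1) = l * pp l i := by
  unfold pp
  rw [Nat.factorial_succ]
  have : (Nat.factorial i : ℝ) ≠ 0 := by positivity
  push_cast
  field_simp
  ring

lemma pp_hasSum (l : ℝ) : HasSum (pp l) 1 := by
  have h := (NormedSpace.expSeries_div_hasSum_exp (𝔸 := ℝ) l).mul_left (Real.exp (-l))
  rw [← Real.exp_eq_exp_ℝ, ← Real.exp_add] at h
  simp only [neg_add_cancel, Real.exp_zero] at h
  have e : pp l = fun i => Real.exp (-l) * (l ^ i / (Nat.factorial i)) := by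
    funext i; unfold pp; ring
  rw [e]; exact h

lemma FF_succ (l : ℝ) (j : ℕ) : FF l (j+1) = FF l j + pp l (j+1) := by
  unfold FF; rw [Finset.sum_range_succ]

lemma FF_zero (l : ℝ) : FF l 0 = pp l 0 := by simp [FF]

lemma FF_pos {l : ℝ} (hl : 0 < l) (j : ℕ) : 0 < FF l j := 
  Finset.sum_pos (fun i _ => pp_pos hl i) (by simp)

lemma FF_tail (l : ℝ) (j : ℕ) : HasSum (fun i => pp l (i + (j+1))) (1 - FF l j) := by
  exact (hasSum_nat_add_iff' (j+1)).2 (pp_hasSum l)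

lemma FF_le {l : ℝ} (hl : 0 < l) (j : ℕ) : FF l j ≤ 1 := by
  have := (FF_tail l j).nonneg (fun i => (pp_pos hl _).le)
  linarith

lemma tail_ineq {l : ℝ} (hl : 0 < l) (j : ℕ) :
    ((j:ℝ)+1) * (1 - FF l j) ≤ l * (1 - FF l j + pp l j) := by
  have h1 := (FF_tail l j).mul_left ((j:ℝ)+1)
  have h2 : HasSum (fun i => l * pp l (i + j)) (l * (1 - FF l j + pp l j)) := by
    have := ((hasSum_nat_add_iff' (f := pp l) j).2 (pp_hasSum l)).mul_left l
    have e : 1 - FF l j + pp l j = 1 - ∑ i ∈ Finset.range j, pp l i := by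
      unfold FF; rw [Finset.sum_range_succ]; ring
    rw [e]; exact this
  refine hasSum_le (fun i => ?_) h1 h2
  have := pp_succ l (i+j)
  rw [← this, show i + (j+1) = i + j + 1 by ring]
  have := pp_pos hl (i+j+1)
  push_cast
  have : (0:ℝ) ≤ i := by positivity
  gcongr; linarith

lemma head_ineq {l : ℝ} (hl : 0 < l) (j : ℕ) :
    l * FF l j ≤ ((j:ℝ)+1) * (FF l (j+1) - pp l 0) := by
  induction j with
  | zero =>
    rw [FF_succ, FF_zero]
    have := pp_succ l 0
    simp at this ⊢; linarith
  | succ j ih =>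
    rw [FF_succ l j, FF_succ l (j+1)]
    have := pp_succ l (j+1)
    have h3 : 0 ≤ FF l (j+1) - pp l 0 := by
      by_contra h
      push Not at h
      have := mul_pos hl (FF_pos hl j)
      have : ((j:ℝ)+1) * (FF l (j+1) - pp l 0) ≤ 0 := 
        mul_nonpos_of_nonneg_of_nonpos (by positivity) h.le
      linarith
    push_cast at *
    nlinarith

lemma pp_deriv (l : ℝ) (j : ℕ) : HasDerivAt (fun x => pp x (j+1)) (pp l j - pp l (j+1)) l := by
  unfold pp
  have h := (((hasDerivAt_id l).neg.exp).mul (hasDerivAt_pow (j+1) l)).div_const ((j+1).factorial:ℝ)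
  refine h.congr_deriv ?_
  rw [Nat.factorial_succ]
  have : (Nat.factorial j : ℝ) ≠ 0 := by positivity
  push_cast
  simp
  field_simp
  ring

lemma pp_deriv0 (l : ℝ) : HasDerivAt (fun x => pp x 0) (- pp l 0) l := by
  unfold pp
  have h := ((hasDerivAt_id l).neg.exp)
  simpa using h

lemma pp_deriv' {l : ℝ} (hl : 0 < l) (j : ℕ) : HasDerivAt (fun x => pp x j) (pp l j * (j / l - 1)) l := by
  cases j with
  | zero => refine (pp_deriv0 l).congr_deriv ?_; simp
  | succ j =>
    refine (pp_deriv l j).congr_deriv ?_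
    have := pp_succ l j
    push_cast
    field_simp
    linarith

lemma FF_deriv (l : ℝ) (j : ℕ) : HasDerivAt (fun x => FF x j) (- pp l j) l := by
  induction j with
  | zero => simp only [FF_zero]; exact pp_deriv0 l
  | succ j ih =>
    simp only [FF_succ]
    refine (ih.add (pp_deriv l j)).congr_deriv ?_
    ring

lemma FF_tendsto (j : ℕ) : Filter.Tendsto (fun x => FF x j) Filter.atTop (nhds 0) := by
  unfold FF
  rw [show (0:ℝ) = ∑ i ∈ Finset.range (j+1), 0 by simp]
  refine tendsto_finsetSum _ fun i _ => ?_
  unfold pp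
  have := (Real.tendsto_pow_mul_exp_neg_atTop_nhds_zero i).div_const (i.factorial:ℝ)
  simp only [zero_div] at this
  refine this.congr fun x => ?_
  ring

lemma cheeger {l : ℝ} (hl : 0 < l) (j : ℕ) :
    FF l j * (1 - FF l j) ≤ Real.sqrt l * pp l j := by
  by_contra hneg
  push Not at hneg
  set Φ : ℝ → ℝ := fun x => Real.sqrt x * pp x j - FF x j * (1 - FF x j) with hΦ
  have hcF : Continuous (fun x => FF x j) := by
    unfold FF pp; fun_prop
  have hcP : Continuous (fun x => pp x j) := by
    unfold pp; fun_prop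
  have hcont : Continuous Φ := by
    exact (Real.continuous_sqrt.mul hcP).sub (hcF.mul (continuous_const.sub hcF))
  have hl0 : Φ l < 0 := by simp only [hΦ]; linarith
  have hev := (FF_tendsto j).eventually (gt_mem_nhds (show 0 < - Φ l by linarith))
  obtain ⟨B, hB⟩ := Filter.eventually_atTop.1 hev
  set B' := max B l with hB'
  have hlB : l ∈ Set.Icc 0 B' := ⟨hl.le, le_max_right _ _⟩
  obtain ⟨x, hx, hmin⟩ := isCompact_Icc.exists_isMinOn ⟨l, hlB⟩ hcont.continuousOn
  have hxl : Φ x ≤ Φ l := hmin hlB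
  have hF00 : FF 0 j = 1 := by
    unfold FF pp
    rw [Finset.sum_range_succ']
    simp
  have hx0 : 0 < x := by
    rcases hx.1.lt_or_eq with h | h
    · exact h
    · exfalso
      rw [← h] at hxl
      simp only [hΦ, hF00] at hxl
      simp only [hΦ] at hl0
      simp at hxl
      linarith
  have hglob : ∀ y, 0 < y → Φ x ≤ Φ y := by
    intro y hy
    by_cases hyB : y ≤ B'
    · exact hmin ⟨hy.le, hyB⟩
    · have h1 := hB y (le_trans (le_max_left _ _) (not_le.1 hyB).le)
      have h2 : 0 ≤ Real.sqrt y * pp y j := mul_nonneg (Real.sqrt_nonneg _) (pp_pos hy j).le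
      have h3 := FF_pos hy j
      have : - FF y j ≤ Φ y := by simp only [hΦ]; nlinarith
      linarith
  set K : ℝ → ℝ := fun y => (j+1/2) / Real.sqrt y - Real.sqrt y - 1 + 2 * (1 - FF y j) with hK
  have hder : ∀ y, 0 < y → HasDerivAt Φ (pp y j * K y) y := by
    intro y hy
    have hs := Real.hasDerivAt_sqrt hy.ne'
    have hF := FF_deriv y j
    have h := (hs.mul (pp_deriv' hy j)).sub (hF.mul (hF.const_sub 1))
    refine h.congr_deriv ?_
    simp only [hK]
    have hsp : 0 < Real.sqrt y := Real.sqrt_pos.2 hy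
    have hsq : y = Real.sqrt y ^ 2 := (Real.sq_sqrt hy.le).symm
    have e : (j:ℝ) / y = j / Real.sqrt y ^ 2 := by rw [← hsq]
    rw [e]
    field_simp
    ring
  have hcrit : K x = 0 := by
    have hloc : IsLocalMin Φ x := by
      filter_upwards [lt_mem_nhds hx0] with y hy using hglob y hy
    have := hloc.hasDerivAt_eq_zero (hder x hx0)
    rcases mul_eq_zero.1 this with h | h
    · exact absurd h (pp_pos hx0 j).ne'
    · exact h
  have hsx : 0 < Real.sqrt x := Real.sqrt_pos.2 hx0
  have hKd : HasDerivAt K (- (j+1/2) * (1 / (2 * Real.sqrt x)) / (Real.sqrt x)^2 - 1 / (2 * Real.sqrt x) + 2 * pp x j) x := by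
    have hs := Real.hasDerivAt_sqrt hx0.ne'
    have h := (((hs.inv hsx.ne').const_mul ((j:ℝ)+1/2)).sub hs).sub_const 1 |>.add
      (((FF_deriv x j).const_sub 1).const_mul 2)
    refine h.congr_deriv ?_
    ring
  have hKneg : - (j+1/2) * (1 / (2 * Real.sqrt x)) / (Real.sqrt x)^2 - 1 / (2 * Real.sqrt x) + 2 * pp x j < 0 := by
    have h1 : Real.sqrt x * pp x j < 1/4 := by
      have : Φ x < 0 := by linarith
      simp only [hΦ] at this
      nlinarith [sq_nonneg (FF x j - 1/2)]
    have h2 : - ((j:ℝ)+1/2) * (1 / (2 * Real.sqrt x)) / (Real.sqrt x)^2 ≤ 0 := by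
      rw [neg_mul, neg_div]
      have : 0 ≤ ((j:ℝ)+1/2) * (1 / (2 * Real.sqrt x)) / (Real.sqrt x)^2 := by positivity
      linarith
    have h3 : 2 * pp x j < 1 / (2 * Real.sqrt x) := by
      rw [lt_div_iff₀ (by positivity)]
      linarith
    linarith
  -- K < 0 just to the right
  have hright : ∀ᶠ y in nhdsWithin x (Set.Ioi x), K y < 0 := by
    have ht := hKd.tendsto_slope
    have h1 : ∀ᶠ y in nhdsWithin x {x}ᶜ, slope K x y < 0 := ht.eventually (gt_mem_nhds hKneg)
    have h2 : ∀ᶠ y in nhdsWithin x (Set.Ioi x), slope K x y < 0 :=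
      h1.filter_mono (nhdsWithin_mono _ (fun y hy => ne_of_gt hy))
    filter_upwards [h2, self_mem_nhdsWithin] with y hy hxy
    rw [slope_def_field, hcrit, sub_zero] at hy
    by_contra hc
    push Not at hc
    have : 0 ≤ K y / (y - x) := div_nonneg hc (sub_nonneg.2 (le_of_lt hxy))
    linarith
  obtain ⟨u, hu, hKu⟩ := mem_nhdsGT_iff_exists_Ioo_subset.1 hright
  have hxu : x < u := hu
  set y := (x+u)/2 with hy
  have hxy : x < y := by rw [hy]; linarith
  have hyu : y < u := by rw [hy]; linarith
  obtain ⟨c, hc, hce⟩ := exists_hasDerivAt_eq_slope Φ (fun z => pp z j * K z) hxy hcont.continuousOn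
    (fun z hz => hder z (hx0.trans hz.1))
  have hKc : K c < 0 := hKu ⟨hc.1, hc.2.trans hyu⟩
  have : pp c j * K c < 0 := mul_neg_of_pos_of_neg (pp_pos (hx0.trans hc.1) j) hKc
  have h4 : 0 ≤ (Φ y - Φ x) / (y - x) :=
    div_nonneg (sub_nonneg.2 (hglob y (hx0.trans hxy))) (sub_nonneg.2 hxy.le)
  linarith

lemma cheeger_one {l : ℝ} (hl : 0 < l) (j : ℕ) :
    FF l j * (1 - FF l j) ≤ l * pp l j := by
  rcases le_total 1 l with h | h
  · refine (cheeger hl j).trans ?_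
    have : Real.sqrt l ≤ l := Real.sqrt_le_iff.2 ⟨hl.le, by nlinarith⟩
    exact mul_le_mul_of_nonneg_right this (pp_pos hl j).le
  · have hF := FF_pos hl j
    have hF1 := FF_le hl j
    cases j with
    | zero =>
      rw [FF_zero] at *
      have : 1 - pp l 0 ≤ l := by
        have := Real.add_one_le_exp (-l)
        simp [pp]; linarith
      nlinarith
    | succ j =>
      have := tail_ineq hl (j+1)
      push_cast at this
      have hj : (0:ℝ) ≤ j := by positivity
      nlinarith [mul_nonneg hj (sub_nonneg.2 hF1), mul_nonneg (sub_nonneg.2 h) (sub_nonneg.2 hF1)]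

lemma key_alg {x y b P F p0 J l T : ℝ} (h1 : 0 ≤ x) (h2 : x ≤ F) (h3 : 0 ≤ y) (h4 : y ≤ P)
    (h5 : 0 ≤ b) (h6 : b ≤ T) (hTd : T = 1 - (F + P)) (hl : 0 < l) (hJ : 0 < J) (hp0 : 0 < p0)
    (hT : (J + 1) * T ≤ l * (T + P)) (hH : l * F ≤ J * (F + P - p0)) :
    |J * (x + y - (x + y + b) * (F + P)) - l * (x - (x + y + b) * F)| ≤ J * P * (1 - p0) := by
  have hT0 : 0 ≤ T := h5.trans h6
  have hF0 : 0 ≤ F := h1.trans h2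
  have c1 : J * T - l * (T + P) ≤ 0 := by linarith
  have c2 : J * T + l * F ≤ J * (1 - p0) := by rw [hTd]; linarith
  have hJp : 0 ≤ J * p0 := by positivity
  have c3 : l * F - J * (F + P) ≤ 0 := by linarith
  have c2' : 0 ≤ J * (1 - p0) := by
    have : 0 ≤ J * T + l * F := by positivity
    linarith
  have ee : J * (x + y - (x + y + b) * (F + P)) - l * (x - (x + y + b) * F)
    = x * (J * T - l * (T + P)) + y * (J * T + l * F) + b * (l * F - J * (F + P)) := by
    rw [hTd]; ring
  have ee2 : J * (x + y - (x + y + b) * (F + P)) - l * (x - (x + y + b) * F)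
    = - ((F - x) * (J * T - l * (T + P)) + (P - y) * (J * T + l * F) + (T - b) * (l * F - J * (F + P))) := by
    rw [hTd]; ring
  have e3 : J * P * (1 - p0) = P * (J * (1 - p0)) := by ring
  rw [abs_le, e3]
  constructor
  · rw [ee2]
    have i1 := mul_nonpos_of_nonneg_of_nonpos (sub_nonneg.2 h2) c1
    have i2 := mul_le_mul_of_nonneg_left c2 (sub_nonneg.2 h4)
    have i3 := mul_nonpos_of_nonneg_of_nonpos (sub_nonneg.2 h6) c3
    have i4 := mul_le_mul_of_nonneg_right (show P - y ≤ P by linarith) c2'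
    linarith
  · rw [ee]
    have i1 := mul_nonpos_of_nonneg_of_nonpos h1 c1
    have i2 := mul_le_mul_of_nonneg_left c2 h3
    have i3 := mul_nonpos_of_nonneg_of_nonpos h5 c3
    have i4 := mul_le_mul_of_nonneg_right h4 c2'
    linarith

/-- Stein solution. -/
lemma stein {l : ℝ} (hl : 0 < l) (A : Set ℕ) : ∃ g : ℕ → ℝ,
    (∀ j : ℕ, l * g (j+1) - j * g j = A.indicator 1 j - ∑' i, A.indicator (pp l) i) ∧
    (∀ j, |g j| ≤ min 1 (1 / Real.sqrt l)) ∧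
    (∀ j, |g (j+1) - g j| ≤ min 1 (1 / Real.sqrt l)) := by
  classical
  set p := ∑' i, A.indicator (pp l) i with hp
  set q : ℕ → ℝ := A.indicator (pp l) with hq
  have hq0 : ∀ i, 0 ≤ q i := fun i => Set.indicator_nonneg (fun i _ => (pp_pos hl i).le) i
  have hq1 : ∀ i, q i ≤ pp l i := fun i => Set.indicator_le_self' (fun i _ => (pp_pos hl i).le) i
  have hqs : HasSum q p := ((pp_hasSum l).summable.of_nonneg_of_le hq0 hq1).hasSum
  set a : ℕ → ℝ := fun j => ∑ i ∈ Finset.range (j+1), q i with ha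
  have ha0 : ∀ j, 0 ≤ a j := fun j => Finset.sum_nonneg fun i _ => hq0 i
  have ha1 : ∀ j, a j ≤ FF l j := fun j => Finset.sum_le_sum fun i _ => hq1 i
  have has : ∀ j, a (j+1) = a j + q (j+1) := fun j => by simp only [ha]; rw [Finset.sum_range_succ]
  have htail : ∀ j, HasSum (fun i => q (i + (j+1))) (p - a j) := fun j =>
    (hasSum_nat_add_iff' (j+1)).2 hqs
  have hb0 : ∀ j, 0 ≤ p - a j := fun j => (htail j).nonneg fun i => hq0 _
  have hb1 : ∀ j, p - a j ≤ 1 - FF l j := fun j => hasSum_le (fun i => hq1 _) (htail j) (FF_tail l j)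
  have hqi : ∀ j, q j = A.indicator 1 j * pp l j := by
    intro j; simp only [hq, Set.indicator]; split_ifs <;> simp
  have hs : 0 < Real.sqrt l := Real.sqrt_pos.2 hl
  refine ⟨fun j => (a (j-1) - p * FF l (j-1)) / (l * pp l (j-1)), ?_, ?_, ?_⟩
  · intro j
    cases j with
    | zero =>
      have h0 := (pp_pos hl 0).ne'
      simp only [ha, hqi]
      simp [FF_zero]
      field_simp
    | succ j =>
      have h0 := (pp_pos hl j).ne'
      have h1 := (pp_pos hl (j+1)).ne'
      simp only [Nat.add_sub_cancel]
      rw [has, FF_succ, hqi, ← pp_succ l j]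
      push_cast
      field_simp
      ring
  · intro j
    suffices H : ∀ j, |(a j - p * FF l j) / (l * pp l j)| ≤ min 1 (1 / Real.sqrt l) from H (j-1)
    intro j
    show |(a j - p * FF l j) / (l * pp l j)| ≤ _
    have hpj := pp_pos hl j
    have hF := FF_pos hl j
    have hF1 := FF_le hl j
    have key : |a j - p * FF l j| ≤ FF l j * (1 - FF l j) := by
      have := ha0 j; have := ha1 j; have := hb0 j; have := hb1 j
      rw [abs_le]
      constructor <;> nlinarith
    rw [abs_div, abs_of_pos (show 0 < l * pp l j by positivity), div_le_iff₀ (by positivity)]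
    rcases min_choice 1 (1 / Real.sqrt l) with h | h <;> rw [h]
    · have := cheeger_one hl j; linarith
    · have := cheeger hl j
      have e : 1 / Real.sqrt l * (l * pp l j) = Real.sqrt l * pp l j := by
        have := Real.mul_self_sqrt hl.le
        field_simp; nlinarith
      linarith
  · intro j
    cases j with
    | zero => simp
    | succ j =>
      simp only [Nat.add_sub_cancel]
      have hpj := pp_pos hl j
      have hpj1 := pp_pos hl (j+1)
      have hp0 := pp_pos hl 0
      have hps := pp_succ l j
      have hFs := FF_succ l j
      have hT := tail_ineq hl (j+1)
      have hH := head_ineq hl j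
      have hj : (0:ℝ) < (j:ℝ)+1 := by positivity
      have hF1 := FF_le hl (j+1)
      have key : |(a (j+1) - p * FF l (j+1)) / (l * pp l (j+1)) - (a j - p * FF l j) / (l * pp l j)|
          ≤ (1 - pp l 0) / l := by
        have e : (a (j+1) - p * FF l (j+1)) / (l * pp l (j+1)) - (a j - p * FF l j) / (l * pp l j)
          = (((j:ℝ)+1) * (a (j+1) - p * FF l (j+1)) - l * (a j - p * FF l j)) / (l * (((j:ℝ)+1) * pp l (j+1))) := by
          rw [← hps]
          field_simp
        rw [e, abs_div, abs_of_pos (show 0 < l * (((j:ℝ)+1) * pp l (j+1)) by positivity),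
          div_le_div_iff₀ (by positivity) hl]
        have key2 : |((j:ℝ)+1) * (a (j+1) - p * FF l (j+1)) - l * (a j - p * FF l j)| ≤
            ((j:ℝ)+1) * pp l (j+1) * (1 - pp l 0) := by
          have hpe : p = a j + q (j+1) + (p - a (j+1)) := by rw [has]; ring
          have hTd : 1 - FF l (j+1) = 1 - (FF l j + pp l (j+1)) := by rw [hFs]
          have hT' : ((j:ℝ)+1+1) * (1 - FF l (j+1)) ≤ l * (1 - FF l (j+1) + pp l (j+1)) := by
            push_cast at hT; exact hT
          rw [hFs] at hH
          have := key_alg (ha0 j) (ha1 j) (hq0 (j+1)) (hq1 (j+1)) (hb0 (j+1)) (hb1 (j+1)) hTd hl hj hp0 hT' hH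
          rw [← hpe, ← hFs, ← has] at this
          exact this
        have := mul_le_mul_of_nonneg_right key2 hl.le
        linarith
      refine key.trans ?_
      have e0 : 1 - pp l 0 ≤ l := by
        have := Real.add_one_le_exp (-l)
        simp [pp]; linarith
      rw [div_le_iff₀ hl]
      rcases min_choice 1 (1 / Real.sqrt l) with h | h
      · rw [h]; linarith
      · rw [h]
        have h1 : 1 / Real.sqrt l ≤ 1 := by rw [← h]; exact min_le_left _ _
        have h2 : 1 ≤ Real.sqrt l := by rwa [div_le_one hs] at h1
        have : 1 / Real.sqrt l * l = Real.sqrt l := by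
          have := Real.mul_self_sqrt hl.le
          field_simp; nlinarith
        linarith

section comb
variable {k n : ℕ}

def DD (ω : Fin k → Fin n) : Finset (Fin n) :=
  Finset.univ.filter fun b : Fin n => 2 ≤ (Finset.univ.filter fun i : Fin k => ω i = b).card

def RR (ω : Fin k → Fin n) (a b : Fin k) : ℕ :=
  (Finset.univ.filter fun c : Fin k => c ≠ a ∧ c ≠ b ∧ ω c = ω a).card

def QQ (ω : Fin k → Fin n) (b : Fin k) : ℕ :=
  (Finset.univ.filter fun c : Fin k => c ≠ b ∧ ω c = ω b).card

lemma mem_DD (ω : Fin k → Fin n) (v : Fin n) : v ∈ DD ω ↔ ∃ i j, i ≠ j ∧ ω i = v ∧ ω j = v := by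
  unfold DD
  simp only [Finset.mem_filter, Finset.mem_univ, true_and]
  rw [← Nat.lt_iff_add_one_le, Finset.one_lt_card]
  simp only [Finset.mem_filter, Finset.mem_univ, true_and]
  constructor
  · rintro ⟨a, ha, b, hb, h⟩; exact ⟨a, b, h, ha, hb⟩
  · rintro ⟨a, b, h, ha, hb⟩; exact ⟨a, ha, b, hb, h⟩

lemma DD_update (ω : Fin k → Fin n) {a b : Fin k} (hab : a ≠ b) :
    (DD (Function.update ω b (ω a))).card ≤ (DD ω).card + 1 ∧
    (DD ω).card + 1 ≤ (DD (Function.update ω b (ω a))).card + RR ω a b + QQ ω b := by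
  set ω' := Function.update ω b (ω a) with hω
  have hb : ω' b = ω a := by simp [hω]
  have hne : ∀ c, c ≠ b → ω' c = ω c := fun c hc => by simp [hω, hc]
  have m1 : ω a ∈ DD ω' := (mem_DD _ _).2 ⟨a, b, hab, hne a hab, hb⟩
  constructor
  · have : DD ω' ⊆ insert (ω a) (DD ω) := by
      intro v hv
      rw [Finset.mem_insert]
      by_cases h : v = ω a
      · exact Or.inl h
      · right
        obtain ⟨i, j, hij, hi, hj⟩ := (mem_DD _ _).1 hv
        have hib : i ≠ b := by rintro rfl; exact h (hi ▸ hb)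
        have hjb : j ≠ b := by rintro rfl; exact h (hj ▸ hb)
        exact (mem_DD _ _).2 ⟨i, j, hij, by rw [← hne i hib, hi], by rw [← hne j hjb, hj]⟩
    exact (Finset.card_le_card this).trans (Finset.card_insert_le _ _)
  · have s1 : (DD ω).erase (ω b) ⊆ DD ω' := by
      intro v hv
      rw [Finset.mem_erase] at hv
      obtain ⟨i, j, hij, hi, hj⟩ := (mem_DD _ _).1 hv.2
      have hib : i ≠ b := by rintro rfl; exact hv.1 hi.symm
      have hjb : j ≠ b := by rintro rfl; exact hv.1 hj.symm
      exact (mem_DD _ _).2 ⟨i, j, hij, by rw [hne i hib, hi], by rw [hne j hjb, hj]⟩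
    have hQ : QQ ω b = 0 → ω b ∉ DD ω := by
      intro h0 hm
      obtain ⟨i, j, hij, hi, hj⟩ := (mem_DD _ _).1 hm
      unfold QQ at h0
      rw [Finset.card_eq_zero, Finset.filter_eq_empty_iff] at h0
      have e1 : i = b := by by_contra h; exact h0 (Finset.mem_univ i) ⟨h, hi⟩
      have e2 : j = b := by by_contra h; exact h0 (Finset.mem_univ j) ⟨h, hj⟩
      exact hij (e1.trans e2.symm)
    have hR : RR ω a b = 0 → ω a ≠ ω b → ω a ∉ DD ω := by
      intro h0 hw hm
      obtain ⟨i, j, hij, hi, hj⟩ := (mem_DD _ _).1 hm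
      unfold RR at h0
      rw [Finset.card_eq_zero, Finset.filter_eq_empty_iff] at h0
      have hib : i ≠ b := by rintro rfl; exact hw hi.symm
      have hjb : j ≠ b := by rintro rfl; exact hw hj.symm
      have e1 : i = a := by by_contra h; exact h0 (Finset.mem_univ i) ⟨h, hib, hi⟩
      have e2 : j = a := by by_contra h; exact h0 (Finset.mem_univ j) ⟨h, hjb, hj⟩
      exact hij (e1.trans e2.symm)
    have c1 := Finset.card_le_card s1
    have c2 : (DD ω).card ≤ ((DD ω).erase (ω b)).card + 1 := by
      have := Finset.pred_card_le_card_erase (s := DD ω) (a := ω b); omega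
    by_cases hw : ω a = ω b
    · have : ω' = ω := by rw [hω, hw]; simp
      rw [this]
      have : QQ ω b ≠ 0 := by
        unfold QQ
        rw [Finset.card_ne_zero]
        exact ⟨a, by simp [hab, hw]⟩
      omega
    · have c3 : RR ω a b = 0 → ((DD ω).erase (ω b)).card + 1 ≤ (DD ω').card := by
        intro h0
        have hn : ω a ∉ (DD ω).erase (ω b) := fun h => hR h0 hw (Finset.mem_of_mem_erase h)
        rw [← Finset.card_insert_of_notMem hn]
        exact Finset.card_le_card (Finset.insert_subset m1 s1)
      have c4 : QQ ω b = 0 → ((DD ω).erase (ω b)).card = (DD ω).card := by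
        intro h0
        rw [Finset.erase_eq_of_notMem (hQ h0)]
      by_cases hr : RR ω a b = 0 <;> by_cases hq : QQ ω b = 0
      · have := c3 hr; have := c4 hq; omega
      · have := c3 hr; omega
      · have := c4 hq; omega
      · omega

lemma resample (b : Fin k) (h : (Fin k → Fin n) → ℝ) :
    (n:ℝ) * ∑ ω, h ω = ∑ ω, ∑ x, h (Function.update ω b x) := by
  have inv : Function.Involutive (fun q : (Fin k → Fin n) × Fin n => (Function.update q.1 b q.2, q.1 b)) := by
    rintro ⟨ω, x⟩; simp
  have e := Equiv.sum_comp inv.toPerm (fun q => h q.1)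
  rw [Fintype.sum_prod_type, Fintype.sum_prod_type] at e
  simp [Function.Involutive.toPerm] at e
  rw [Finset.mul_sum, ← e]

lemma replace_lem {a b : Fin k} (hab : a ≠ b) (f : (Fin k → Fin n) → ℝ) :
    (n:ℝ) * ∑ ω, (if ω b = ω a then f ω else 0) = ∑ ω, f (Function.update ω b (ω a)) := by
  rw [resample b]
  refine Finset.sum_congr rfl fun ω _ => ?_
  simp [hab]

lemma sum_coll (hn : 1 ≤ n) {a b : Fin k} (hab : a ≠ b) :
    ∑ ω : Fin k → Fin n, (if ω b = ω a then (1:ℝ) else 0) = (n:ℝ)^k / n := by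
  have h := replace_lem (n := n) hab (fun _ => 1)
  have : (0:ℝ) < n := by exact_mod_cast hn
  rw [eq_div_iff this.ne', mul_comm, h]
  simp

lemma sum_QQ (hn : 1 ≤ n) (b : Fin k) :
    ∑ ω : Fin k → Fin n, (QQ ω b : ℝ) ≤ k * ((n:ℝ)^k / n) := by
  have e : ∀ ω : Fin k → Fin n, (QQ ω b : ℝ) = ∑ c ∈ Finset.univ.filter (fun c => c ≠ b), (if ω c = ω b then (1:ℝ) else 0) := by
    intro ω
    rw [Finset.sum_boole, Finset.filter_filter]; rfl
  simp only [e]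
  rw [Finset.sum_comm]
  rw [Finset.sum_congr rfl (fun c hc => sum_coll hn (a := b) (b := c) (by simpa using (Finset.mem_filter.1 hc).2.symm))]
  rw [Finset.sum_const, nsmul_eq_mul]
  have := Finset.card_filter_le (Finset.univ : Finset (Fin k)) (fun c => c ≠ b)
  simp only [Finset.card_univ, Fintype.card_fin] at this
  gcongr

lemma RR_le_QQ (ω : Fin k → Fin n) (a b : Fin k) : RR ω a b ≤ QQ ω a := by
  unfold RR QQ
  apply Finset.card_le_card
  intro c; simp; tauto

lemma sum_RR_coll (hn : 1 ≤ n) {a b : Fin k} (hab : a ≠ b) :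
    ∑ ω : Fin k → Fin n, (if ω b = ω a then (RR ω a b : ℝ) else 0) ≤ k * ((n:ℝ)^k / n) / n := by
  have : (0:ℝ) < n := by exact_mod_cast hn
  rw [le_div_iff₀ this, mul_comm, replace_lem hab (fun ω => (RR ω a b:ℝ))]
  refine le_trans (Finset.sum_le_sum fun ω _ => ?_) (sum_QQ hn a)
  have : RR (Function.update ω b (ω a)) a b = RR ω a b := by
    unfold RR
    congr 1
    ext c
    simp only [Finset.mem_filter, Finset.mem_univ, true_and]
    constructor <;> rintro ⟨h1, h2, h3⟩ <;> refine ⟨h1, h2, ?_⟩ <;> simpa [hab, h2] using h3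
  rw [this]
  exact_mod_cast RR_le_QQ ω a b


lemma CW (ω : Fin k → Fin n) :
    0 ≤ (1/2) * ∑ q ∈ (Finset.univ : Finset (Fin k)).offDiag, (if ω q.2 = ω q.1 then (1:ℝ) else 0) - (DD ω).card ∧
    (1/2) * ∑ q ∈ (Finset.univ : Finset (Fin k)).offDiag, (if ω q.2 = ω q.1 then (1:ℝ) else 0) - (DD ω).card
      ≤ (1/3) * ∑ q ∈ (Finset.univ : Finset (Fin k)).offDiag, (if ω q.2 = ω q.1 then (RR ω q.1 q.2:ℝ) else 0) := by
  set N : Fin n → ℕ := fun v => (Finset.univ.filter fun i : Fin k => ω i = v).card with hN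
  have gen : ∀ F : Fin k × Fin k → ℝ, ∀ φ : Fin n → ℝ, 
      (∀ a b, a ≠ b → ω b = ω a → F (a,b) = φ (ω a)) →
      ∑ q ∈ (Finset.univ : Finset (Fin k)).offDiag, (if ω q.2 = ω q.1 then F q else 0)
        = ∑ v, (N v : ℝ) * ((N v:ℝ) - 1) * φ v := by
    intro F φ hF
    rw [← Finset.sum_filter]
    rw [← Finset.sum_fiberwise (s := Finset.univ.offDiag.filter fun q : Fin k × Fin k => ω q.2 = ω q.1) (g := fun q => ω q.1)]
    refine Finset.sum_congr rfl fun v _ => ?_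
    have e : ((Finset.univ.offDiag.filter fun q : Fin k × Fin k => ω q.2 = ω q.1).filter fun q => ω q.1 = v)
      = (Finset.univ.filter fun i : Fin k => ω i = v).offDiag := by
      ext ⟨a, b⟩
      simp only [Finset.mem_filter, Finset.mem_offDiag, Finset.mem_univ, true_and]
      constructor
      · rintro ⟨⟨h1, h2⟩, h3⟩; exact ⟨h3, h2.trans h3, h1⟩
      · rintro ⟨h1, h2, h3⟩; exact ⟨⟨h3, h2.trans h1.symm⟩, h1⟩
    rw [e]
    rw [Finset.sum_congr rfl (g := fun _ => φ v)]
    · rw [Finset.sum_const, Finset.offDiag_card, nsmul_eq_mul, Nat.cast_sub (Nat.le_mul_self _)]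
      push_cast
      simp only [hN]; ring
    · rintro ⟨a, b⟩ h
      simp only [Finset.mem_offDiag, Finset.mem_filter, Finset.mem_univ, true_and] at h
      rw [hF a b h.2.2 (h.2.1.trans h.1.symm), h.1]
  have hRR : ∀ a b, a ≠ b → ω b = ω a → (RR ω a b : ℝ) = (N (ω a) : ℝ) - 2 := by
    intro a b hab h
    have e : (Finset.univ.filter fun c : Fin k => c ≠ a ∧ c ≠ b ∧ ω c = ω a) 
      = ((Finset.univ.filter fun i : Fin k => ω i = ω a).erase a).erase b := by
      ext c; simp; tauto
    have c1 : (((Finset.univ.filter fun i : Fin k => ω i = ω a).erase a).erase b).card + 1 = ((Finset.univ.filter fun i : Fin k => ω i = ω a).erase a).card :=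
      Finset.card_erase_add_one (by simp [hab.symm, h])
    have c2 : ((Finset.univ.filter fun i : Fin k => ω i = ω a).erase a).card + 1 = N (ω a) :=
      Finset.card_erase_add_one (by simp)
    have : RR ω a b + 2 = N (ω a) := by unfold RR; rw [e]; omega
    rw [← this]; push_cast; ring
  have eW : ((DD ω).card : ℝ) = ∑ v, if 2 ≤ N v then (1:ℝ) else 0 := by
    rw [Finset.sum_boole]; rfl
  rw [gen (fun _ => 1) (fun _ => 1) (fun _ _ _ _ => rfl), gen (fun q => (RR ω q.1 q.2:ℝ)) (fun v => (N v:ℝ) - 2) hRR, eW,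
    Finset.mul_sum, Finset.mul_sum, ← Finset.sum_sub_distrib]
  constructor
  · refine Finset.sum_nonneg fun v _ => ?_
    generalize N v = m
    split_ifs with h
    · have : (2:ℝ) ≤ m := by exact_mod_cast h
      nlinarith
    · interval_cases m <;> norm_num
  · refine Finset.sum_le_sum fun v _ => ?_
    generalize N v = m
    split_ifs with h
    · obtain ⟨r, rfl⟩ := Nat.exists_eq_add_of_le h
      push_cast
      rcases Nat.eq_zero_or_pos r with rfl | hr
      · norm_num
      · have h1 : (1:ℝ) ≤ r := by exact_mod_cast hr
        have h3 : (0:ℝ) ≤ r * ((r:ℝ) - 1) * (2 * r + 5) :=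
          mul_nonneg (mul_nonneg (by linarith) (by linarith)) (by linarith)
        linarith
    · interval_cases m <;> norm_num

end comb
lemma lip_of_incr {g : ℕ → ℝ} {M : ℝ} (hg : ∀ j, |g (j+1) - g j| ≤ M) (i d : ℕ) :
    |g (i + d) - g i| ≤ M * d := by
  induction d with
  | zero => simp
  | succ d ih =>
    have h := abs_add_le (g (i + d + 1) - g (i+d)) (g (i+d) - g i)
    have h2 := hg (i+d)
    rw [sub_add_sub_cancel] at h
    rw [← add_assoc]
    push_cast
    linarith

lemma main_sum {k n : ℕ} (hn : 1 ≤ n) {l M p : ℝ} (hl : l = (k:ℝ)^2 / (2 * n)) (hM : 0 ≤ M)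
    (A : Set ℕ) (g : ℕ → ℝ)
    (hst : ∀ j : ℕ, l * g (j+1) - j * g j = A.indicator 1 j - p)
    (hg : ∀ j, |g j| ≤ M) (hdg : ∀ j, |g (j+1) - g j| ≤ M) :
    |∑ ω : Fin k → Fin n, (A.indicator (1 : ℕ → ℝ) (DD ω).card - p)| ≤
      M * (n:ℝ)^k * ((k:ℝ)^3 / n^2 + k / (2 * n) + k^3 / (3 * n^2)) := by
  have hn0 : (0:ℝ) < n := by exact_mod_cast hn
  set P := (Finset.univ : Finset (Fin k)).offDiag with hP
  have hPc : (P.card : ℝ) = (k:ℝ)^2 - k := by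
    rw [hP, Finset.offDiag_card, Nat.cast_sub (Nat.le_mul_self _)]
    simp [sq]
  have hCard : ∑ ω : Fin k → Fin n, (1:ℝ) = (n:ℝ)^k := by simp
  set Cc : (Fin k → Fin n) → ℝ := fun ω => (1/2) * ∑ q ∈ P, (if ω q.2 = ω q.1 then (1:ℝ) else 0) with hCc
  set S1 := ∑ ω : Fin k → Fin n, (k / (2 * n) : ℝ) * g ((DD ω).card + 1) with hS1
  set S3 := ∑ ω : Fin k → Fin n, (Cc ω - (DD ω).card) * g (DD ω).card with hS3
  set S2 := (1 / (2 * n) : ℝ) * ∑ q ∈ P, ∑ ω : Fin k → Fin n,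
    (g ((DD ω).card + 1) - g (DD (Function.update ω q.2 (ω q.1))).card) with hS2
  have hne : ∀ q ∈ P, q.1 ≠ q.2 := fun q hq => (Finset.mem_offDiag.1 hq).2.2
  have e1 : ∑ ω : Fin k → Fin n, Cc ω * g (DD ω).card = 
      (1 / (2 * n) : ℝ) * ∑ q ∈ P, ∑ ω : Fin k → Fin n, g (DD (Function.update ω q.2 (ω q.1))).card := by
    rw [← Finset.sum_congr rfl (fun q hq => replace_lem (n := n) (hne q hq) (fun ω => g (DD ω).card)),
      ← Finset.mul_sum, Finset.sum_comm]
    rw [← mul_assoc, show (1 / (2 * n) * n : ℝ) = 1/2 by field_simp, Finset.mul_sum]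
    refine Finset.sum_congr rfl fun ω _ => ?_
    simp only [hCc]
    rw [mul_assoc, Finset.sum_mul]
    congr 1
    refine Finset.sum_congr rfl fun q _ => ?_
    split_ifs <;> simp
  have hdecomp : ∑ ω : Fin k → Fin n, (A.indicator (1 : ℕ → ℝ) (DD ω).card - p) = S1 + S2 + S3 := by
    have e2 : S2 = ∑ ω : Fin k → Fin n, (((k:ℝ)^2 - k) / (2 * n)) * g ((DD ω).card + 1) - 
        ∑ ω : Fin k → Fin n, Cc ω * g (DD ω).card := by
      rw [e1, hS2]
      simp only [Finset.sum_sub_distrib]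
      rw [mul_sub, Finset.sum_const, nsmul_eq_mul, hPc, ← Finset.mul_sum]
      ring
    rw [e2, hS1, hS3, ← Finset.sum_sub_distrib, ← Finset.sum_add_distrib, ← Finset.sum_add_distrib]
    refine Finset.sum_congr rfl fun ω _ => ?_
    rw [← hst, hl]
    field_simp
    ring
  have b1 : |S1| ≤ M * (n:ℝ)^k * (k / (2 * n)) := by
    rw [hS1, ← Finset.mul_sum, abs_mul, abs_of_nonneg (show (0:ℝ) ≤ k / (2*n) by positivity)]
    have : |∑ ω : Fin k → Fin n, g ((DD ω).card + 1)| ≤ M * (n:ℝ)^k := by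
      refine (Finset.abs_sum_le_sum_abs _ _).trans ?_
      refine (Finset.sum_le_sum fun ω _ => hg _).trans ?_
      rw [← hCard, Finset.mul_sum]; simp
    rw [mul_comm]
    gcongr
  have b3 : |S3| ≤ M * (n:ℝ)^k * (k^3 / (3 * n^2)) := by
    have h1 : |S3| ≤ ∑ ω : Fin k → Fin n, M * ((1/3) * ∑ q ∈ P, (if ω q.2 = ω q.1 then (RR ω q.1 q.2:ℝ) else 0)) := by
      refine (Finset.abs_sum_le_sum_abs _ _).trans ?_
      refine Finset.sum_le_sum fun ω _ => ?_
      have h := CW ω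
      rw [abs_mul, abs_of_nonneg h.1, mul_comm]
      exact mul_le_mul (hg _) h.2 h.1 hM
    refine h1.trans ?_
    rw [← Finset.mul_sum, ← Finset.mul_sum, Finset.sum_comm]
    have h2 : ∑ q ∈ P, ∑ ω : Fin k → Fin n, (if ω q.2 = ω q.1 then (RR ω q.1 q.2:ℝ) else 0)
        ≤ (k:ℝ)^2 * (k * ((n:ℝ)^k / n) / n) := by
      refine (Finset.sum_le_sum fun q hq => sum_RR_coll hn (hne q hq)).trans ?_
      rw [Finset.sum_const, nsmul_eq_mul, hPc]
      have : (0:ℝ) ≤ k := by positivity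
      gcongr; linarith
    calc _ ≤ M * (1/3 * ((k:ℝ)^2 * (k * ((n:ℝ)^k / n) / n))) := by gcongr
      _ = _ := by field_simp
  have b2 : |S2| ≤ M * (n:ℝ)^k * ((k:ℝ)^3 / n^2) := by
    rw [hS2, abs_mul, abs_of_nonneg (show (0:ℝ) ≤ 1 / (2*n) by positivity)]
    have h2 : ∀ q ∈ P, |∑ ω : Fin k → Fin n,
        (g ((DD ω).card + 1) - g (DD (Function.update ω q.2 (ω q.1))).card)| ≤
        M * (2 * (k * ((n:ℝ)^k / n))) := by
      intro q hq
      refine (Finset.abs_sum_le_sum_abs _ _).trans ?_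
      have h3 : ∀ ω : Fin k → Fin n, |g ((DD ω).card + 1) - g (DD (Function.update ω q.2 (ω q.1))).card|
          ≤ M * ((QQ ω q.1 : ℝ) + QQ ω q.2) := by
        intro ω
        obtain ⟨h4, h5⟩ := DD_update ω (hne q hq)
        obtain ⟨d, hd⟩ := Nat.exists_eq_add_of_le h4
        rw [hd]
        refine (lip_of_incr hdg _ _).trans ?_
        have h6 := RR_le_QQ ω q.1 q.2
        have : d ≤ QQ ω q.1 + QQ ω q.2 := by omega
        have : (d:ℝ) ≤ (QQ ω q.1 : ℝ) + QQ ω q.2 := by exact_mod_cast this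
        gcongr
      refine (Finset.sum_le_sum fun ω _ => h3 ω).trans ?_
      rw [← Finset.mul_sum, Finset.sum_add_distrib]
      have := sum_QQ (n := n) hn q.1
      have := sum_QQ (n := n) hn q.2
      gcongr
      linarith
    have h3 : |∑ q ∈ P, ∑ ω : Fin k → Fin n,
        (g ((DD ω).card + 1) - g (DD (Function.update ω q.2 (ω q.1))).card)| ≤
        (k:ℝ)^2 * (M * (2 * (k * ((n:ℝ)^k / n)))) := by
      refine (Finset.abs_sum_le_sum_abs _ _).trans ?_
      refine (Finset.sum_le_sum h2).trans ?_
      rw [Finset.sum_const, nsmul_eq_mul, hPc]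
      have : (0:ℝ) ≤ k := by positivity
      gcongr; linarith
    calc _ ≤ 1 / (2 * n) * ((k:ℝ)^2 * (M * (2 * (k * ((n:ℝ)^k / n))))) := by gcongr
      _ = _ := by field_simp
  rw [hdecomp]
  have t1 := abs_add_le (S1 + S2) S3
  have t2 := abs_add_le S1 S2
  linarith

lemma poisson_apply {l : ℝ} (hl : 0 < l) (A : Set ℕ) :
    (poissonMeasure l A).toReal = ∑' i, A.indicator (pp l) i := by
  have e : poissonMeasure l A = ∑' i, ENNReal.ofReal (A.indicator (pp l) i) := by
    unfold poissonMeasure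
    rw [Measure.sum_apply _ (MeasurableSet.of_discrete)]
    refine tsum_congr fun i => ?_
    rw [Measure.smul_apply, Measure.dirac_apply]
    by_cases h : i ∈ A <;> simp [h, pp]
  have h0 : ∀ i, 0 ≤ A.indicator (pp l) i :=
    fun i => Set.indicator_nonneg (fun i _ => (pp_pos hl i).le) i
  have hs : Summable (A.indicator (pp l)) := (pp_hasSum l).summable.indicator A
  rw [e, ← ENNReal.ofReal_tsum_of_nonneg h0 hs, ENNReal.toReal_ofReal (tsum_nonneg h0)]

lemma alloc_apply (k n : ℕ) (A : Set ℕ) :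
    (((uniformAlloc k n).map (fun ω => (DD ω).card)) A).toReal =
      (∑ ω : Fin k → Fin n, A.indicator (1 : ℕ → ℝ) (DD ω).card) / (n:ℝ)^k := by
  classical
  have : MeasurableSingletonClass (Fin n) := ⟨fun _ => trivial⟩
  rw [Measure.map_apply (measurable_of_finite _) MeasurableSet.of_discrete]
  unfold uniformAlloc
  rw [Measure.smul_apply, Measure.count_apply_finite _ (Set.toFinite _)]
  simp only [Fintype.card_fun, Fintype.card_fin, smul_eq_mul, ENNReal.toReal_mul, ENNReal.toReal_inv]
  simp only [Set.indicator, Pi.one_apply]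
  rw [Finset.sum_boole, inv_mul_eq_div]
  simp

/-- Birthday problem: drop `k ≥ 1` balls independently and uniformly into `n ≥ 1` boxes,
let `W` be the number of boxes containing at least two balls and `θ = k/√n`.  Then
`‖L(W) - Poi_{θ²/2}‖_TV ≤ min(1, √2 θ⁻¹) [(19θ³ + 6θ)/(12√n) + θ²/(2n)]`. -/
theorem birthday_poisson_approx (k n : ℕ) (hk : 1 ≤ k) (hn : 1 ≤ n)
    (θ : ℝ) (hθ : θ = k / Real.sqrt n) :
    ∀ A : Set ℕ,
      |(((uniformAlloc k n).map (fun ω =>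
          (Finset.univ.filter fun b : Fin n =>
            2 ≤ (Finset.univ.filter fun i : Fin k => ω i = b).card).card)) A).toReal -
        (poissonMeasure (θ ^ 2 / 2) A).toReal| ≤
      min 1 (Real.sqrt 2 * θ⁻¹) *
        ((19 * θ ^ 3 + 6 * θ) / (12 * Real.sqrt n) + θ ^ 2 / (2 * n)) := by
  intro A
  have hn0 : (0:ℝ) < n := by exact_mod_cast hn
  have hk0 : (0:ℝ) < k := by exact_mod_cast hk
  have hs0 : 0 < Real.sqrt n := Real.sqrt_pos.2 hn0
  have hss : Real.sqrt n ^ 2 = n := Real.sq_sqrt hn0.le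
  have hθ0 : 0 < θ := by rw [hθ]; positivity
  have hl : 0 < θ ^ 2 / 2 := by positivity
  have hle : θ ^ 2 / 2 = (k:ℝ)^2 / (2 * n) := by
    rw [hθ, div_pow, hss]; field_simp
  have hMe : 1 / Real.sqrt (θ ^ 2 / 2) = Real.sqrt 2 * θ⁻¹ := by
    rw [Real.sqrt_div' _ (by norm_num), Real.sqrt_sq hθ0.le]
    field_simp
  obtain ⟨g, h1, h2, h3⟩ := stein hl A
  rw [hMe] at h2 h3
  set M := min 1 (Real.sqrt 2 * θ⁻¹) with hMd
  have hM : 0 ≤ M := by rw [hMd]; positivity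
  have hmain := main_sum hn hle hM A g h1 h2 h3
  have ha := alloc_apply k n A
  unfold DD at ha
  rw [ha, poisson_apply hl]
  set p := ∑' i, A.indicator (pp (θ ^ 2 / 2)) i
  have hC : (0:ℝ) < (n:ℝ)^k := by positivity
  rw [Finset.sum_sub_distrib] at hmain
  simp only [Finset.sum_const, Finset.card_univ, Fintype.card_fun, Fintype.card_fin, nsmul_eq_mul] at hmain
  push_cast at hmain
  unfold DD at hmain
  rw [div_sub' hC.ne', abs_div, abs_of_pos hC, div_le_iff₀ hC]
  refine hmain.trans ?_
  have e : (19 * θ ^ 3 + 6 * θ) / (12 * Real.sqrt n) = 19 * (k:ℝ)^3 / (12 * n^2) + k / (2 * n) := by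
    rw [hθ]
    have h4 : (n:ℝ)^2 = Real.sqrt n ^ 4 := by
      rw [show Real.sqrt n ^ 4 = (Real.sqrt n ^ 2) ^ 2 by ring, hss]
    have h5 : (k:ℝ) / (2 * n) = k / (2 * Real.sqrt n ^ 2) := by rw [hss]
    rw [h4, h5]
    field_simp
    ring
  rw [e, mul_assoc, mul_assoc]
  refine mul_le_mul_of_nonneg_left ?_ hM
  rw [mul_comm]
  refine mul_le_mul_of_nonneg_right ?_ hC.le
  have e2 : 19 * (k:ℝ)^3 / (12 * n^2) = (k:ℝ)^3 / n^2 + k^3 / (3 * n^2) + k^3/(4 * n^2) := by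
    field_simp; ring
  have e3 : 0 ≤ (k:ℝ)^3/(4 * n^2) := by positivity
  have e4 : 0 ≤ θ ^ 2 / (2 * n) := by positivity
  linarith
end

section
/- For every θ > 0 there exists a constant C > 0 such that for all n ≥ 1 the following holds: drop k = ⌊θ n^{2/3}⌋ balls independently and uniformly into n boxes (b_1, …, b_k i.i.d. uniform on {1, …, n}), and let W = #{(i,j,l) : 1 ≤ i < j < l ≤ k, b_i = b_j = b_l} be the number of triples of balls sharing a box. Then ‖L(W) - Poi_λ‖_TV ≤ C · n^{-1/3}, where λ = C(k,3)/n² (C(k,3) the binomial coefficient). -/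
open MeasureTheory

namespace TB
open Finset

variable {ι : Type} [Fintype ι] [DecidableEq ι] {n : ℕ}

def cst (α : Finset ι) (ω : ι → Fin n) : Prop := ∀ i ∈ α, ∀ j ∈ α, ω i = ω j

instance (α : Finset ι) (ω : ι → Fin n) : Decidable (cst α ω) := by unfold cst; infer_instance

theorem indep (α : Finset ι) (hα : α.Nonempty) (g : (ι → Fin n) → ℝ)
    (hg : ∀ ω ω' : ι → Fin n, (∀ i, i ∉ α → ω i = ω' i) → g ω = g ω') :
    (n : ℝ) ^ α.card * ∑ ω, (if cst α ω then g ω else 0) = n * ∑ ω, g ω := by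
  classical
  obtain ⟨i0, hi0⟩ := hα
  let e := Equiv.piEquivPiSubtypeProd (fun i => i ∈ α) (fun _ : ι => Fin n)
  rcases Nat.eq_zero_or_pos n with rfl | hn
  · have : IsEmpty (ι → Fin 0) := ⟨fun f => (f i0).elim0⟩
    simp
  let z : Fin n := ⟨0, hn⟩
  let z' : {i // i ∈ α} → Fin n := fun _ => z
  have h1 : ∀ (a : {i // i ∈ α} → Fin n) b, g (e.symm (a, b)) = g (e.symm (z', b)) := by
    intro a b
    apply hg
    intro i hi
    simp [e, Equiv.piEquivPiSubtypeProd, hi]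
  have h2 : ∀ (a : {i // i ∈ α} → Fin n) b,
      cst α (e.symm (a, b)) ↔ ∃ c : Fin n, a = fun _ => c := by
    intro a b
    constructor
    · intro h
      refine ⟨a ⟨i0, hi0⟩, ?_⟩
      funext i
      have := h i.1 i.2 i0 hi0
      simpa [e, Equiv.piEquivPiSubtypeProd, hi0] using this
    · rintro ⟨c, rfl⟩ i hi j hj
      simp [e, Equiv.piEquivPiSubtypeProd, hi, hj]
  have h3 : (univ.filter fun a : {i // i ∈ α} → Fin n => ∃ c : Fin n, a = fun _ => c).card = n := by
    have : (univ.filter fun a : {i // i ∈ α} → Fin n => ∃ c : Fin n, a = fun _ => c)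
        = univ.image (fun (c : Fin n) (_ : {i // i ∈ α}) => c) := by
      ext a; simp [eq_comm]
    rw [this, card_image_of_injective]
    · simp
    · intro c d h
      exact congrFun h ⟨i0, hi0⟩
  have key : ∀ F : (ι → Fin n) → ℝ, ∑ ω, F ω = ∑ b, ∑ a, F (e.symm (a, b)) := by
    intro F
    rw [← Equiv.sum_comp e.symm F, Fintype.sum_prod_type_right]
  rw [key, key, mul_sum, mul_sum]
  refine sum_congr rfl fun b _ => ?_
  simp only [h2, h1 _ b]
  rw [← sum_filter, sum_const, sum_const, h3]
  simp
  ring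

theorem prob (α : Finset ι) (hα : α.Nonempty) :
    (n : ℝ) ^ α.card * ∑ ω : ι → Fin n, (if cst α ω then (1:ℝ) else 0)
      = n * n ^ Fintype.card ι := by
  rw [indep α hα (fun _ => 1) (fun _ _ _ => rfl)]
  simp

theorem cst_union {α β : Finset ι} (h : ¬ Disjoint α β) (ω : ι → Fin n) :
    cst (α ∪ β) ω ↔ cst α ω ∧ cst β ω := by
  rw [Finset.not_disjoint_iff] at h
  obtain ⟨c, hc, hc'⟩ := h
  constructor
  · intro h
    exact ⟨fun i hi j hj => h i (mem_union_left _ hi) j (mem_union_left _ hj),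
      fun i hi j hj => h i (mem_union_right _ hi) j (mem_union_right _ hj)⟩
  · rintro ⟨h1, h2⟩ i hi j hj
    have : ∀ i ∈ α ∪ β, ω i = ω c := by
      intro i hi
      rcases mem_union.1 hi with hi | hi
      · exact h1 i hi c hc
      · exact h2 i hi c hc'
    rw [this i hi, this j hj]

/-- number of monochromatic triples -/
def W (ω : ι → Fin n) : ℕ := ((powersetCard 3 (univ : Finset ι)).filter fun α => cst α ω).card
def V (α : Finset ι) (ω : ι → Fin n) : ℕ :=
  ((powersetCard 3 (univ : Finset ι)).filter fun β => Disjoint α β ∧ cst β ω).card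

theorem V_indep (α : Finset ι) (ω ω' : ι → Fin n) (h : ∀ i, i ∉ α → ω i = ω' i) :
    V α ω = V α ω' := by
  unfold V
  congr 1
  apply filter_congr
  intro β _
  have : ∀ (hd : Disjoint α β), ∀ i ∈ β, ω i = ω' i := fun hd i hi =>
    h i (fun hi' => (Finset.disjoint_left.1 hd) hi' hi)
  constructor
  · rintro ⟨hd, hc⟩
    exact ⟨hd, fun i hi j hj => by rw [← this hd i hi, ← this hd j hj]; exact hc i hi j hj⟩
  · rintro ⟨hd, hc⟩
    exact ⟨hd, fun i hi j hj => by rw [this hd i hi, this hd j hj]; exact hc i hi j hj⟩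

/-- neighbours -/
def B (α : Finset ι) : Finset (Finset ι) :=
  (powersetCard 3 (univ : Finset ι)).filter fun β => ¬ Disjoint α β

theorem W_eq (α : Finset ι) (ω : ι → Fin n) :
    W ω = V α ω + ((B α).filter fun β => cst β ω).card := by
  unfold W V B
  rw [filter_filter, ← card_union_of_disjoint]
  · congr 1
    ext β
    simp only [mem_union, mem_filter]
    tauto
  · rw [Finset.disjoint_left]
    intro β h1 h2
    simp only [mem_filter] at h1 h2
    tauto

theorem diff_bound (f : ℕ → ℝ) (F : ℝ) (hf : ∀ j, |f j| ≤ F) (a b c : ℕ) (h : c = 0 → a = b) :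
    |f a - f b| ≤ 2 * F * c := by
  have hF : 0 ≤ F := (abs_nonneg _).trans (hf 0)
  rcases Nat.eq_zero_or_pos c with hc | hc
  · rw [h hc, hc]; simp
  · have : (1:ℝ) ≤ c := by exact_mod_cast hc
    calc |f a - f b| ≤ |f a| + |f b| := abs_sub _ _
      _ ≤ 2 * F * 1 := by linarith [hf a, hf b]
      _ ≤ _ := by gcongr

theorem main_ineq (hn : 0 < n) (f : ℕ → ℝ) (F : ℝ) (hf : ∀ j, |f j| ≤ F) :
    |∑ ω : ι → Fin n, ((W ω : ℝ) * f (W ω)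
       - ((Fintype.card ι).choose 3 : ℝ) / n ^ 2 * f (W ω + 1))| ≤
    2 * F * n ^ Fintype.card ι *
      (∑ α ∈ powersetCard 3 (univ : Finset ι), ∑ β ∈ (B α).erase α, (n : ℝ) / n ^ (α ∪ β).card
       + ∑ α ∈ powersetCard 3 (univ : Finset ι), ((B α).card : ℝ) / n ^ 4) := by
  have hn' : (0:ℝ) < n := by exact_mod_cast hn
  have hF : 0 ≤ F := (abs_nonneg _).trans (hf 0)
  have e1 : ∑ ω : ι → Fin n, ((W ω : ℝ) * f (W ω)
       - ((Fintype.card ι).choose 3 : ℝ) / n ^ 2 * f (W ω + 1)) =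
      ∑ α ∈ powersetCard 3 (univ : Finset ι), ∑ ω : ι → Fin n,
        ((if cst α ω then f (W ω) else 0) - 1 / n ^ 2 * f (W ω + 1)) := by
    rw [sum_comm]
    refine sum_congr rfl fun ω _ => ?_
    rw [sum_sub_distrib, ← sum_filter, sum_const, sum_const, card_powersetCard]
    simp only [nsmul_eq_mul, card_univ, W]
    ring
  rw [e1]
  rw [← sum_add_distrib, mul_sum]
  refine (abs_sum_le_sum_abs _ _).trans (sum_le_sum fun α hα => ?_)
  have hα3 : α.card = 3 := (mem_powersetCard.1 hα).2
  have hαne : α.Nonempty := by rw [← card_pos]; omega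
  have hαB : α ∈ B α := by
    simp only [B, mem_filter]
    refine ⟨hα, ?_⟩
    rw [disjoint_self]; exact hαne.ne_empty
  have i1 := indep α hαne (fun ω : ι → Fin n => f (V α ω + 1))
    (fun ω ω' h => by simp only [V_indep α ω ω' h])
  rw [hα3] at i1
  have i2 : ∑ ω : ι → Fin n, (if cst α ω then f (V α ω + 1) else 0)
      = ∑ ω : ι → Fin n, 1 / (n:ℝ) ^ 2 * f (V α ω + 1) := by
    rw [← mul_sum]
    field_simp
    apply mul_left_cancel₀ hn'.ne'
    linarith
  have e2 : ∑ ω : ι → Fin n, ((if cst α ω then f (W ω) else 0) - 1 / n ^ 2 * f (W ω + 1)) =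
    ∑ ω : ι → Fin n, ((if cst α ω then f (W ω) - f (V α ω + 1) else 0)
        + 1 / (n:ℝ) ^ 2 * (f (V α ω + 1) - f (W ω + 1))) := by
    rw [← sub_eq_zero, ← sum_sub_distrib]
    rw [← sub_eq_zero, ← sum_sub_distrib] at i2
    rw [← neg_eq_zero, ← sum_neg_distrib] at i2 
    rw [← neg_eq_zero, ← sum_neg_distrib] 
    rw [← i2]
    refine sum_congr rfl fun ω _ => ?_
    split_ifs <;> ring
  rw [e2]
  have pt : ∀ ω : ι → Fin n, |(if cst α ω then f (W ω) - f (V α ω + 1) else 0)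
        + 1 / (n:ℝ) ^ 2 * (f (V α ω + 1) - f (W ω + 1))| ≤
      2 * F * (∑ β ∈ (B α).erase α, (if cst (α ∪ β) ω then 1 else 0)
        + 1 / (n:ℝ)^2 * ∑ β ∈ B α, if cst β ω then 1 else 0) := by
    intro ω
    have hW := W_eq α ω
    refine (abs_add_le _ _).trans ?_
    rw [mul_add]
    refine add_le_add ?_ ?_
    · split_ifs with h
      · refine (diff_bound f F hf _ _ (((B α).erase α).filter fun β => cst β ω).card ?_).trans ?_
        · intro h0
          rw [hW, ← insert_erase hαB, filter_insert, if_pos h, card_insert_of_notMem, h0]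
          simp
        · rw [← sum_filter, sum_const, nsmul_eq_mul, mul_one]
          apply le_of_eq
          congr 3
          apply filter_congr
          intro β hβ
          rw [cst_union (mem_filter.1 (mem_erase.1 hβ).2).2]
          simp [h]
      · rw [abs_zero]
        apply mul_nonneg (by positivity)
        apply sum_nonneg
        intros; split_ifs <;> norm_num
    · rw [abs_mul, abs_of_nonneg (by positivity : (0:ℝ) ≤ 1 / n ^ 2)]
      have := diff_bound f F hf (V α ω + 1) (W ω + 1) ((B α).filter fun β => cst β ω).card (by omega)
      rw [← sum_filter, sum_const, nsmul_eq_mul, mul_one]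
      refine (mul_le_mul_of_nonneg_left this (by positivity)).trans (le_of_eq ?_)
      ring
  refine (abs_sum_le_sum_abs _ _).trans ((sum_le_sum fun ω _ => pt ω).trans ?_)
  rw [← mul_sum, sum_add_distrib, ← mul_sum, sum_comm, sum_comm (t := B α)]
  have pr : ∀ γ : Finset ι, γ.Nonempty → ∑ ω : ι → Fin n, (if cst γ ω then (1:ℝ) else 0)
      = n ^ Fintype.card ι * (n / n ^ γ.card) := by
    intro γ hγ
    have := prob (n := n) γ hγ
    field_simp
    linarith
  have s1 : ∑ β ∈ (B α).erase α, ∑ ω : ι → Fin n, (if cst (α ∪ β) ω then (1:ℝ) else 0)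
     = n ^ Fintype.card ι * ∑ β ∈ (B α).erase α, (n : ℝ) / n ^ (α ∪ β).card := by
    rw [mul_sum]
    exact sum_congr rfl fun β _ => pr _ (hαne.mono subset_union_left)
  have s2 : ∑ β ∈ B α, ∑ ω : ι → Fin n, (if cst β ω then (1:ℝ) else 0)
     = n ^ Fintype.card ι * ((B α).card / n ^ 2) := by
    rw [sum_congr rfl (g := fun _ => (n:ℝ) ^ Fintype.card ι * (1 / n ^ 2))]
    · rw [sum_const, nsmul_eq_mul]; ring
    · intro β hβ
      have h3 : β.card = 3 := (mem_powersetCard.1 (mem_filter.1 hβ).1).2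
      rw [pr β (by rw [← card_pos]; omega), h3]
      field_simp
  rw [s1, s2]
  apply le_of_eq
  field_simp

theorem pair_sum (hι : 1 ≤ Fintype.card ι) (g : ℕ → ℝ) (hg : ∀ j, 0 ≤ g j) (s : Finset ℕ)
    (S : Finset (Finset ι × Finset ι)) (hS : ∀ p ∈ S, (p.1 ∪ p.2).card ∈ s) :
    ∑ p ∈ S, g (p.1 ∪ p.2).card ≤ ∑ m ∈ s, 4 ^ m * (Fintype.card ι : ℝ) ^ m * g m := by
  have h1 : S ⊆ (s.sigma (fun m => (powersetCard m (univ : Finset ι)))).biUnion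
      (fun x => x.2.powerset ×ˢ x.2.powerset) := by
    intro p hp
    simp only [mem_biUnion, mem_sigma, mem_product, mem_powerset, mem_powersetCard]
    exact ⟨⟨_, p.1 ∪ p.2⟩, ⟨hS p hp, subset_univ _, rfl⟩, subset_union_left, subset_union_right⟩
  have h2 : ∀ m ∈ s, ∑ p ∈ S.filter (fun p => (p.1 ∪ p.2).card = m), g (p.1 ∪ p.2).card
      ≤ 4 ^ m * (Fintype.card ι : ℝ) ^ m * g m := by
    intro m _
    have hc : (S.filter (fun p => (p.1 ∪ p.2).card = m)).card ≤ 4 ^ m * (Fintype.card ι) ^ m := by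
      have hsub : S.filter (fun p => (p.1 ∪ p.2).card = m) ⊆
          (powersetCard m (univ : Finset ι)).biUnion (fun x => x.powerset ×ˢ x.powerset) := by
        intro p hp
        simp only [mem_biUnion, mem_product, mem_powerset, mem_powersetCard]
        exact ⟨p.1 ∪ p.2, ⟨subset_univ _, (mem_filter.1 hp).2⟩, subset_union_left,
          subset_union_right⟩
      refine (card_le_card hsub).trans ((card_biUnion_le_card_mul _ _ (4 ^ m) ?_).trans ?_)
      · intro x hx
        rw [card_product, card_powerset, (mem_powersetCard.1 hx).2, ← mul_pow]
        norm_num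
      · rw [card_powersetCard, mul_comm, card_univ]
        exact Nat.mul_le_mul_left _ (Nat.choose_le_pow _ _)
    rw [sum_congr rfl (g := fun _ => g m), sum_const, nsmul_eq_mul]
    · exact mul_le_mul_of_nonneg_right (by exact_mod_cast hc) (hg m)
    · intro p hp
      rw [(mem_filter.1 hp).2]
  rw [← sum_fiberwise_of_maps_to hS]
  exact sum_le_sum h2

theorem union_card {α β : Finset ι} (hα : α.card = 3) (hβ : β ∈ B α) :
    (α ∪ β).card ∈ ({3, 4, 5} : Finset ℕ) ∧ (β ≠ α → (α ∪ β).card ∈ ({4, 5} : Finset ℕ)) := by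
  simp only [B, mem_filter, mem_powersetCard] at hβ
  have h1 := card_union_add_card_inter α β
  have h2 : 0 < (α ∩ β).card := by
    rw [card_pos, nonempty_iff_ne_empty]
    exact fun h => hβ.2 (disjoint_iff_inter_eq_empty.2 h)
  have h3 : (α ∩ β).card ≤ α.card := card_le_card inter_subset_left
  simp only [mem_insert, mem_singleton]
  refine ⟨by omega, fun hne => ?_⟩
  have : (α ∩ β).card ≠ 3 := by
    intro h
    apply hne
    have a1 : α ∩ β = α := eq_of_subset_of_card_le inter_subset_left (by omega)
    have a2 : α ∩ β = β := eq_of_subset_of_card_le inter_subset_right (by omega)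
    rw [← a2, a1]
  omega

theorem sums_bound (hι : 1 ≤ Fintype.card ι) (hn : 0 < n) :
    (∑ α ∈ powersetCard 3 (univ : Finset ι), ∑ β ∈ (B α).erase α, (n : ℝ) / n ^ (α ∪ β).card
       + ∑ α ∈ powersetCard 3 (univ : Finset ι), ((B α).card : ℝ) / n ^ 4) ≤
     256 * (Fintype.card ι : ℝ) ^ 4 / n ^ 3 + 3000 * (Fintype.card ι : ℝ) ^ 5 / n ^ 4 := by
  have hn' : (0:ℝ) < n := by exact_mod_cast hn
  have hk : (1:ℝ) ≤ Fintype.card ι := by exact_mod_cast hι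
  set k : ℝ := (Fintype.card ι : ℝ)
  have a1 := pair_sum hι (fun m => (n:ℝ) / n ^ m) (fun _ => by positivity) {4, 5}
    (((powersetCard 3 (univ : Finset ι)).sigma (fun α => (B α).erase α)).map
      (Equiv.sigmaEquivProd _ _).toEmbedding) (by
      intro p hp
      simp only [mem_map, mem_sigma] at hp
      obtain ⟨⟨a, b⟩, ⟨h1, h2⟩, rfl⟩ := hp
      exact (union_card (mem_powersetCard.1 h1).2 (mem_erase.1 h2).2).2 (mem_erase.1 h2).1)
  have a2 := pair_sum hι (fun m => (1:ℝ) / n ^ 4) (fun _ => by positivity) {3, 4, 5}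
    (((powersetCard 3 (univ : Finset ι)).sigma (fun α => (B α))).map
      (Equiv.sigmaEquivProd _ _).toEmbedding) (by
      intro p hp
      simp only [mem_map, mem_sigma] at hp
      obtain ⟨⟨a, b⟩, ⟨h1, h2⟩, rfl⟩ := hp
      exact (union_card (mem_powersetCard.1 h1).2 h2).1)
  rw [sum_map, sum_sigma] at a1 a2
  simp at a1 a2
  have b1 : k ^ 3 ≤ k ^ 5 := pow_le_pow_right₀ hk (by norm_num)
  have b2 : k ^ 4 ≤ k ^ 5 := pow_le_pow_right₀ hk (by norm_num)
  have c1 : 4 ^ 4 * k ^ 4 * (n / (n:ℝ) ^ 4) + 4 ^ 5 * k ^ 5 * (n / (n:ℝ) ^ 5)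
     = 256 * k ^ 4 / n ^ 3 + 1024 * k ^ 5 / n ^ 4 := by
    field_simp; ring
  have c2 : 4 ^ 3 * k ^ 3 * ((n:ℝ) ^ 4)⁻¹ + (4 ^ 4 * k ^ 4 * ((n:ℝ) ^ 4)⁻¹
     + 4 ^ 5 * k ^ 5 * ((n:ℝ) ^ 4)⁻¹)
     ≤ 1344 * k ^ 5 / n ^ 4 := by
    rw [div_eq_mul_inv, ← add_mul, ← add_mul]
    gcongr
    linarith
  have c3 : 1024 * k ^ 5 / n ^ 4 + 1344 * k ^ 5 / n ^ 4 ≤ 3000 * k ^ 5 / (n:ℝ) ^ 4 := by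
    rw [← add_div]
    gcongr
    nlinarith [pow_pos (lt_of_lt_of_le one_pos hk) 5]
  have c4 : ∑ α ∈ powersetCard 3 (univ : Finset ι), ((B α).card : ℝ) / n ^ 4
    = ∑ α ∈ powersetCard 3 (univ : Finset ι), ((B α).card : ℝ) * ((n:ℝ) ^ 4)⁻¹ := by
    simp only [div_eq_mul_inv]
  rw [c4]
  linarith
end TB
namespace TB

/-- Stein equation. -/
theorem stein (lam : ℝ) (hl : 0 ≤ lam) (h : ℕ → ℝ) (hh : ∀ i, |h i| ≤ 1)
    (h0 : ∑' i : ℕ, lam ^ i / (i.factorial : ℝ) * h i = 0) :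
    ∃ f : ℕ → ℝ, (∀ j, |f j| ≤ Real.exp lam) ∧
      ∀ j : ℕ, (j : ℝ) * f j - lam * f (j + 1) = h j := by
  have hexp : HasSum (fun m : ℕ => lam ^ m / (m.factorial : ℝ)) (Real.exp lam) := by
    rw [Real.exp_eq_exp_ℝ]
    exact NormedSpace.expSeries_div_hasSum_exp lam
  let g : ℕ → ℕ → ℝ := fun j m => (j.factorial : ℝ) * lam ^ m / ((j + 1 + m).factorial : ℝ) * h (j + 1 + m)
  have hb : ∀ j m, ‖g j m‖ ≤ lam ^ m / (m.factorial : ℝ) := by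
    intro j m
    simp only [g, Real.norm_eq_abs]
    rw [abs_mul, abs_of_nonneg (by positivity)]
    refine (mul_le_of_le_one_right (by positivity) (hh _)).trans ?_
    rw [div_le_div_iff₀ (by positivity) (by positivity)]
    have : ((j.factorial : ℝ) * m.factorial) ≤ (j + 1 + m).factorial := by
      have h1 : j.factorial * m.factorial ≤ (j + m).factorial :=
        Nat.le_of_dvd (Nat.factorial_pos _) (Nat.factorial_mul_factorial_dvd_factorial_add j m)
      have h2 : (j + m).factorial ≤ (j + 1 + m).factorial := Nat.factorial_le (by omega)
      exact_mod_cast h1.trans h2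
    have := mul_le_mul_of_nonneg_left this (by positivity : 0 ≤ lam ^ m)
    linarith
  have hs : ∀ j, Summable (g j) := fun j => Summable.of_norm_bounded hexp.summable (hb j)
  refine ⟨fun j => match j with | 0 => 0 | j + 1 => ∑' m, g j m, ?_, ?_⟩
  · intro j
    rcases j with _ | j
    · simp [Real.exp_nonneg]
    · exact tsum_of_norm_bounded hexp (hb j)
  · intro j
    rcases j with _ | j
    · have hs0 : Summable (fun i : ℕ => lam ^ i / (i.factorial : ℝ) * h i) := by
        refine Summable.of_norm_bounded hexp.summable fun i => ?_
        rw [Real.norm_eq_abs, abs_mul, abs_of_nonneg (by positivity)]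
        exact mul_le_of_le_one_right (by positivity) (hh _)
      rw [hs0.tsum_eq_zero_add] at h0
      have : ∑' i : ℕ, lam ^ (i+1) / ((i+1).factorial : ℝ) * h (i+1) = lam * ∑' m, g 0 m := by
        rw [← tsum_mul_left]
        refine tsum_congr fun i => ?_
        simp only [g, Nat.factorial_zero, Nat.cast_one, zero_add, Nat.add_comm 1 i]
        ring
      simp only [this] at h0
      simp at h0 ⊢
      linarith
    · have e : ((j + 1 : ℕ) : ℝ) * ∑' m, g j m = h (j + 1) + lam * ∑' m, g (j + 1) m := by
        rw [(hs j).tsum_eq_zero_add, mul_add, ← tsum_mul_left, ← tsum_mul_left]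
        congr 1
        · simp only [g, add_zero, pow_zero, mul_one, Nat.factorial_succ, Nat.cast_mul]
          have : (j.factorial : ℝ) ≠ 0 := by positivity
          field_simp
        · refine tsum_congr fun m => ?_
          simp only [g]
          rw [show j + 1 + (m + 1) = j + 1 + 1 + m by ring, Nat.factorial_succ j]
          push_cast
          ring
      show ((j + 1 : ℕ) : ℝ) * ∑' m, g j m - lam * ∑' m, g (j + 1) m = _
      rw [e]
      ring
end TB
namespace TB

theorem poisson_toReal (lam : ℝ) (hl : 0 ≤ lam) (A : Set ℕ) :
    HasSum (fun i : ℕ => lam ^ i / (i.factorial : ℝ) * A.indicator 1 i)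
      (Real.exp lam * (poissonMeasure lam A).toReal) := by
  have hexp : HasSum (fun m : ℕ => lam ^ m / (m.factorial : ℝ)) (Real.exp lam) := by
    rw [Real.exp_eq_exp_ℝ]
    exact NormedSpace.expSeries_div_hasSum_exp lam
  have hs : Summable (fun i : ℕ => lam ^ i / (i.factorial : ℝ) * A.indicator 1 i) := by
    refine Summable.of_norm_bounded hexp.summable fun i => ?_
    rw [Real.norm_eq_abs, abs_mul, abs_of_nonneg (by positivity)]
    refine mul_le_of_le_one_right (by positivity) ?_
    by_cases h : i ∈ A <;> simp [h]
  convert hs.hasSum using 1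
  rw [poissonMeasure, Measure.sum_apply _ (MeasurableSet.of_discrete), ENNReal.tsum_toReal_eq]
  · rw [← tsum_mul_left]
    refine tsum_congr fun i => ?_
    have : (0:ℝ) ≤ Real.exp (-lam) * lam ^ i / (Nat.factorial i) := by positivity
    simp only [Measure.smul_apply, smul_eq_mul, ENNReal.toReal_mul, ENNReal.toReal_ofReal this,
      Measure.dirac_apply]
    have e : Real.exp lam * Real.exp (-lam) = 1 := by rw [← Real.exp_add]; simp
    by_cases h : i ∈ A
    · simp [h]
      rw [← mul_div_assoc, ← mul_assoc, e, one_mul]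
    · simp [h]
  · intro i
    simp only [Measure.smul_apply, smul_eq_mul]
    exact ENNReal.mul_ne_top ENNReal.ofReal_ne_top (measure_ne_top _ _)

theorem alloc_toReal (k n : ℕ) (X : (Fin k → Fin n) → ℕ) (A : Set ℕ) :
    (((uniformAlloc k n).map X) A).toReal
      = ((n : ℝ) ^ k)⁻¹ * ∑ ω, A.indicator (1 : ℕ → ℝ) (X ω) := by
  classical
  have : DiscreteMeasurableSpace (Fin n) := ⟨fun _ => trivial⟩
  have hX : Measurable X := measurable_of_finite _
  rw [Measure.map_apply hX MeasurableSet.of_discrete, uniformAlloc, Measure.smul_apply,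
    Measure.count_apply (hX MeasurableSet.of_discrete)]
  have : (X ⁻¹' A).encard = ((Finset.univ.filter fun ω => X ω ∈ A).card : ℕ∞) := by
    rw [← Set.encard_coe_eq_coe_finsetCard]
    congr 1
    ext; simp
  rw [this]
  simp [Set.indicator_apply, Finset.sum_boole]

theorem W_bridge (k n : ℕ) (ω : Fin k → Fin n) :
    (Finset.univ.filter fun t : Fin k × Fin k × Fin k =>
       t.1 < t.2.1 ∧ t.2.1 < t.2.2 ∧ ω t.1 = ω t.2.1 ∧ ω t.2.1 = ω t.2.2).card = W ω := by
  unfold W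
  refine Finset.card_bij (fun t _ => {t.1, t.2.1, t.2.2}) ?_ ?_ ?_
  · rintro ⟨a, b, c⟩ h
    simp only [Finset.mem_filter, Finset.mem_univ, true_and] at h
    simp only [Finset.mem_filter, Finset.mem_powersetCard, Finset.subset_univ, true_and]
    obtain ⟨h1, h2, h3, h4⟩ := h
    refine ⟨Finset.card_eq_three.2 ⟨a, b, c, h1.ne, (h1.trans h2).ne, h2.ne, rfl⟩, ?_⟩
    have : ∀ i ∈ ({a, b, c} : Finset (Fin k)), ω i = ω b := by
      intro i hi
      simp only [Finset.mem_insert, Finset.mem_singleton] at hi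
      rcases hi with rfl | rfl | rfl
      · exact h3
      · rfl
      · exact h4.symm
    intro i hi j hj
    rw [this i hi, this j hj]
  · rintro ⟨a, b, c⟩ h ⟨a', b', c'⟩ h' he
    simp only [Finset.mem_filter, Finset.mem_univ, true_and] at h h' he
    obtain ⟨h1, h2, -, -⟩ := h
    obtain ⟨h1', h2', -, -⟩ := h'
    have ha : a ∈ ({a', b', c'} : Finset (Fin k)) := by rw [← he]; simp
    have hb : b ∈ ({a', b', c'} : Finset (Fin k)) := by rw [← he]; simp
    have hc : c ∈ ({a', b', c'} : Finset (Fin k)) := by rw [← he]; simp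
    simp only [Finset.mem_insert, Finset.mem_singleton] at ha hb hc
    simp only [Prod.mk.injEq]
    simp only [Fin.ext_iff, Fin.lt_def] at *
    omega
  · intro α hα
    simp only [Finset.mem_filter, Finset.mem_powersetCard, Finset.subset_univ, true_and] at hα
    obtain ⟨h3, hc⟩ := hα
    let e := α.orderEmbOfFin h3
    have hm : ∀ i, e i ∈ α := fun i => α.orderEmbOfFin_mem h3 i
    refine ⟨(e 0, e 1, e 2), ?_, ?_⟩
    · simp only [Finset.mem_filter, Finset.mem_univ, true_and]
      exact ⟨e.strictMono (by decide), e.strictMono (by decide), hc _ (hm _) _ (hm _),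
        hc _ (hm _) _ (hm _)⟩
    · apply Finset.eq_of_subset_of_card_le
      · intro x hx
        simp only [Finset.mem_insert, Finset.mem_singleton] at hx
        rcases hx with rfl | rfl | rfl <;> exact hm _
      · rw [h3]
        refine le_of_eq (Finset.card_eq_three.2 ⟨e 0, e 1, e 2, ?_, ?_, ?_, rfl⟩).symm <;>
        · exact fun h => absurd (e.injective h) (by decide)

theorem core (k n : ℕ) (hn : 0 < n) (hk : 1 ≤ k) (A : Set ℕ) (X : (Fin k → Fin n) → ℕ)
    (hX : ∀ ω, X ω = W ω) :
    |(((uniformAlloc k n).map X) A).toReal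
      - (poissonMeasure ((k.choose 3 : ℝ) / n ^ 2) A).toReal| ≤
    2 * Real.exp ((k.choose 3 : ℝ) / n ^ 2) *
      (256 * (k : ℝ) ^ 4 / n ^ 3 + 3000 * (k : ℝ) ^ 5 / n ^ 4) := by
  set lam : ℝ := (k.choose 3 : ℝ) / n ^ 2 with hlam
  have hn' : (0:ℝ) < n := by exact_mod_cast hn
  have hl : 0 ≤ lam := by positivity
  have hP := poisson_toReal lam hl A
  set P := (poissonMeasure lam A).toReal with hPdef
  have hexp : HasSum (fun m : ℕ => lam ^ m / (m.factorial : ℝ)) (Real.exp lam) := by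
    rw [Real.exp_eq_exp_ℝ]
    exact NormedSpace.expSeries_div_hasSum_exp lam
  have hP0 : 0 ≤ P := ENNReal.toReal_nonneg
  have hP1 : P ≤ 1 := by
    have : Real.exp lam * P ≤ Real.exp lam := by
      refine hasSum_le (fun i => ?_) hP hexp
      refine mul_le_of_le_one_right (by positivity) ?_
      by_cases h : i ∈ A <;> simp [h]
    nlinarith [Real.exp_pos lam]
  have h0 : HasSum (fun i : ℕ => lam ^ i / (i.factorial : ℝ) * (A.indicator 1 i - P)) 0 := by
    have := hP.sub (hexp.mul_right P)
    simpa [mul_sub] using this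
  obtain ⟨f, hf, hst⟩ := stein lam hl (fun i => A.indicator 1 i - P) (by
    intro i
    rw [abs_le]
    by_cases h : i ∈ A <;> simp [h] <;> constructor <;> linarith) h0.tsum_eq
  have hm := main_ineq (ι := Fin k) hn f _ hf
  simp only [Fintype.card_fin] at hm
  rw [← hlam] at hm
  simp only [hst] at hm
  have hb := sums_bound (ι := Fin k) (n := n) (by simpa using hk) hn
  simp only [Fintype.card_fin] at hb
  have hm2 := hm.trans (mul_le_mul_of_nonneg_left hb (by positivity))
  rw [alloc_toReal]
  have e : ((n : ℝ) ^ k)⁻¹ * ∑ ω, A.indicator (1 : ℕ → ℝ) (X ω) - P =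
     ((n : ℝ) ^ k)⁻¹ * ∑ ω : Fin k → Fin n, (A.indicator (1 : ℕ → ℝ) (W ω) - P) := by
    rw [Finset.sum_sub_distrib]
    simp only [hX, Finset.sum_const, Finset.card_univ, Fintype.card_fun, Fintype.card_fin,
      nsmul_eq_mul]
    push_cast
    field_simp
  rw [e, abs_mul, abs_of_nonneg (by positivity)]
  refine (mul_le_mul_of_nonneg_left hm2 (by positivity)).trans (le_of_eq ?_)
  field_simp

theorem core0 (n : ℕ) (A : Set ℕ) (X : (Fin 0 → Fin n) → ℕ) (hX : ∀ ω, X ω = W ω) :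
    |(((uniformAlloc 0 n).map X) A).toReal
      - (poissonMeasure (((0:ℕ).choose 3 : ℝ) / n ^ 2) A).toReal| ≤ 0 := by
  have h1 := poisson_toReal (((0:ℕ).choose 3 : ℝ) / n ^ 2) (by simp) A
  rw [alloc_toReal]
  have hW : ∀ ω : Fin 0 → Fin n, W ω = 0 := by 
    intro ω
    have h : Finset.powersetCard 3 (Finset.univ : Finset (Fin 0)) = ∅ :=
      Finset.powersetCard_eq_empty.2 (by simp)
    rw [W, h]
    rfl
  simp only [Nat.choose_zero_succ, Nat.cast_zero, zero_div, Real.exp_zero, one_mul] at h1 ⊢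
  have h2 : HasSum (fun i : ℕ => (0:ℝ) ^ i / (i.factorial : ℝ) * A.indicator 1 i)
      ((0:ℝ) ^ 0 / (Nat.factorial 0 : ℝ) * A.indicator 1 0) := by
    apply hasSum_single
    intro i hi
    simp [hi]
  rw [h1.unique h2]
  simp [hX, hW]

end TB

theorem triple_birthday_poisson_approx (θ : ℝ) (hθ : 0 < θ) :
    ∃ C : ℝ, 0 < C ∧ ∀ n : ℕ, 1 ≤ n →
      ∀ k : ℕ, k = ⌊θ * (n : ℝ) ^ ((2 : ℝ) / 3)⌋₊ →
      ∀ A : Set ℕ,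
        |(((uniformAlloc k n).map (fun ω =>
            (Finset.univ.filter fun t : Fin k × Fin k × Fin k =>
              t.1 < t.2.1 ∧ t.2.1 < t.2.2 ∧ ω t.1 = ω t.2.1 ∧ ω t.2.1 = ω t.2.2).card)) A).toReal -
          (poissonMeasure ((k.choose 3 : ℝ) / n ^ 2) A).toReal| ≤
        C * (n : ℝ) ^ (-(1 : ℝ) / 3) := by
  refine ⟨2 * Real.exp (θ ^ 3) * (256 * θ ^ 4 + 3000 * θ ^ 5), by positivity, ?_⟩
  intro n hn k hk A
  have hn1 : (1:ℝ) ≤ n := by exact_mod_cast hn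
  have hn0 : (0:ℝ) ≤ n := by linarith
  set x : ℝ := (n : ℝ) ^ ((1:ℝ) / 3) with hx
  have hx1 : 1 ≤ x := Real.one_le_rpow hn1 (by norm_num)
  have hx0 : 0 < x := by linarith
  have hx3 : (n : ℝ) = x ^ 3 := by
    rw [hx, ← Real.rpow_natCast, ← Real.rpow_mul hn0]; norm_num
  have hx2 : (n : ℝ) ^ ((2:ℝ) / 3) = x ^ 2 := by
    rw [hx, ← Real.rpow_natCast, ← Real.rpow_mul hn0]; norm_num
  have hxi : (n : ℝ) ^ (-(1:ℝ) / 3) = x⁻¹ := by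
    rw [hx, ← Real.rpow_neg hn0]; norm_num
  have hkx : (k : ℝ) ≤ θ * x ^ 2 := by
    rw [hk, hx2]; exact Nat.floor_le (by positivity)
  rw [hxi]
  clear hk
  rcases Nat.eq_zero_or_pos k with rfl | hkpos
  · refine (TB.core0 n A _ (fun ω => TB.W_bridge 0 n ω)).trans (by positivity)
  · refine (TB.core k n hn hkpos A _ (fun ω => TB.W_bridge k n ω)).trans ?_
    have hlam : (k.choose 3 : ℝ) / n ^ 2 ≤ θ ^ 3 := by
      rw [div_le_iff₀ (by positivity)]
      calc (k.choose 3 : ℝ) ≤ (k : ℝ) ^ 3 := by exact_mod_cast Nat.choose_le_pow _ _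
        _ ≤ (θ * x ^ 2) ^ 3 := by gcongr
        _ = θ ^ 3 * n ^ 2 := by rw [hx3]; ring
    have b1 : 256 * (k : ℝ) ^ 4 / n ^ 3 ≤ 256 * θ ^ 4 * x⁻¹ := by
      calc 256 * (k : ℝ) ^ 4 / n ^ 3 ≤ 256 * (θ * x ^ 2) ^ 4 / n ^ 3 := by gcongr
        _ = _ := by rw [hx3]; field_simp
    have b2 : 3000 * (k : ℝ) ^ 5 / n ^ 4 ≤ 3000 * θ ^ 5 * x⁻¹ := by
      calc 3000 * (k : ℝ) ^ 5 / n ^ 4 ≤ 3000 * (θ * x ^ 2) ^ 5 / n ^ 4 := by gcongr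
        _ = 3000 * θ ^ 5 * x⁻¹ * x⁻¹ := by rw [hx3]; field_simp
        _ ≤ _ := mul_le_of_le_one_right (by positivity) (inv_le_one_of_one_le₀ hx1)
    calc _ ≤ 2 * Real.exp (θ ^ 3) * (256 * θ ^ 4 * x⁻¹ + 3000 * θ ^ 5 * x⁻¹) := by gcongr
      _ = _ := by ring
end

section
/- For every θ ∈ ℝ there exists a constant C > 0 such that for all n ≥ 2 the following holds: drop k = ⌈n log n + θ n⌉ balls independently and uniformly into n boxes (b_1, …, b_k i.i.d. uniform on {1, …, n}), and let W be the number of empty boxes. Then ‖L(W) - Poi_{e^{-θ}}‖_TV ≤ C / √(log n). -/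
open MeasureTheory

open Finset in
lemma cc_count (k n r : ℕ) :
    ∑ ω : Fin k → Fin n,
      ((Finset.univ.filter fun b : Fin n => ∀ i : Fin k, ω i ≠ b).card.choose r) =
      n.choose r * (n - r) ^ k := by
  classical
  have h1 : ∀ ω : Fin k → Fin n,
      ((Finset.univ.filter fun b : Fin n => ∀ i : Fin k, ω i ≠ b).card.choose r) =
      ∑ T ∈ powersetCard r (univ : Finset (Fin n)), if ∀ i, ω i ∈ Tᶜ then 1 else 0 := by
    intro ω
    rw [← card_powersetCard, ← Finset.card_filter]
    congr 1
    ext T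
    simp only [mem_powersetCard, mem_filter, subset_univ, true_and, mem_compl]
    constructor
    · rintro ⟨h, hc⟩
      refine ⟨hc, fun i hi => ?_⟩
      have := h hi
      simp at this
      exact this i rfl
    · rintro ⟨hc, h⟩
      refine ⟨fun b hb => ?_, hc⟩
      simp only [mem_filter, mem_univ, true_and]
      rintro i rfl
      exact h i hb
  simp_rw [h1]
  rw [sum_comm]
  have h2 : ∀ T ∈ powersetCard r (univ : Finset (Fin n)),
      (∑ ω : Fin k → Fin n, if ∀ i, ω i ∈ Tᶜ then 1 else 0) = (n - r) ^ k := by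
    intro T hT
    rw [mem_powersetCard] at hT
    rw [← Finset.card_filter]
    have : (univ.filter fun ω : Fin k → Fin n => ∀ i, ω i ∈ Tᶜ) =
        Fintype.piFinset fun _ => Tᶜ := by
      ext ω; simp
    rw [this, Fintype.card_piFinset]
    simp [card_compl, hT.2]
  rw [sum_congr rfl h2]
  simp

lemma cc_newton (f : ℕ → ℝ) (hf : ∀ m, |f m| ≤ 1) :
    ∃ g : ℕ → ℝ, (∀ r, |g r| ≤ 2 ^ r) ∧
      ∀ m, f m = ∑ r ∈ Finset.range (m + 1), (m.choose r : ℝ) * g r := by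
  refine ⟨fun r => ((fwdDiff 1)^[r] f) 0, ?_, ?_⟩
  · have : ∀ r y, |((fwdDiff 1)^[r] f) y| ≤ 2 ^ r := by
      intro r
      induction r with
      | zero => intro y; simpa using hf y
      | succ r ih =>
        intro y
        rw [Function.iterate_succ_apply', fwdDiff]
        have h1 := abs_le.1 (ih (y + 1))
        have h2 := abs_le.1 (ih y)
        rw [abs_le, pow_succ]
        constructor <;> linarith
    intro r; exact this r 0
  · intro m
    have := shift_eq_sum_fwdDiff_iter 1 f m 0
    simpa using this

/-- factorial moments of the number of empty boxes -/
noncomputable def ccS (k n r : ℕ) : ℝ := (n.choose r : ℝ) * ((n - r : ℕ) : ℝ) ^ k / (n : ℝ) ^ k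

lemma cc_alloc (k n : ℕ) (f g : ℕ → ℝ)
    (hg : ∀ m, f m = ∑ r ∈ Finset.range (m + 1), (m.choose r : ℝ) * g r) :
    (∑ ω : Fin k → Fin n,
      f ((Finset.univ.filter fun b : Fin n => ∀ i : Fin k, ω i ≠ b).card)) / (n : ℝ) ^ k
     = ∑ r ∈ Finset.range (n + 1), g r * ccS k n r := by
  have h1 : ∀ m ≤ n, f m = ∑ r ∈ Finset.range (n + 1), (m.choose r : ℝ) * g r := by
    intro m hm
    rw [hg]
    apply Finset.sum_subset
    · intro x; simp; omega
    · intro x _ hx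
      simp at hx
      rw [Nat.choose_eq_zero_of_lt (by omega)]; simp
  have h2 : ∀ ω : Fin k → Fin n,
      (Finset.univ.filter fun b : Fin n => ∀ i : Fin k, ω i ≠ b).card ≤ n := by
    intro ω
    simpa using Finset.card_filter_le (Finset.univ : Finset (Fin n)) (fun b => ∀ i : Fin k, ω i ≠ b)
  rw [Finset.sum_congr rfl (fun ω _ => h1 _ (h2 ω)), Finset.sum_comm, Finset.sum_div]
  refine Finset.sum_congr rfl fun r _ => ?_
  rw [← Finset.sum_mul, ← Nat.cast_sum, cc_count]
  unfold ccS
  push_cast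
  ring

lemma cc_summable (x : ℝ) (hx : 0 ≤ x) (f : ℕ → ℝ) (c : ℝ) (hf : ∀ r, |f r| ≤ c ^ r) (_hc : 0 ≤ c) :
    Summable fun r => ‖f r * (x ^ r / (r.factorial : ℝ))‖ := by
  refine Summable.of_nonneg_of_le (fun _ => norm_nonneg _) (fun r => ?_)
    (Real.summable_pow_div_factorial (c * x))
  rw [Real.norm_eq_abs, abs_mul, abs_of_nonneg (by positivity : (0:ℝ) ≤ x ^ r / (r.factorial : ℝ)),
    mul_pow, mul_div_assoc]
  exact mul_le_mul_of_nonneg_right (hf r) (by positivity)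

lemma cc_poisson (lam : ℝ) (hl : 0 ≤ lam) (f g : ℕ → ℝ) 
    (hb : ∀ r, |g r| ≤ 2 ^ r)
    (hg : ∀ m, f m = ∑ r ∈ Finset.range (m + 1), (m.choose r : ℝ) * g r) :
    ∑' m, (Real.exp (-lam) * lam ^ m / (m.factorial : ℝ)) * f m =
      ∑' r, g r * (lam ^ r / (r.factorial : ℝ)) := by
  have hs := cc_summable lam hl g 2 hb (by norm_num)
  have hs2 := cc_summable lam hl (fun _ => 1) 1 (by simp) (by norm_num)
  have key := tsum_mul_tsum_eq_tsum_sum_antidiagonal_of_summable_norm hs hs2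
  have he : ∑' r : ℕ, (1:ℝ) * (lam ^ r / (r.factorial : ℝ)) = Real.exp lam := by
    rw [Real.exp_eq_exp_ℝ, NormedSpace.exp_eq_tsum_div]; simp
  rw [he] at key
  have h3 : ∀ m : ℕ, ∑ kl ∈ Finset.HasAntidiagonal.antidiagonal m, g kl.1 * (lam ^ kl.1 / (kl.1.factorial : ℝ)) *
      (1 * (lam ^ kl.2 / (kl.2.factorial : ℝ))) = lam ^ m / (m.factorial : ℝ) * f m := by
    intro m
    rw [hg, Finset.Nat.sum_antidiagonal_eq_sum_range_succ_mk, Finset.mul_sum]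
    refine Finset.sum_congr rfl fun r hr => ?_
    have hr : r ≤ m := by simp at hr; omega
    rw [Nat.cast_choose ℝ hr]
    have e : lam ^ m = lam ^ r * lam ^ (m - r) := by rw [← pow_add]; congr 1; omega
    rw [e]
    have := Nat.factorial_ne_zero r
    have := Nat.factorial_ne_zero m
    have := Nat.factorial_ne_zero (m - r)
    field_simp
  simp_rw [h3] at key
  have : ∀ m : ℕ, (Real.exp (-lam) * lam ^ m / (m.factorial : ℝ)) * f m =
    Real.exp (-lam) * (lam ^ m / (m.factorial : ℝ) * f m) := by intro m; ring
  simp_rw [this]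
  rw [tsum_mul_left, ← key, mul_comm, mul_assoc, ← Real.exp_add]
  simp

lemma cc_S_upper (k n r : ℕ) (θ : ℝ) (hn : 0 < n) (hk : (n : ℝ) * Real.log n + θ * n ≤ k) :
    ccS k n r ≤ Real.exp (-θ) ^ r / (r.factorial : ℝ) := by
  unfold ccS
  rcases lt_or_ge n r with h | h
  · rw [Nat.choose_eq_zero_of_lt h]; simp; positivity
  have hn' : (0:ℝ) < n := by exact_mod_cast hn
  rw [mul_div_assoc, ← div_pow, Nat.cast_sub h]
  have h1 : (n.choose r : ℝ) ≤ (n:ℝ) ^ r / (r.factorial : ℝ) := Nat.choose_le_pow_div r n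
  have h2 : (((n:ℝ) - r) / n) ^ k ≤ Real.exp (-(r / n)) ^ k := by
    have : (0:ℝ) ≤ n - r := by rw [sub_nonneg]; exact_mod_cast h
    apply pow_le_pow_left₀ (by positivity)
    have := Real.add_one_le_exp (-((r:ℝ) / n))
    have e : ((n:ℝ) - r) / n = -((r:ℝ) / n) + 1 := by field_simp; ring
    rw [e]; exact this
  have h3 : Real.exp (-(r / n)) ^ k ≤ Real.exp (-θ) ^ r / (n:ℝ) ^ r := by
    have : (n:ℝ) ^ r = Real.exp (Real.log n) ^ r := by rw [Real.exp_log hn']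
    rw [this, ← Real.exp_nat_mul, ← Real.exp_nat_mul, ← Real.exp_nat_mul, ← Real.exp_sub,
      Real.exp_le_exp]
    have h4 : Real.log n + θ ≤ k / n := by
      rw [le_div_iff₀ hn']; linarith
    have h5 := mul_le_mul_of_nonneg_left h4 (Nat.cast_nonneg (α := ℝ) r)
    have e : (k:ℝ) * -(r / n) = -(r * (k / n)) := by ring
    rw [e]; linarith
  calc _ ≤ (n:ℝ) ^ r / (r.factorial : ℝ) * (Real.exp (-θ) ^ r / (n:ℝ) ^ r) := by
        apply mul_le_mul h1 (h2.trans h3) _ (by positivity)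
        have : (0:ℝ) ≤ n - r := by rw [sub_nonneg]; exact_mod_cast h
        positivity
    _ = _ := by field_simp

lemma cc_prod3 (a b c x y z : ℝ) (ha : 0 ≤ a) (hb : 0 ≤ b) (hc : 0 ≤ c) 
    (hxa : 1 - x ≤ a) (hyb : 1 - y ≤ b) (hzc : 1 - z ≤ c) (hx : 0 ≤ x) (hy : 0 ≤ y) (hz : 0 ≤ z) :
    1 - (x + y + z) ≤ a * b * c := by
  rcases le_or_gt 1 (x + y + z) with h | h
  · have : 0 ≤ a * b * c := by positivity
    linarith
  have h1 : (1 - x) * (1 - y) * (1 - z) ≤ a * b * c := by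
    have : 0 ≤ 1 - x := by linarith
    have : 0 ≤ 1 - y := by linarith
    have : 0 ≤ 1 - z := by linarith
    gcongr
  have h2 : 1 - (x + y) ≤ (1 - x) * (1 - y) := by nlinarith
  have h3 : (1 - (x + y)) * (1 - z) ≤ (1 - x) * (1 - y) * (1 - z) :=
    mul_le_mul_of_nonneg_right h2 (by linarith)
  nlinarith [mul_nonneg (add_nonneg hx hy) hz]

lemma cc_S_lower (k n r : ℕ) (θ : ℝ) (hn : 0 < n) (hk : (k : ℝ) ≤ (n : ℝ) * Real.log n + θ * n + 1) :
    Real.exp (-θ) ^ r / (r.factorial : ℝ) * (1 - (r:ℝ) ^ 2 * (2 / n + k / n ^ 2)) ≤ ccS k n r := by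
  have hn' : (0:ℝ) < n := by exact_mod_cast hn
  have hn1 : (1:ℝ) ≤ n := by exact_mod_cast hn
  rcases lt_or_ge n r with h | h
  · have h0 : 0 ≤ ccS k n r := by unfold ccS; positivity
    refine le_trans ?_ h0
    apply mul_nonpos_of_nonneg_of_nonpos (by positivity)
    have hr : (n:ℝ) ≤ r := by exact_mod_cast h.le
    have : (1:ℝ) ≤ r ^ 2 * (2 / n) := by
      rw [mul_div_assoc', le_div_iff₀ hn']; nlinarith
    have : (0:ℝ) ≤ r ^ 2 * (k / n ^ 2) := by positivity
    linarith
  have hrn : (r:ℝ) ≤ n := by exact_mod_cast h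
  set x : ℝ := r / n with hx
  have hx0 : 0 ≤ x := by positivity
  have hx1 : x ≤ 1 := by rw [hx, div_le_one hn']; exact hrn
  -- a
  have ha : 1 - (r:ℝ) ^ 2 / n ≤ (n.choose r : ℝ) * r.factorial / n ^ r := by
    have h1 : ((n + 1 - r : ℕ) : ℝ) ^ r ≤ (n.choose r : ℝ) * r.factorial := by
      have := Nat.pow_sub_le_descFactorial n r
      rw [Nat.descFactorial_eq_factorial_mul_choose] at this
      rw [mul_comm]
      exact_mod_cast this
    have h2 : (1 - x) ^ r ≤ (n.choose r : ℝ) * r.factorial / n ^ r := by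
      rw [le_div_iff₀ (by positivity), ← mul_pow]
      refine le_trans ?_ h1
      apply pow_le_pow_left₀ (mul_nonneg (by linarith) hn'.le)
      rw [Nat.cast_sub (by omega)]
      push_cast
      have : (1 - x) * n = n - r := by rw [hx]; field_simp
      linarith
    have h3 := one_add_mul_le_pow (a := -x) (by linarith) r
    have e : 1 - (r:ℝ) ^ 2 / n = 1 + r * (-x) := by rw [hx]; ring
    rw [e]
    exact h3.trans (by rw [← sub_eq_add_neg]; exact h2)
  have hb : 1 - (k:ℝ) * x ^ 2 ≤ (1 - x ^ 2) ^ k := by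
    have h3 := one_add_mul_le_pow (a := -x ^ 2) (by nlinarith) k
    calc _ = 1 + (k:ℝ) * (-x ^ 2) := by ring
      _ ≤ _ := h3
      _ = _ := by ring
  have hc : 1 - x ≤ Real.exp (-x) := by linarith [Real.add_one_le_exp (-x)]
  have hp := cc_prod3 _ _ _ _ _ _ (by positivity) (by apply pow_nonneg; nlinarith) (by positivity) ha hb hc
    (by positivity) (by positivity) (by positivity)
  have hd : (1 - x ^ 2) ^ k * Real.exp (-x) * (Real.exp (-θ) ^ r / n ^ r) ≤ (((n - r : ℕ) : ℝ) / n) ^ k := by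
    have e1 : ((n - r : ℕ) : ℝ) / n = 1 - x := by
      rw [Nat.cast_sub h, hx]; field_simp
    rw [e1]
    have h1 : Real.exp (-x) * (Real.exp (-θ) ^ r / n ^ r) ≤ Real.exp (-x) ^ k := by
      have : (n:ℝ) ^ r = Real.exp (Real.log n) ^ r := by rw [Real.exp_log hn']
      rw [this, ← Real.exp_nat_mul, ← Real.exp_nat_mul, ← Real.exp_nat_mul, ← Real.exp_sub,
        ← Real.exp_add, Real.exp_le_exp]
      have h5 := mul_le_mul_of_nonneg_right hk hx0
      have e : ((n : ℝ) * Real.log n + θ * n + 1) * x = r * Real.log n + r * θ + x := by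
        rw [hx]; field_simp
      rw [e] at h5
      linarith
    have h2 : (1 - x ^ 2) * Real.exp (-x) ≤ 1 - x := by
      have : (1 + x) * Real.exp (-x) ≤ 1 := by
        have := Real.add_one_le_exp x
        calc _ ≤ Real.exp x * Real.exp (-x) := by gcongr; linarith
          _ = 1 := by rw [← Real.exp_add]; simp
      nlinarith
    calc _ = (1 - x ^ 2) ^ k * (Real.exp (-x) * (Real.exp (-θ) ^ r / n ^ r)) := by ring
      _ ≤ (1 - x ^ 2) ^ k * Real.exp (-x) ^ k := by
        apply mul_le_mul_of_nonneg_left h1 (by apply pow_nonneg; nlinarith)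
      _ = ((1 - x ^ 2) * Real.exp (-x)) ^ k := by rw [mul_pow]
      _ ≤ _ := by
        apply pow_le_pow_left₀ (mul_nonneg (by nlinarith) (by positivity)) h2
  have hS : ccS k n r = (n.choose r : ℝ) * (((n - r : ℕ) : ℝ) / n) ^ k := by
    unfold ccS; rw [div_pow]; ring
  rw [hS]
  have hq : (r:ℝ) ^ 2 / n + k * x ^ 2 + x ≤ (r:ℝ) ^ 2 * (2 / n + k / n ^ 2) := by
    have : x ≤ (r:ℝ) ^ 2 / n := by
      rw [hx]; gcongr
      rcases Nat.eq_zero_or_pos r with h0 | h0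
      · simp [h0]
      · have : (1:ℝ) ≤ r := by exact_mod_cast h0
        nlinarith
    have e : (r:ℝ) ^ 2 * (2 / n + k / n ^ 2) = (r:ℝ) ^ 2 / n + k * x ^ 2 + (r:ℝ) ^ 2 / n := by
      rw [hx]; ring
    rw [e]; linarith
  calc _ ≤ Real.exp (-θ) ^ r / (r.factorial : ℝ) * ((n.choose r : ℝ) * r.factorial / n ^ r * (1 - x ^ 2) ^ k * Real.exp (-x)) := by
        apply mul_le_mul_of_nonneg_left _ (by positivity)
        linarith
    _ = (n.choose r : ℝ) * ((1 - x ^ 2) ^ k * Real.exp (-x) * (Real.exp (-θ) ^ r / n ^ r)) := by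
        have := Nat.factorial_ne_zero r
        field_simp
    _ ≤ _ := mul_le_mul_of_nonneg_left hd (by positivity)

lemma cc_map (k n : ℕ) (A : Set ℕ) :
    (((uniformAlloc k n).map (fun ω =>
            (Finset.univ.filter fun b : Fin n => ∀ i : Fin k, ω i ≠ b).card)) A).toReal =
    (∑ ω : Fin k → Fin n,
      A.indicator (fun _ => (1:ℝ)) ((Finset.univ.filter fun b : Fin n => ∀ i : Fin k, ω i ≠ b).card)) / (n : ℝ) ^ k := by
  classical
  rw [Measure.map_apply (measurable_of_finite _) (MeasurableSet.of_discrete)]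
  unfold uniformAlloc
  rw [Measure.smul_apply, Measure.count_apply (Set.toFinite _).measurableSet, Set.encard_eq_coe_toFinset_card]
  simp only [smul_eq_mul, ENNReal.toReal_mul, ENNReal.toReal_inv, Fintype.card_fun, Fintype.card_fin]
  simp only [Set.indicator_apply, Finset.sum_boole]
  rw [div_eq_inv_mul]
  congr 1
  · simp
  · simp

lemma cc_pmeas (lam : ℝ) (hl : 0 ≤ lam) (A : Set ℕ) :
    (poissonMeasure lam A).toReal =
    ∑' m, (Real.exp (-lam) * lam ^ m / (m.factorial : ℝ)) * A.indicator (fun _ => (1:ℝ)) m := by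
  unfold poissonMeasure
  rw [Measure.sum_apply _ MeasurableSet.of_discrete, ENNReal.tsum_toReal_eq]
  · refine tsum_congr fun m => ?_
    rw [Measure.smul_apply, Measure.dirac_apply, smul_eq_mul, ENNReal.toReal_mul,
      ENNReal.toReal_ofReal (by positivity)]
    congr 1
    by_cases h : m ∈ A <;> simp [h]
  · intro m
    rw [Measure.smul_apply, Measure.dirac_apply, smul_eq_mul]
    by_cases h : m ∈ A <;> simp [h]

lemma cc_main_bound (θ : ℝ) : ∃ K : ℝ, 0 ≤ K ∧ ∀ n k : ℕ, 0 < n → 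
    (n : ℝ) * Real.log n + θ * n ≤ k → (k : ℝ) ≤ (n : ℝ) * Real.log n + θ * n + 1 → ∀ A : Set ℕ,
        |(((uniformAlloc k n).map (fun ω =>
            (Finset.univ.filter fun b : Fin n => ∀ i : Fin k, ω i ≠ b).card)) A).toReal -
          (poissonMeasure (Real.exp (-θ)) A).toReal| ≤ K * (2 / n + k / n ^ 2) := by
  set lam := Real.exp (-θ) with hlam
  have hl : 0 ≤ lam := (Real.exp_pos _).le
  -- r^2 <= 4^r
  have h4 : ∀ r : ℕ, |(2:ℝ) ^ r * (r:ℝ) ^ 2| ≤ 8 ^ r := by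
    intro r
    have : (r:ℝ) ≤ 2 ^ r := by exact_mod_cast Nat.lt_two_pow_self.le
    rw [abs_of_nonneg (by positivity)]
    calc (2:ℝ) ^ r * (r:ℝ) ^ 2 ≤ 2 ^ r * (2 ^ r) ^ 2 := by gcongr
      _ = 8 ^ r := by rw [← pow_mul, mul_comm r 2, pow_mul, ← mul_pow]; norm_num
  have hsK := (cc_summable lam hl _ 8 h4 (by norm_num)).of_norm
  refine ⟨∑' r : ℕ, (2:ℝ) ^ r * (r:ℝ) ^ 2 * (lam ^ r / (r.factorial : ℝ)),
    tsum_nonneg fun r => by positivity, ?_⟩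
  intro n k hn hk1 hk2 A
  obtain ⟨g, hg2, hg⟩ := cc_newton (A.indicator fun _ => (1:ℝ))
    (fun m => by by_cases h : m ∈ A <;> simp [h])
  rw [cc_map, cc_pmeas _ hl, cc_poisson lam hl _ g hg2 hg, cc_alloc k n _ g hg]
  have hfin : ∑ r ∈ Finset.range (n + 1), g r * ccS k n r = ∑' r, g r * ccS k n r := by
    rw [tsum_eq_sum]
    intro r hr
    simp at hr
    simp [ccS, Nat.choose_eq_zero_of_lt (show n < r by omega)]
  have hs1 : Summable fun r => g r * ccS k n r := by
    apply summable_of_ne_finset_zero (s := Finset.range (n + 1))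
    intro r hr
    simp at hr
    simp [ccS, Nat.choose_eq_zero_of_lt (show n < r by omega)]
  have hs2 := (cc_summable lam hl g 2 hg2 (by norm_num)).of_norm
  rw [hfin, ← hs1.tsum_sub hs2, ← tsum_mul_right, ← Real.norm_eq_abs]
  refine tsum_of_norm_bounded (hsK.mul_right _).hasSum ?_
  intro r
  rw [← mul_sub, norm_mul, Real.norm_eq_abs, Real.norm_eq_abs]
  have hu := cc_S_upper k n r θ hn hk1
  have hlo := cc_S_lower k n r θ hn hk2
  rw [← hlam] at hu hlo
  have : |ccS k n r - lam ^ r / (r.factorial : ℝ)| ≤ lam ^ r / (r.factorial : ℝ) * ((r:ℝ) ^ 2 * (2 / n + k / n ^ 2)) := by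
    rw [abs_sub_comm, abs_of_nonneg (by linarith)]
    linarith
  calc _ ≤ 2 ^ r * (lam ^ r / (r.factorial : ℝ) * ((r:ℝ) ^ 2 * (2 / n + k / n ^ 2))) := 
        mul_le_mul (hg2 r) this (abs_nonneg _) (by positivity)
    _ = _ := by ring

lemma cc_triv (lam : ℝ) (hl : 0 ≤ lam) (k n : ℕ) (hn : 0 < n) (A : Set ℕ) :
        |(((uniformAlloc k n).map (fun ω =>
            (Finset.univ.filter fun b : Fin n => ∀ i : Fin k, ω i ≠ b).card)) A).toReal -
          (poissonMeasure lam A).toReal| ≤ 1 := by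
  have hi : ∀ m, 0 ≤ A.indicator (fun _ => (1:ℝ)) m ∧ A.indicator (fun _ => (1:ℝ)) m ≤ 1 := by
    intro m; by_cases h : m ∈ A <;> simp [h]
  have hn' : (0:ℝ) < n := by exact_mod_cast hn
  have h1 : (∑ ω : Fin k → Fin n,
      A.indicator (fun _ => (1:ℝ)) ((Finset.univ.filter fun b : Fin n => ∀ i : Fin k, ω i ≠ b).card)) / (n : ℝ) ^ k ≤ 1 := by
    rw [div_le_one (by positivity)]
    refine (Finset.sum_le_sum fun ω _ => (hi _).2).trans ?_
    simp
  have h1' : 0 ≤ (∑ ω : Fin k → Fin n,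
      A.indicator (fun _ => (1:ℝ)) ((Finset.univ.filter fun b : Fin n => ∀ i : Fin k, ω i ≠ b).card)) / (n : ℝ) ^ k := 
    div_nonneg (Finset.sum_nonneg fun ω _ => (hi _).1) (by positivity)
  have he : HasSum (fun m : ℕ => Real.exp (-lam) * lam ^ m / (m.factorial : ℝ)) 1 := by
    have h := (NormedSpace.expSeries_div_hasSum_exp lam).mul_left (Real.exp (-lam))
    rw [← Real.exp_eq_exp_ℝ, ← Real.exp_add] at h
    simpa [mul_div_assoc] using h
  have hle : ∀ m, (Real.exp (-lam) * lam ^ m / (m.factorial : ℝ)) * A.indicator (fun _ => (1:ℝ)) m ≤ Real.exp (-lam) * lam ^ m / (m.factorial : ℝ) :=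
    fun m => mul_le_of_le_one_right (by positivity) (hi m).2
  have h0 : ∀ m, 0 ≤ (Real.exp (-lam) * lam ^ m / (m.factorial : ℝ)) * A.indicator (fun _ => (1:ℝ)) m :=
    fun m => mul_nonneg (by positivity) (hi m).1
  have h2' := tsum_nonneg (L := SummationFilter.unconditional ℕ) h0
  have h2 := (Summable.of_nonneg_of_le h0 hle he.summable).tsum_le_tsum hle he.summable
  rw [he.tsum_eq] at h2
  rw [cc_map, cc_pmeas _ hl, abs_le]
  constructor <;> linarith

/-- Coupon collector's problem: for every `θ ∈ ℝ` there is `C > 0` so that for all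
`n ≥ 2`, dropping `k = ⌈n log n + θ n⌉` balls independently and uniformly into `n` boxes
and letting `W` be the number of empty boxes,
`‖L(W) - Poi_{e^{-θ}}‖_TV ≤ C / √(log n)`. -/
theorem coupon_collector_poisson_approx (θ : ℝ) :
    ∃ C : ℝ, 0 < C ∧ ∀ n : ℕ, 2 ≤ n →
      ∀ k : ℕ, k = ⌈(n : ℝ) * Real.log n + θ * n⌉₊ →
      ∀ A : Set ℕ,
        |(((uniformAlloc k n).map (fun ω =>
            (Finset.univ.filter fun b : Fin n => ∀ i : Fin k, ω i ≠ b).card)) A).toReal -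
          (poissonMeasure (Real.exp (-θ)) A).toReal| ≤
        C / Real.sqrt (Real.log n) := by
  obtain ⟨K, hK, hmain⟩ := cc_main_bound θ
  have hC : (0:ℝ) < 1 + |θ| + K * (4 + |θ|) := by positivity
  refine ⟨1 + |θ| + K * (4 + |θ|), hC, ?_⟩
  intro n hn k hk A
  have hn' : (2:ℝ) ≤ n := by exact_mod_cast hn
  have hlog : 0 < Real.log n := Real.log_pos (by linarith)
  set s := Real.sqrt (Real.log n) with hs
  have hs0 : 0 < s := Real.sqrt_pos.2 hlog
  have hss : s ^ 2 = Real.log n := Real.sq_sqrt hlog.le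
  rw [le_div_iff₀ hs0]
  rcases lt_or_ge ((n : ℝ) * Real.log n + θ * n) 0 with hneg | hpos
  · have ht := cc_triv (Real.exp (-θ)) (Real.exp_pos _).le k n (by omega) A
    have h1 : Real.log n + θ < 0 := by
      by_contra! h
      have : 0 ≤ (n:ℝ) * (Real.log n + θ) := mul_nonneg (by linarith) h
      linarith
    have h2 : s ≤ 1 + |θ| := by
      have := neg_abs_le θ
      nlinarith
    have h3 : 0 ≤ K * (4 + |θ|) := by positivity
    calc _ ≤ 1 * s := mul_le_mul_of_nonneg_right ht hs0.le
      _ ≤ _ := by linarith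
  · have hk1 : (n : ℝ) * Real.log n + θ * n ≤ k := by rw [hk]; exact Nat.le_ceil _
    have hk2 : (k : ℝ) ≤ (n : ℝ) * Real.log n + θ * n + 1 := by
      rw [hk]; exact (Nat.ceil_lt_add_one hpos).le
    have hb := hmain n k (by omega) hk1 hk2 A
    have h1 : (2 / n + k / n ^ 2 : ℝ) ≤ (s ^ 2 + |θ| + 3) / n := by
      have e : (2 / n + k / n ^ 2 : ℝ) = (2 + k / n) / n := by field_simp
      rw [e]
      apply div_le_div_of_nonneg_right _ (by linarith : (0:ℝ) ≤ n)
      have : (k:ℝ) / n ≤ s ^ 2 + |θ| + 1 := by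
        rw [div_le_iff₀ (by linarith), hss]
        have := le_abs_self θ
        nlinarith
      linarith
    have h2 : (s ^ 2 + |θ| + 3) * s ≤ (4 + |θ|) * n := by
      have h := Real.quadratic_le_exp_of_nonneg hlog.le
      rw [Real.exp_log (by linarith), ← hss] at h
      have h5 : s ≤ n := by nlinarith [sq_nonneg (s - 1), sq_nonneg (s^2)]
      have h6 : s ^ 3 ≤ n := by nlinarith [sq_nonneg (s - 1), sq_nonneg (s^2 - s)]
      have := abs_nonneg θ
      nlinarith
    have h3 : (2 / n + k / n ^ 2 : ℝ) * s ≤ 4 + |θ| := by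
      calc _ ≤ (s ^ 2 + |θ| + 3) / n * s := by gcongr
        _ = (s ^ 2 + |θ| + 3) * s / n := by ring
        _ ≤ _ := by rw [div_le_iff₀ (by linarith)]; exact h2
    calc _ ≤ K * (2 / n + k / n ^ 2) * s := mul_le_mul_of_nonneg_right hb hs0.le
      _ = K * ((2 / n + k / n ^ 2) * s) := by ring
      _ ≤ K * (4 + |θ|) := mul_le_mul_of_nonneg_left h3 hK
      _ ≤ _ := by have := abs_nonneg θ; linarith
end
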